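/- Let k be an integer with k ≥ 3 and let α ∈ ℝ^k. Suppose that there exists a natural number j with 2 ≤ j ≤ k such that, for some a ∈ ℤ and q ∈ ℕ with gcd(a,q) = 1, one has |α_j − a/q| ≤ q^{−2}. Then for every ε > 0 there is a constant C(k,ε) such that for all real X ≥ 1 one has |f_k(α;X)| ≤ C(k,ε) · X^{1+ε} · ( q^{−1} + X^{−1} + q·X^{−j} )^{σ(k)}, where σ(k) = 1/(2(k−1)(k−2)). -/

import Mathlib

/-- The Weyl sum `f k α X = ∑_{1 ≤ x ≤ X} e(α₁ x + … + α_k x^k)`, where the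
`j`-th coordinate of `α : Fin k → ℝ` is the coefficient of `x^(j+1)`. -/
noncomputable def fsum (k : ℕ) (α : Fin k → ℝ) (X : ℝ) : ℂ :=
  ∑ x ∈ Finset.Icc 1 ⌊X⌋₊,
    Complex.exp (2 * (Real.pi : ℂ) * Complex.I *
      ((∑ j : Fin k, α j * (x : ℝ) ^ ((j : ℕ) + 1) : ℝ) : ℂ))

namespace VMVT
open Finset

lemma mink2 {Ω : Type} [Fintype Ω] (s : ℕ) (hs : 1 ≤ s) (w : Ω → ℝ) (hw : ∀ α, 0 ≤ w α)
    (f g : Ω → ℝ) (hf : ∀ α, 0 ≤ f α) (hg : ∀ α, 0 ≤ g α) :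
    (∑ α, w α * (f α + g α) ^ s) ^ ((1 : ℝ) / s) ≤
      (∑ α, w α * f α ^ s) ^ ((1 : ℝ) / s) + (∑ α, w α * g α ^ s) ^ ((1 : ℝ) / s) := by
  have hs' : (1 : ℝ) ≤ s := by exact_mod_cast hs
  have hs0 : (s : ℝ) ≠ 0 := by positivity
  have key : ∀ h : Ω → ℝ, (∀ α, 0 ≤ h α) → ∀ α,
      w α * h α ^ s = (w α ^ ((1 : ℝ) / s) * h α) ^ (s : ℝ) := by
    intro h hh α
    rw [Real.mul_rpow (Real.rpow_nonneg (hw α) _) (hh α), ← Real.rpow_mul (hw α),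
      one_div_mul_cancel hs0, Real.rpow_one, Real.rpow_natCast]
  simp_rw [key f hf, key g hg, key (fun α => f α + g α) (fun α => add_nonneg (hf α) (hg α)), mul_add]
  exact Real.Lp_add_le_of_nonneg _ hs'
    (fun α _ => mul_nonneg (Real.rpow_nonneg (hw α) _) (hf α))
    (fun α _ => mul_nonneg (Real.rpow_nonneg (hw α) _) (hg α))

lemma mink {Ω κ : Type} [Fintype Ω] (s : ℕ) (hs : 1 ≤ s) (w : Ω → ℝ) (hw : ∀ α, 0 ≤ w α)
    (T : Finset κ) (h : κ → Ω → ℝ) (hh : ∀ i α, 0 ≤ h i α) :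
    (∑ α, w α * (∑ i ∈ T, h i α) ^ s) ^ ((1 : ℝ) / s) ≤
      ∑ i ∈ T, (∑ α, w α * h i α ^ s) ^ ((1 : ℝ) / s) := by
  classical
  induction T using Finset.induction_on with
  | empty =>
    have : (1 : ℝ) / s ≠ 0 := by positivity
    have h2 : s ≠ 0 := by omega
    simp [h2, Real.zero_rpow]
  | insert a T ha ih =>
    simp_rw [Finset.sum_insert ha]
    refine (mink2 s hs w hw _ _ (hh a) (fun α => Finset.sum_nonneg fun i _ => hh i α)).trans ?_
    gcongr

lemma hold {Ω : Type} [Fintype Ω] (w : Ω → ℝ) (hw : ∀ α, 0 ≤ w α) (u v : ℕ) (hu : 1 ≤ u)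
    (hv : 1 ≤ v) (g a b : Ω → ℝ) (hg : ∀ α, 0 ≤ g α) (ha : ∀ α, 0 ≤ a α) (hb : ∀ α, 0 ≤ b α)
    (h : ∀ α, g α ^ (u + v) = a α ^ u * b α ^ v) :
    (∑ α, w α * g α) ^ (u + v) ≤ (∑ α, w α * a α) ^ u * (∑ α, w α * b α) ^ v := by
  have hu' : (0 : ℝ) < u := by exact_mod_cast hu
  have hv' : (0 : ℝ) < v := by exact_mod_cast hv
  have hc : Real.HolderConjugate (((u : ℝ) + v) / u) (((u : ℝ) + v) / v) := by
    rw [Real.holderConjugate_iff]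
    constructor
    · rw [lt_div_iff₀ hu']; linarith
    · field_simp
  have hsum : (0 : ℝ) < (u : ℝ) + v := by positivity
  have hA : 0 ≤ ∑ α, w α * a α := Finset.sum_nonneg fun α _ => mul_nonneg (hw α) (ha α)
  have hB : 0 ≤ ∑ α, w α * b α := Finset.sum_nonneg fun α _ => mul_nonneg (hw α) (hb α)
  have hG : 0 ≤ ∑ α, w α * g α := Finset.sum_nonneg fun α _ => mul_nonneg (hw α) (hg α)
  have := Real.inner_le_Lp_mul_Lq_of_nonneg (s := Finset.univ)
    (f := fun α => (w α * a α) ^ ((u : ℝ) / (u + v)))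
    (g := fun α => (w α * b α) ^ ((v : ℝ) / (u + v))) hc
    (fun α _ => Real.rpow_nonneg (mul_nonneg (hw α) (ha α)) _)
    (fun α _ => Real.rpow_nonneg (mul_nonneg (hw α) (hb α)) _)
  have e1 : ∀ α, ((w α * a α) ^ ((u : ℝ) / (u + v))) ^ (((u : ℝ) + v) / u) = w α * a α := by
    intro α
    rw [← Real.rpow_mul (mul_nonneg (hw α) (ha α)), div_mul_div_cancel₀ hsum.ne', div_self hu'.ne',
      Real.rpow_one]
  have e2 : ∀ α, ((w α * b α) ^ ((v : ℝ) / (u + v))) ^ (((u : ℝ) + v) / v) = w α * b α := by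
    intro α
    rw [← Real.rpow_mul (mul_nonneg (hw α) (hb α)), div_mul_div_cancel₀ hsum.ne', div_self hv'.ne',
      Real.rpow_one]
  have e3 : ∀ α, (w α * a α) ^ ((u : ℝ) / (u + v)) * (w α * b α) ^ ((v : ℝ) / (u + v)) =
      w α * g α := by
    intro α
    have h0 : 0 ≤ w α * g α := mul_nonneg (hw α) (hg α)
    have : w α * g α = ((w α * g α) ^ (u + v)) ^ ((1 : ℝ) / (u + v)) := by
      rw [← Real.rpow_natCast, ← Real.rpow_mul h0]
      push_cast
      rw [mul_one_div_cancel hsum.ne', Real.rpow_one]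
    rw [this, mul_pow, h α, pow_add, mul_mul_mul_comm, ← mul_pow, ← mul_pow,
      Real.mul_rpow (pow_nonneg (mul_nonneg (hw α) (ha α)) _)
        (pow_nonneg (mul_nonneg (hw α) (hb α)) _), ← Real.rpow_natCast, ← Real.rpow_natCast,
      ← Real.rpow_mul (mul_nonneg (hw α) (ha α)), ← Real.rpow_mul (mul_nonneg (hw α) (hb α))]
    simp [div_eq_mul_inv]
  simp only [e1, e2, e3, one_div_div] at this
  calc (∑ α, w α * g α) ^ (u + v) ≤ _ := pow_le_pow_left₀ hG this _
    _ = _ := by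
      rw [mul_pow, ← Real.rpow_natCast, ← Real.rpow_natCast, ← Real.rpow_mul hA,
        ← Real.rpow_mul hB]
      push_cast
      rw [div_mul_cancel₀ _ hsum.ne', div_mul_cancel₀ _ hsum.ne', Real.rpow_natCast,
        Real.rpow_natCast]

/-- additive character on the reals -/
noncomputable def ee (z : ℝ) : ℂ := Complex.exp (2 * (Real.pi : ℂ) * Complex.I * (z : ℂ))

lemma ee_add (a b : ℝ) : ee (a + b) = ee a * ee b := by
  unfold ee; rw [← Complex.exp_add]; push_cast; ring_nf

@[simp] lemma ee_norm (a : ℝ) : ‖ee a‖ = 1 := by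
  unfold ee
  have : (2 * (Real.pi : ℂ) * Complex.I * (a : ℂ)) = ((2 * Real.pi * a : ℝ) : ℂ) * Complex.I := by
    push_cast; ring
  rw [this, Complex.norm_exp_ofReal_mul_I]

lemma ee_int (n : ℤ) : ee (n : ℝ) = 1 := by
  unfold ee
  rw [Complex.exp_eq_one_iff]
  exact ⟨n, by push_cast; ring⟩

lemma ee_zero : ee 0 = 1 := by simpa using ee_int 0

lemma ee_add_int (a : ℝ) (n : ℤ) : ee (a + n) = ee a := by rw [ee_add, ee_int, mul_one]

lemma ee_neg (a : ℝ) : ee (-a) = (starRingEnd ℂ) (ee a) := by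
  unfold ee
  rw [← Complex.exp_conj]
  simp [Complex.conj_ofNat]

lemma ee_eq_one {a : ℝ} (h : ee a = 1) : ∃ n : ℤ, a = n := by
  unfold ee at h
  rw [Complex.exp_eq_one_iff] at h
  obtain ⟨n, hn⟩ := h
  refine ⟨n, ?_⟩
  have h2 : (2 * (Real.pi : ℂ) * Complex.I) ≠ 0 := by
    simp [Real.pi_ne_zero]
  have : (a : ℂ) = n := by
    apply mul_left_cancel₀ h2; rw [hn]; ring
  exact_mod_cast this

/-- congruent numerators give the same character value -/
lemma ee_congr (p N : ℕ) (hp : 0 < p) {a b : ℤ} (h : ((p : ℤ) ^ N) ∣ a - b) :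
    ee ((a : ℝ) / (p : ℝ) ^ N) = ee ((b : ℝ) / (p : ℝ) ^ N) := by
  obtain ⟨c, hc⟩ := h
  have hp' : (p : ℝ) ^ N ≠ 0 := by positivity
  have : (a : ℝ) / (p : ℝ) ^ N = (b : ℝ) / (p : ℝ) ^ N + (c : ℤ) := by
    have h1 : (a : ℝ) = b + (p : ℝ) ^ N * c := by
      have : a = b + (p : ℤ) ^ N * c := by linarith
      rw [this]; push_cast; ring
    rw [h1]; field_simp
  rw [this, ee_add_int]
end VMVT

namespace VMVT
open Finset Polynomial

/-- partial exponential sum -/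
def fs {Ω : Type} (φ : ℕ → Ω → ℂ) (S : Finset ℕ) (α : Ω) : ℂ := ∑ i ∈ S, φ i α

/-- weighted norm -/
noncomputable def Nrm {Ω : Type} [Fintype Ω] (s : ℕ) (w : Ω → ℝ) (f : Ω → ℂ) : ℝ :=
  (∑ α, w α * (‖f α‖ ^ 2) ^ s) ^ ((1 : ℝ) / s)

/-- congruence class of an index -/
def cl (p a : ℕ) (x : ℕ → ℤ) (S : Finset ℕ) (i : ℕ) : Finset ℕ :=
  S.filter (fun j => (p : ℤ) ^ a ∣ x j - x i)

/-- partition into congruence classes -/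
def pt (p a : ℕ) (x : ℕ → ℤ) (S : Finset ℕ) : Finset (Finset ℕ) := S.image (cl p a x S)

/-- sum of the norms over classes -/
noncomputable def VV {Ω : Type} [Fintype Ω] (p n s : ℕ) (w : Ω → ℝ) (φ : ℕ → Ω → ℂ) (x : ℕ → ℤ)
    (S : Finset ℕ) : ℝ := ∑ C ∈ pt p n x S, Nrm s w (fs φ C)

/-- richness of symmetries -/
def Rich {Ω : Type} (p k N : ℕ) (w : Ω → ℝ) (φ : ℕ → Ω → ℂ) (x : ℕ → ℤ)
    (S : Finset ℕ) : Prop :=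
  ∀ P : ℤ[X], P.natDegree ≤ k → ∃ σ : Equiv.Perm Ω, (∀ α, w (σ α) = w α) ∧
    ∃ u : Ω → ℂ, (∀ α, ‖u α‖ = 1) ∧ ∀ i ∈ S, ∀ α,
      φ i (σ α) = u α * ee (((P.eval (x i) : ℤ) : ℝ) / (p : ℝ) ^ N) * φ i α

/-- triangular numbers -/
def sN (k : ℕ) : ℕ := k * (k + 1) / 2

lemma two_sN (k : ℕ) : 2 * sN k = k * (k + 1) :=
  Nat.mul_div_cancel' (Nat.even_mul_succ_self k).two_dvd

lemma sN_succ (k : ℕ) : sN (k + 1) = sN k + (k + 1) := by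
  have h1 := two_sN k
  have h2 := two_sN (k + 1)
  nlinarith

lemma sN_mono {l k : ℕ} (h : l ≤ k) : sN l ≤ sN k :=
  Nat.div_le_div_right (Nat.mul_le_mul h (by omega))

lemma sN_pos {k : ℕ} (h : 1 ≤ k) : 1 ≤ sN k := by
  have := sN_mono h; simpa [sN] using this

def Dec (p k n : ℕ) (D : ℝ) : Prop :=
  ∀ (Ω : Type) [Fintype Ω] (w : Ω → ℝ) (φ : ℕ → Ω → ℂ) (x : ℕ → ℤ) (S : Finset ℕ),
    (∀ α, 0 ≤ w α) → Rich p k (k * n) w φ x S →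
    Nrm (sN k) w (fs φ S) ≤ D * VV p n (sN k) w φ x S

def Bil (p k n l a b : ℕ) (M : ℝ) : Prop :=
  ∀ (Ω : Type) [Fintype Ω] (w : Ω → ℝ) (φ : ℕ → Ω → ℂ) (x : ℕ → ℤ) (I J : Finset ℕ),
    (∀ α, 0 ≤ w α) → Rich p k (k * n) w φ x (I ∪ J) →
    (∀ i ∈ I, ∀ j ∈ I, (p : ℤ) ^ a ∣ x i - x j) →
    (∀ i ∈ J, ∀ j ∈ J, (p : ℤ) ^ b ∣ x i - x j) →
    (∀ i ∈ I, ∀ j ∈ J, ¬ (p : ℤ) ∣ x i - x j) →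
    ∑ α, w α * ((‖fs φ I α‖ ^ 2) ^ sN l * (‖fs φ J α‖ ^ 2) ^ (sN k - sN l)) ≤
      M ^ sN k * (VV p n (sN k) w φ x I ^ sN l * VV p n (sN k) w φ x J ^ (sN k - sN l))

/-! ### classes -/

lemma mem_cl {p a : ℕ} {x : ℕ → ℤ} {S : Finset ℕ} {i j : ℕ} :
    j ∈ cl p a x S i ↔ j ∈ S ∧ (p : ℤ) ^ a ∣ x j - x i := by simp [cl]

lemma self_mem_cl {p a : ℕ} {x : ℕ → ℤ} {S : Finset ℕ} {i : ℕ} (h : i ∈ S) :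
    i ∈ cl p a x S i := by simp [mem_cl, h]

lemma cl_eq {p a : ℕ} {x : ℕ → ℤ} {S : Finset ℕ} {i j : ℕ} (h : (p : ℤ) ^ a ∣ x j - x i) :
    cl p a x S j = cl p a x S i := by
  ext m
  simp only [mem_cl]
  refine and_congr_right fun _ => ⟨fun h2 => ?_, fun h2 => ?_⟩
  · have := dvd_add h2 h; simpa using this
  · have := dvd_sub h2 h; simpa using this

lemma cl_eq_iff {p a : ℕ} {x : ℕ → ℤ} {S : Finset ℕ} {i j : ℕ} (hj : j ∈ S) :
    cl p a x S j = cl p a x S i ↔ (p : ℤ) ^ a ∣ x j - x i := by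
  refine ⟨fun h => ?_, cl_eq⟩
  have := self_mem_cl (p := p) (a := a) (x := x) hj
  rw [h, mem_cl] at this
  exact this.2

lemma pt_sub {p a : ℕ} {x : ℕ → ℤ} {S C : Finset ℕ} (h : C ∈ pt p a x S) : C ⊆ S := by
  obtain ⟨i, _, rfl⟩ := Finset.mem_image.1 h
  exact Finset.filter_subset _ _

lemma pt_congr {p a : ℕ} {x : ℕ → ℤ} {S C : Finset ℕ} (h : C ∈ pt p a x S) :
    ∀ i ∈ C, ∀ j ∈ C, (p : ℤ) ^ a ∣ x i - x j := by
  obtain ⟨m, _, rfl⟩ := Finset.mem_image.1 h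
  intro i hi j hj
  have := dvd_sub (mem_cl.1 hi).2 (mem_cl.1 hj).2
  simpa using this

lemma pt_nonempty {p a : ℕ} {x : ℕ → ℤ} {S C : Finset ℕ} (h : C ∈ pt p a x S) : C.Nonempty := by
  obtain ⟨m, hm, rfl⟩ := Finset.mem_image.1 h
  exact ⟨m, self_mem_cl hm⟩

lemma pt_eq_cl {p a : ℕ} {x : ℕ → ℤ} {S C : Finset ℕ} (h : C ∈ pt p a x S) {i : ℕ} (hi : i ∈ C) :
    C = cl p a x S i := by
  obtain ⟨m, hm, rfl⟩ := Finset.mem_image.1 h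
  exact (cl_eq (mem_cl.1 hi).2).symm

lemma pt_ne {p a : ℕ} {x : ℕ → ℤ} {S C C' : Finset ℕ} (h : C ∈ pt p a x S) (h' : C' ∈ pt p a x S)
    (hne : C ≠ C') : ∀ i ∈ C, ∀ j ∈ C', ¬ (p : ℤ) ^ a ∣ x i - x j := by
  intro i hi j hj hd
  apply hne
  rw [pt_eq_cl h hi, pt_eq_cl h' hj]
  exact cl_eq hd

lemma sum_pt {M : Type} [AddCommMonoid M] (p a : ℕ) (x : ℕ → ℤ) (S : Finset ℕ) (g : ℕ → M) :
    ∑ C ∈ pt p a x S, ∑ i ∈ C, g i = ∑ i ∈ S, g i := by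
  unfold pt
  refine Finset.sum_image' (f := fun C => ∑ i ∈ C, g i) g ?_
  intro i hi
  apply Finset.sum_congr _ (fun _ _ => rfl)
  ext j
  simp only [mem_cl, Finset.mem_filter]
  refine and_congr_right fun hj => ?_
  exact (cl_eq_iff hj).symm

lemma fs_pt {Ω : Type} (p a : ℕ) (x : ℕ → ℤ) (S : Finset ℕ) (φ : ℕ → Ω → ℂ) (α : Ω) :
    fs φ S α = ∑ C ∈ pt p a x S, fs φ C α := (sum_pt p a x S (fun i => φ i α)).symm

lemma cl_cl {p a n : ℕ} (han : a ≤ n) {x : ℕ → ℤ} {S C : Finset ℕ} (h : C ∈ pt p a x S)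
    {i : ℕ} (hi : i ∈ C) : cl p n x C i = cl p n x S i := by
  ext j
  simp only [mem_cl]
  refine and_congr_left fun hj => ⟨fun h2 => pt_sub h h2, fun h2 => ?_⟩
  rw [pt_eq_cl h hi, mem_cl]
  exact ⟨h2, (pow_dvd_pow _ han).trans hj⟩

lemma pt_biUnion {p a n : ℕ} (han : a ≤ n) (x : ℕ → ℤ) (S : Finset ℕ) :
    pt p n x S = (pt p a x S).biUnion (fun C => pt p n x C) := by
  ext T
  simp only [Finset.mem_biUnion]
  constructor
  · intro hT
    obtain ⟨i, hi, rfl⟩ := Finset.mem_image.1 hT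
    refine ⟨cl p a x S i, Finset.mem_image_of_mem _ hi, ?_⟩
    have h1 : cl p a x S i ∈ pt p a x S := Finset.mem_image_of_mem _ hi
    rw [← cl_cl han h1 (self_mem_cl hi)]
    exact Finset.mem_image_of_mem _ (self_mem_cl hi)
  · rintro ⟨C, hC, hT⟩
    obtain ⟨i, hi, rfl⟩ := Finset.mem_image.1 hT
    rw [cl_cl han hC hi]
    exact Finset.mem_image_of_mem _ (pt_sub hC hi)

lemma sum_pt_pt {M : Type} [AddCommMonoid M] {p a n : ℕ} (han : a ≤ n) (x : ℕ → ℤ) (S : Finset ℕ)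
    (g : Finset ℕ → M) :
    ∑ C ∈ pt p n x S, g C = ∑ C ∈ pt p a x S, ∑ T ∈ pt p n x C, g T := by
  rw [pt_biUnion han, Finset.sum_biUnion]
  intro C hC C' hC' hne
  rw [Function.onFun, Finset.disjoint_left]
  intro T hT hT'
  obtain ⟨i, hi⟩ := pt_nonempty hT
  have := pt_ne hC hC' hne i (pt_sub hT hi) i (pt_sub hT' hi)
  simp at this

lemma VV_add {Ω : Type} [Fintype Ω] {p a n : ℕ} (han : a ≤ n) (s : ℕ) (w : Ω → ℝ)
    (φ : ℕ → Ω → ℂ) (x : ℕ → ℤ) (S : Finset ℕ) :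
    ∑ C ∈ pt p a x S, VV p n s w φ x C = VV p n s w φ x S := (sum_pt_pt han x S _).symm

lemma Nrm_nonneg {Ω : Type} [Fintype Ω] (s : ℕ) {w : Ω → ℝ} (hw : ∀ α, 0 ≤ w α) (f : Ω → ℂ) :
    0 ≤ Nrm s w f :=
  Real.rpow_nonneg (Finset.sum_nonneg fun α _ => mul_nonneg (hw α) (by positivity)) _

lemma VV_nonneg {Ω : Type} [Fintype Ω] (p n s : ℕ) {w : Ω → ℝ} (hw : ∀ α, 0 ≤ w α)
    (φ : ℕ → Ω → ℂ) (x : ℕ → ℤ) (S : Finset ℕ) : 0 ≤ VV p n s w φ x S :=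
  Finset.sum_nonneg fun C _ => Nrm_nonneg s hw _

lemma card_pt {p a A : ℕ} (hp : 0 < p) (haA : a ≤ A) (x : ℕ → ℤ) (S : Finset ℕ)
    (h : ∀ i ∈ S, ∀ j ∈ S, (p : ℤ) ^ a ∣ x i - x j) : (pt p A x S).card ≤ p ^ (A - a) := by
  rcases S.eq_empty_or_nonempty with rfl | ⟨i0, hi0⟩
  · simp [pt]
  have hpp : (0 : ℤ) < p := by exact_mod_cast hp
  have hpa : (0 : ℤ) < (p : ℤ) ^ (A - a) := by positivity
  have : (pt p A x S).card ≤ (Finset.range (p ^ (A - a))).card := by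
    refine Finset.card_le_card_of_surjOn
      (fun r => S.filter (fun j => (((x j - x i0) / (p : ℤ) ^ a) % (p : ℤ) ^ (A - a)) = (r : ℤ))) ?_
    intro C hC
    obtain ⟨i, hi, rfl⟩ := Finset.mem_image.1 (Finset.mem_coe.1 hC)
    have hr0 : 0 ≤ ((x i - x i0) / (p : ℤ) ^ a) % (p : ℤ) ^ (A - a) := Int.emod_nonneg _ hpa.ne'
    have hr1 : ((x i - x i0) / (p : ℤ) ^ a) % (p : ℤ) ^ (A - a) < (p : ℤ) ^ (A - a) :=
      Int.emod_lt_of_pos _ hpa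
    refine ⟨(((x i - x i0) / (p : ℤ) ^ a) % (p : ℤ) ^ (A - a)).toNat, ?_, ?_⟩
    · simp only [Finset.coe_range, Set.mem_Iio]
      zify
      rw [Int.toNat_of_nonneg hr0]; exact hr1
    · dsimp only
      rw [Int.toNat_of_nonneg hr0]
      ext j
      simp only [mem_cl, Finset.mem_filter]
      refine and_congr_right fun hj => ?_
      obtain ⟨c, hc⟩ := h i hi i0 hi0
      obtain ⟨d, hd⟩ := h j hj i0 hi0
      have e : x j - x i = (p : ℤ) ^ a * (d - c) := by linear_combination hd - hc
      have hpa' : (p : ℤ) ^ a ≠ 0 := by positivity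
      rw [hc, hd, Int.mul_ediv_cancel_left _ hpa', Int.mul_ediv_cancel_left _ hpa', e,
        ← Nat.sub_add_cancel haA, pow_add, mul_comm ((p : ℤ) ^ (A - a)),
        mul_dvd_mul_iff_left hpa', Nat.sub_add_cancel haA]
      rw [Int.emod_eq_emod_iff_emod_sub_eq_zero, Int.dvd_iff_emod_eq_zero]
  simpa using this

lemma Nrm_triv {Ω : Type} [Fintype Ω] {p a A : ℕ} (hp : 0 < p) (haA : a ≤ A) {s : ℕ} (hs : 1 ≤ s)
    {w : Ω → ℝ} (hw : ∀ α, 0 ≤ w α) (φ : ℕ → Ω → ℂ) (x : ℕ → ℤ) (S : Finset ℕ)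
    (h : ∀ i ∈ S, ∀ j ∈ S, (p : ℤ) ^ a ∣ x i - x j) :
    Nrm s w (fs φ S) ≤ (p : ℝ) ^ (A - a) * VV p A s w φ x S := by
  have h1 : ∀ α, ‖fs φ S α‖ ^ 2 ≤ ∑ C ∈ pt p A x S, (p : ℝ) ^ (A - a) * ‖fs φ C α‖ ^ 2 := by
    intro α
    rw [fs_pt p A x S φ α, ← Finset.mul_sum]
    calc ‖∑ C ∈ pt p A x S, fs φ C α‖ ^ 2 ≤ (∑ C ∈ pt p A x S, ‖fs φ C α‖) ^ 2 := by
          gcongr; exact norm_sum_le _ _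
      _ ≤ (pt p A x S).card * ∑ C ∈ pt p A x S, ‖fs φ C α‖ ^ 2 := sq_sum_le_card_mul_sum_sq
      _ ≤ _ := by
        gcongr
        exact_mod_cast card_pt hp haA x S h
  have hs0 : (s : ℝ) ≠ 0 := by positivity
  calc Nrm s w (fs φ S) ≤ (∑ α, w α * (∑ C ∈ pt p A x S, (p : ℝ) ^ (A - a) * ‖fs φ C α‖ ^ 2) ^ s)
        ^ ((1 : ℝ) / s) := by
        unfold Nrm
        refine Real.rpow_le_rpow
          (Finset.sum_nonneg fun α _ => mul_nonneg (hw α) (by positivity)) ?_ (by positivity)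
        refine Finset.sum_le_sum fun α _ => mul_le_mul_of_nonneg_left ?_ (hw α)
        exact pow_le_pow_left₀ (by positivity) (h1 α) _
    _ ≤ _ := mink s hs w hw _ _ (fun C α => by positivity)
    _ = _ := by
      unfold VV Nrm
      rw [Finset.mul_sum]
      refine Finset.sum_congr rfl fun C _ => ?_
      simp_rw [mul_pow, mul_left_comm (w _)]
      rw [← Finset.mul_sum, Real.mul_rpow (by positivity)
        (Finset.sum_nonneg fun α _ => mul_nonneg (hw α) (by positivity)), ← Real.rpow_natCast _ s,
        ← Real.rpow_mul (by positivity), mul_one_div_cancel hs0, Real.rpow_one]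

lemma Dec_triv {p k : ℕ} (hp : 0 < p) (hk : 1 ≤ k) (n : ℕ) : Dec p k n ((p : ℝ) ^ n) := by
  intro Ω _ w φ x S hw _
  have := Nrm_triv (a := 0) hp (Nat.zero_le n) (sN_pos hk) hw φ x S (by simp)
  simpa using this

lemma Dec_mono {p k n : ℕ} {D D' : ℝ} (h : Dec p k n D) (hD : D ≤ D') : Dec p k n D' := by
  intro Ω _ w φ x S hw hR
  exact (h Ω w φ x S hw hR).trans (mul_le_mul_of_nonneg_right hD (VV_nonneg _ _ _ hw _ _ _))

lemma Bil_mono {p k n l a b : ℕ} {M M' : ℝ} (h : Bil p k n l a b M) (h0 : 0 ≤ M) (hM : M ≤ M') :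
    Bil p k n l a b M' := by
  intro Ω _ w φ x I J hw hR h1 h2 h3
  refine (h Ω w φ x I J hw hR h1 h2 h3).trans ?_
  have := VV_nonneg p n (sN k) hw φ x I
  have := VV_nonneg p n (sN k) hw φ x J
  gcongr

/-! ### richness -/

lemma Rich_sub {Ω : Type} {p k N : ℕ} {w : Ω → ℝ} {φ : ℕ → Ω → ℂ} {x : ℕ → ℤ}
    {S T : Finset ℕ} (h : Rich p k N w φ x S) (hT : T ⊆ S) : Rich p k N w φ x T := by
  intro P hP
  obtain ⟨σ, h1, u, hu, h2⟩ := h P hP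
  exact ⟨σ, h1, u, hu, fun i hi => h2 i (hT hi)⟩

lemma eval_scale (p N N' : ℕ) (hp : 0 < p) (h : N' ≤ N) (m : ℤ) :
    (((p : ℤ) ^ (N - N') * m : ℤ) : ℝ) / (p : ℝ) ^ N = (m : ℝ) / (p : ℝ) ^ N' := by
  have hp' : (p : ℝ) ≠ 0 := by positivity
  obtain ⟨d, rfl⟩ := Nat.exists_eq_add_of_le h
  rw [Nat.add_sub_cancel_left]
  push_cast
  rw [pow_add]
  field_simp

/-- from integer valued polynomial data to symmetric action: rescaling -/
lemma Rich_rescale {Ω : Type} {p k n t : ℕ} (hp : 0 < p) (htn : t ≤ n) {w : Ω → ℝ}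
    {φ : ℕ → Ω → ℂ} {x y : ℕ → ℤ} {S : Finset ℕ} (ξ : ℤ) (hy : ∀ i ∈ S, x i = ξ + (p : ℤ) ^ t * y i)
    (h : Rich p k (k * n) w φ x S) : Rich p k (k * (n - t)) w φ y S := by
  intro Q hQ
  set P : ℤ[X] := ∑ j ∈ Finset.range (k + 1),
    Polynomial.C (Q.coeff j * (p : ℤ) ^ (t * (k - j))) * (X - Polynomial.C ξ) ^ j with hP
  have hdeg : P.natDegree ≤ k := by
    rw [hP]
    refine natDegree_sum_le_of_forall_le _ _ fun j hj => ?_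
    refine (natDegree_C_mul_le _ _).trans ?_
    refine natDegree_pow_le.trans ?_
    rw [natDegree_X_sub_C]
    have := Finset.mem_range.1 hj; omega
  obtain ⟨σ, h1, u, hu, h2⟩ := h P hdeg
  refine ⟨σ, h1, u, hu, fun i hi α => ?_⟩
  rw [h2 i hi α]
  have : P.eval (x i) = (p : ℤ) ^ (k * n - k * (n - t)) * Q.eval (y i) := by
    rw [hP, eval_finsetSum, Polynomial.eval_eq_sum_range' (Nat.lt_succ_of_le hQ), Finset.mul_sum]
    refine Finset.sum_congr rfl fun j hj => ?_
    have hj' : j ≤ k := by have := Finset.mem_range.1 hj; omega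
    have e : k * n - k * (n - t) = t * (k - j) + t * j := by
      rw [← mul_add, Nat.sub_add_cancel hj', ← Nat.mul_sub, Nat.sub_sub_self htn, mul_comm]
    rw [e]
    simp only [eval_mul, eval_C, eval_pow, eval_sub, eval_X]
    rw [hy i hi]
    ring
  rw [this, eval_scale p _ _ hp (Nat.mul_le_mul_left _ (Nat.sub_le _ _))]

lemma cl_rescale {p n t : ℕ} (hp : 0 < p) (htn : t ≤ n)
    {x y : ℕ → ℤ} {S : Finset ℕ} (ξ : ℤ) (hy : ∀ i ∈ S, x i = ξ + (p : ℤ) ^ t * y i) {i : ℕ}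
    (hi : i ∈ S) : cl p (n - t) y S i = cl p n x S i := by
  ext j
  simp only [mem_cl]
  refine and_congr_right fun hj => ?_
  have e : x j - x i = (p : ℤ) ^ t * (y j - y i) := by rw [hy i hi, hy j hj]; ring
  rw [e, ← Nat.add_sub_of_le htn, pow_add, Nat.add_sub_cancel_left,
    mul_dvd_mul_iff_left (by positivity)]

lemma pt_rescale {p n t : ℕ} (hp : 0 < p) (htn : t ≤ n)
    {x y : ℕ → ℤ} {S : Finset ℕ} (ξ : ℤ) (hy : ∀ i ∈ S, x i = ξ + (p : ℤ) ^ t * y i) :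
    pt p (n - t) y S = pt p n x S :=
  Finset.image_congr fun _ hi => cl_rescale hp htn ξ hy hi

lemma exists_y {p t : ℕ} {x : ℕ → ℤ} {S : Finset ℕ}
    (h : ∀ i ∈ S, ∀ j ∈ S, (p : ℤ) ^ t ∣ x i - x j) :
    ∃ (ξ : ℤ) (y : ℕ → ℤ), (∀ i ∈ S, x i = ξ + (p : ℤ) ^ t * y i) ∧ (S.Nonempty → ∃ i ∈ S, x i = ξ) := by
  rcases S.eq_empty_or_nonempty with rfl | ⟨i0, hi0⟩
  · exact ⟨0, 0, by simp, by simp⟩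
  · have : ∀ i, ∃ c, i ∈ S → x i = x i0 + (p : ℤ) ^ t * c := by
      intro i
      by_cases hi : i ∈ S
      · obtain ⟨c, hc⟩ := h i hi i0 hi0
        exact ⟨c, fun _ => by linarith⟩
      · exact ⟨0, fun h => absurd h hi⟩
    choose y hy using this
    exact ⟨x i0, y, fun i hi => hy i hi, fun _ => ⟨i0, hi0, rfl⟩⟩

lemma Dec_class {p k n t : ℕ} (hp : 0 < p) (htn : t ≤ n) {D : ℝ} (hD : Dec p k (n - t) D)
    {Ω : Type} [Fintype Ω] {w : Ω → ℝ}
    {φ : ℕ → Ω → ℂ} {x : ℕ → ℤ} {S : Finset ℕ} (hw : ∀ α, 0 ≤ w α)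
    (hR : Rich p k (k * n) w φ x S)
    (h : ∀ i ∈ S, ∀ j ∈ S, (p : ℤ) ^ t ∣ x i - x j) :
    Nrm (sN k) w (fs φ S) ≤ D * VV p n (sN k) w φ x S := by
  obtain ⟨ξ, y, hy, -⟩ := exists_y h
  have := hD Ω w φ y S hw (Rich_rescale hp htn ξ hy hR)
  unfold VV at this ⊢
  rwa [pt_rescale hp htn ξ hy] at this

end VMVT

namespace VMVT
open Finset Polynomial

lemma Dec_one {p : ℕ} (hp : 0 < p) (n : ℕ) : Dec p 1 n 1 := by
  intro Ω _ w φ x S hw hR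
  have hs : sN 1 = 1 := rfl
  have hN : ∀ T : Finset ℕ, ((Nrm 1 w (fs φ T) : ℝ) : ℂ) =
      ∑ i ∈ T, ∑ j ∈ T, ∑ α, (w α : ℂ) * (φ i α * (starRingEnd ℂ) (φ j α)) := by
    intro T
    unfold Nrm
    simp only [Nat.cast_one, div_one, Real.rpow_one, pow_one]
    push_cast
    rw [Finset.sum_congr rfl (fun i _ => Finset.sum_comm), Finset.sum_comm]
    refine Finset.sum_congr rfl fun α _ => ?_
    rw [← Complex.ofReal_pow, ← Complex.normSq_eq_norm_sq, ← Complex.mul_conj]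
    unfold fs
    rw [map_sum, Finset.sum_mul_sum, Finset.mul_sum]
    refine Finset.sum_congr rfl fun i _ => ?_
    rw [Finset.mul_sum]
  have horth : ∀ i ∈ S, ∀ j ∈ S, ¬ (p : ℤ) ^ n ∣ x j - x i →
      ∑ α, (w α : ℂ) * (φ i α * (starRingEnd ℂ) (φ j α)) = 0 := by
    intro i hi j hj hd
    obtain ⟨σ, h1, u, hu, h2⟩ := hR X (by simp)
    set Z := ∑ α, (w α : ℂ) * (φ i α * (starRingEnd ℂ) (φ j α)) with hZ
    have e : Z = ee (((x i - x j : ℤ) : ℝ) / (p : ℝ) ^ n) * Z := by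
      conv_lhs => rw [hZ, ← Equiv.sum_comp σ]
      rw [hZ, Finset.mul_sum]
      refine Finset.sum_congr rfl fun α _ => ?_
      rw [h1, h2 i hi, h2 j hj]
      simp only [eval_X, one_mul, map_mul]
      rw [← ee_neg]
      have hu2 : u α * (starRingEnd ℂ) (u α) = 1 := by
        rw [Complex.mul_conj, Complex.normSq_eq_norm_sq, hu]; simp
      have he : ee (((x i - x j : ℤ) : ℝ) / (p : ℝ) ^ n) =
          ee (((x i : ℤ) : ℝ) / (p : ℝ) ^ n) * ee (-(((x j : ℤ) : ℝ) / (p : ℝ) ^ n)) := by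
        rw [← ee_add]; congr 1; push_cast; ring
      rw [he]
      linear_combination (w α : ℂ) * (ee (((x i : ℤ) : ℝ) / (p : ℝ) ^ n) * ee (-(((x j : ℤ) : ℝ) / (p : ℝ) ^ n)) * φ i α * (starRingEnd ℂ) (φ j α)) * hu2
    by_contra hne
    have : ee (((x i - x j : ℤ) : ℝ) / (p : ℝ) ^ n) = 1 := by
      have := mul_right_cancel₀ hne (show ee (((x i - x j : ℤ) : ℝ) / (p : ℝ) ^ n) * Z = 1 * Z by
        rw [← e, one_mul])
      exact this
    obtain ⟨m, hm⟩ := ee_eq_one this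
    apply hd
    have hp' : (p : ℝ) ^ n ≠ 0 := by positivity
    rw [div_eq_iff hp'] at hm
    refine ⟨-m, ?_⟩
    have hm' : x i - x j = m * (p : ℤ) ^ n := by exact_mod_cast hm
    linear_combination -hm'
  rw [one_mul, hs]
  apply le_of_eq
  have : ((Nrm 1 w (fs φ S) : ℝ) : ℂ) = ((VV p n 1 w φ x S : ℝ) : ℂ) := by
    unfold VV
    push_cast
    rw [hN S, ← sum_pt p n x S]
    refine Finset.sum_congr rfl fun C hC => ?_
    rw [hN C]
    refine Finset.sum_congr rfl fun i hi => ?_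
    symm
    refine Finset.sum_subset (pt_sub hC) fun j hj hjC => ?_
    refine horth i (pt_sub hC hi) j hj fun hd => hjC ?_
    rw [pt_eq_cl hC hi, mem_cl]
    exact ⟨hj, hd⟩
  exact_mod_cast this

lemma poly_exist {A : Type} [CommRing A] (l m : ℕ) (vb : A)
    (hvb : IsUnit vb) (hB : IsUnit (((m + l).choose m : ℕ) : A)) (R : A[X]) :
    ∃ (c : A) (Q : A[X]), (∀ i, l ≤ i → Q.coeff i = 0) ∧ ∀ T : A, T ^ (l + 1) = 0 →
      (1 + vb * T) ^ (m + 1) * Q.eval T = R.eval T - c := by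
  set G : PowerSeries A := PowerSeries.rescale (-vb)
    (PowerSeries.mk fun n => (((m + n).choose m : ℕ) : A)) with hG
  have hHG : ((1 : PowerSeries A) + PowerSeries.C vb * PowerSeries.X) ^ (m + 1) * G = 1 := by
    have := congrArg (PowerSeries.rescale (-vb)) (PowerSeries.mk_add_choose_mul_one_sub_pow_eq_one A m)
    rw [map_mul, map_one, map_pow, map_sub, map_one, PowerSeries.rescale_X, ← hG, mul_comm] at this
    rw [map_neg, neg_mul, sub_neg_eq_add] at this
    exact this
  have hgl : IsUnit (PowerSeries.coeff l G) := by
    rw [hG, PowerSeries.coeff_rescale, PowerSeries.coeff_mk]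
    exact (hvb.neg.pow l).mul hB
  obtain ⟨g, hg⟩ := hgl
  set Rp : PowerSeries A := (R : PowerSeries A) with hRp
  set c : A := PowerSeries.coeff l (Rp * G) * ((g⁻¹ : Aˣ) : A) with hc
  set F : PowerSeries A := (Rp - PowerSeries.C c) * G with hF
  have hFl : PowerSeries.coeff l F = 0 := by
    rw [hF, sub_mul, map_sub, PowerSeries.coeff_C_mul, ← hg, hc, mul_assoc, Units.inv_mul]
    ring
  set Q : A[X] := PowerSeries.trunc l F with hQ
  refine ⟨c, Q, fun i hi => ?_, fun T hT => ?_⟩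
  · rw [hQ, PowerSeries.coeff_trunc, if_neg (by omega)]
  have hdvd : (X : A[X]) ^ (l + 1) ∣ (1 + Polynomial.C vb * X) ^ (m + 1) * Q - (R - Polynomial.C c) := by
    rw [Polynomial.X_pow_dvd_iff]
    have h1 : (PowerSeries.X : PowerSeries A) ^ (l + 1) ∣ F - (Q : PowerSeries A) := by
      rw [PowerSeries.X_pow_dvd_iff]
      intro i hi
      rw [map_sub, Polynomial.coeff_coe, hQ, PowerSeries.coeff_trunc]
      split_ifs with h
      · ring
      · have : i = l := by omega
        rw [this, hFl]; ring
    have h2 : (PowerSeries.X : PowerSeries A) ^ (l + 1) ∣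
        (((1 + Polynomial.C vb * X) ^ (m + 1) * Q - (R - Polynomial.C c) : A[X]) : PowerSeries A) := by
      push_cast
      have e : ((1 : PowerSeries A) + PowerSeries.C vb * PowerSeries.X) ^ (m + 1) * (Q : PowerSeries A)
        - ((R : PowerSeries A) - PowerSeries.C c) =
          -(((1 : PowerSeries A) + PowerSeries.C vb * PowerSeries.X) ^ (m + 1) * (F - (Q : PowerSeries A))) := by
        rw [hF]
        linear_combination ((Rp - PowerSeries.C c)) * hHG
      rw [e]
      exact (h1.mul_left _).neg_right
    intro i hi
    rw [PowerSeries.X_pow_dvd_iff] at h2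
    have := h2 i hi
    rwa [Polynomial.coeff_coe] at this
  obtain ⟨K, hK⟩ := hdvd
  have := congrArg (Polynomial.eval T) hK
  simp only [eval_sub, eval_mul, eval_pow, eval_add, eval_one, eval_C, eval_X, hT, zero_mul] at this
  linear_combination this

/-- polynomial for the lower richness -/
lemma poly_exist_int {p N l m a b : ℕ} (hp : p.Prime) (hl : 1 ≤ l) (hlm : l + m < p)
    (ξ ζ : ℤ) (hv : ¬ (p : ℤ) ∣ ξ - ζ) (h1 : N ≤ (l + 1) * a) (h2 : N ≤ (m + 1) * b) (R : ℤ[X]) :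
    ∃ (c : ℤ) (P : ℤ[X]), P.natDegree ≤ l + m ∧
      (∀ x : ℤ, (p : ℤ) ^ a ∣ x - ξ → (p : ℤ) ^ N ∣ P.eval x - (R.eval (x - ξ) - c)) ∧
      (∀ x : ℤ, (p : ℤ) ^ b ∣ x - ζ → (p : ℤ) ^ N ∣ P.eval x) := by
  let A := ZMod (p ^ N)
  have hcop : ∀ z : ℤ, ¬ (p : ℤ) ∣ z → IsUnit ((z : ℤ) : ZMod (p ^ N)) := by
    intro z hz
    have h3 : IsCoprime z ((p : ℤ) ^ N) := by
      apply IsCoprime.pow_right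
      rw [isCoprime_comm]
      exact (Prime.coprime_iff_not_dvd (Nat.prime_iff_prime_int.1 hp)).2 hz
    obtain ⟨u, v, huv⟩ := h3
    have := congrArg (fun t : ℤ => (t : ZMod (p ^ N))) huv
    simp only [Int.cast_add, Int.cast_mul, Int.cast_pow, Int.cast_natCast, Int.cast_one] at this
    have h0 : ((p : ZMod (p ^ N)) ^ N) = 0 := by
      have := ZMod.natCast_self (p ^ N); push_cast at this; exact this
    rw [h0, mul_zero, add_zero] at this
    exact IsUnit.of_mul_eq_one _ (by rw [mul_comm]; exact this)
  have h0 : ((p : ZMod (p ^ N)) ^ N) = 0 := by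
    have := ZMod.natCast_self (p ^ N); push_cast at this; exact this
  obtain ⟨v, hvv⟩ := hcop _ hv
  have hB : IsUnit (((m + l).choose m : ℕ) : ZMod (p ^ N)) := by
    have := hcop ((m + l).choose m : ℕ) ?_
    · simpa using this
    · intro hd
      have hd' : p ∣ (m + l).choose m := by exact_mod_cast hd
      have h3 : p ∣ (m + l).factorial :=
        hd'.trans ⟨m.factorial * l.factorial, by
          rw [← mul_assoc, Nat.choose_symm_add]
          exact (Nat.add_choose_mul_factorial_mul_factorial m l).symm⟩
      rw [hp.dvd_factorial] at h3
      omega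
  obtain ⟨c, Q, hQ, hQT⟩ := poly_exist l m ((v⁻¹ : (ZMod (p ^ N))ˣ) : ZMod (p ^ N)) (Units.isUnit _)
    hB (R.map (Int.castRingHom (ZMod (p ^ N))))
  set PA : (ZMod (p ^ N))[X] := (Polynomial.C (((v⁻¹ : (ZMod (p ^ N))ˣ) : ZMod (p ^ N))) * (X - Polynomial.C ((ζ : ℤ) : ZMod (p ^ N)))) ^ (m + 1) *
    Q.comp (X - Polynomial.C ((ξ : ℤ) : ZMod (p ^ N))) with hPA
  have hdegQ : Q.natDegree ≤ l - 1 := by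
    rw [natDegree_le_iff_coeff_eq_zero]
    intro i hi; exact hQ i (by omega)
  have hX : ∀ z : ZMod (p ^ N), (X - Polynomial.C z).natDegree ≤ 1 := natDegree_X_sub_C_le
  have hdeg : PA.natDegree ≤ l + m := by
    refine natDegree_mul_le.trans ?_
    have e1 := (natDegree_comp_le (p := Q) (q := (X - Polynomial.C ((ξ : ℤ) : ZMod (p ^ N)))))
    have e2 := Nat.mul_le_mul hdegQ (hX ((ξ : ℤ) : ZMod (p ^ N)))
    have e3 : ((Polynomial.C (((v⁻¹ : (ZMod (p ^ N))ˣ) : ZMod (p ^ N))) * (X - Polynomial.C ((ζ : ℤ) : ZMod (p ^ N)))) ^ (m + 1)).natDegree ≤ (m + 1) * 1 :=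
      natDegree_pow_le.trans (Nat.mul_le_mul_left _ ((natDegree_C_mul_le _ _).trans (hX _)))
    omega
  have hlift : PA ∈ Polynomial.lifts (Int.castRingHom (ZMod (p ^ N))) := by
    rw [Polynomial.mem_lifts]
    exact Polynomial.map_surjective _ (ZMod.ringHom_surjective _) PA
  obtain ⟨P, hP, hPdeg⟩ := Polynomial.exists_natDegree_eq_of_mem_lifts hlift
  obtain ⟨c', hc'⟩ := ZMod.ringHom_surjective (Int.castRingHom (ZMod (p ^ N))) c
  have hev : ∀ x : ℤ, ((P.eval x : ℤ) : ZMod (p ^ N)) = PA.eval (x : ZMod (p ^ N)) := by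
    intro x
    rw [← hP]
    have := (Polynomial.eval_map_apply (Int.castRingHom (ZMod (p ^ N))) (p := P) x)
    simpa using this.symm
  refine ⟨c', P, by rw [hPdeg]; exact hdeg, fun x hx => ?_, fun x hx => ?_⟩
  · have hT : (((x - ξ : ℤ)) : ZMod (p ^ N)) ^ (l + 1) = 0 := by
      obtain ⟨t, ht⟩ := hx
      rw [ht]
      push_cast
      rw [mul_pow, ← pow_mul, mul_comm a, ← Nat.sub_add_cancel h1, pow_add, h0]
      ring
    have := hQT _ hT
    suffices hh : ((P.eval x - (R.eval (x - ξ) - c') : ℤ) : ZMod (p ^ N)) = 0 by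
      rw [ZMod.intCast_zmod_eq_zero_iff_dvd] at hh
      exact_mod_cast hh
    push_cast
    rw [hev, hPA]
    simp only [eval_mul, eval_pow, eval_sub, eval_X, eval_C, eval_comp]
    have e4 : (R.map (Int.castRingHom (ZMod (p ^ N)))).eval ((x - ξ : ℤ) : ZMod (p ^ N)) =
      ((R.eval (x - ξ) : ℤ) : ZMod (p ^ N)) := by
      have := (Polynomial.eval_map_apply (Int.castRingHom (ZMod (p ^ N))) (p := R) (x - ξ))
      simpa using this
    rw [e4] at this
    have e5 : ((c' : ℤ) : ZMod (p ^ N)) = c := by rw [← hc']; simp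
    rw [e5]
    have e6 : ((v⁻¹ : (ZMod (p ^ N))ˣ) : ZMod (p ^ N)) * ((x : ZMod (p ^ N)) - (ζ : ℤ)) =
      1 + ((v⁻¹ : (ZMod (p ^ N))ˣ) : ZMod (p ^ N)) * ((x - ξ : ℤ) : ZMod (p ^ N)) := by
      have : ((v⁻¹ : (ZMod (p ^ N))ˣ) : ZMod (p ^ N)) * ((ξ - ζ : ℤ) : ZMod (p ^ N)) = 1 := by
        rw [← hvv]; simp
      push_cast at this ⊢
      linear_combination this
    rw [e6]
    push_cast at this ⊢
    rw [this]; ring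
  · suffices hh : ((P.eval x : ℤ) : ZMod (p ^ N)) = 0 by
      rw [ZMod.intCast_zmod_eq_zero_iff_dvd] at hh
      exact_mod_cast hh
    rw [hev, hPA]
    simp only [eval_mul, eval_pow, eval_sub, eval_X, eval_C, eval_comp]
    have : ((x : ZMod (p ^ N)) - (ζ : ℤ)) ^ (m + 1) = 0 := by
      obtain ⟨t, ht⟩ := hx
      have e7 : ((x : ZMod (p ^ N)) - (ζ : ℤ)) = ((x - ζ : ℤ) : ZMod (p ^ N)) := by push_cast; ring
      rw [e7, ht]
      push_cast
      rw [mul_pow, ← pow_mul, mul_comm b, ← Nat.sub_add_cancel h2, pow_add, h0]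
      ring
    rw [mul_pow, this]; ring

lemma LowerRich {Ω : Type} {p k n l m a b s0 e : ℕ} (hp : p.Prime) (hl : 1 ≤ l) (hlm : l + m = k)
    (hkp : k < p) {w : Ω → ℝ} {φ : ℕ → Ω → ℂ} {x y : ℕ → ℤ} {I J : Finset ℕ} (ξ ζ : ℤ)
    (hR : Rich p k (k * n) w φ x (I ∪ J)) (hI : ∀ i ∈ I, x i = ξ + (p : ℤ) ^ a * y i)
    (hJ : ∀ j ∈ J, (p : ℤ) ^ b ∣ x j - ζ) (hv : ¬ (p : ℤ) ∣ ξ - ζ)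
    (h1 : l * (a + s0) ≤ (l + 1) * a) (h2 : l * (a + s0) ≤ (m + 1) * b)
    (h3 : l * (a + s0) ≤ k * n) :
    Rich p l (l * s0) (fun α => w α * (‖fs φ J α‖ ^ 2) ^ e) φ y I := by
  intro R hRdeg
  have hp0 := hp.pos
  set Rh : ℤ[X] := ∑ j ∈ Finset.range (l + 1),
    Polynomial.C (R.coeff j * (p : ℤ) ^ (a * (l - j))) * X ^ j with hRh
  have hRe : ∀ t : ℤ, Rh.eval ((p : ℤ) ^ a * t) = (p : ℤ) ^ (l * a) * R.eval t := by
    intro t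
    rw [hRh, eval_finsetSum, Polynomial.eval_eq_sum_range' (Nat.lt_succ_of_le hRdeg), Finset.mul_sum]
    refine Finset.sum_congr rfl fun j hj => ?_
    have hj' : j ≤ l := by have := Finset.mem_range.1 hj; omega
    have e : l * a = a * (l - j) + a * j := by
      rw [← mul_add, Nat.sub_add_cancel hj', mul_comm]
    rw [e]
    simp only [eval_mul, eval_C, eval_pow, eval_X]
    ring
  obtain ⟨c, P, hPdeg, hPI, hPJ⟩ := poly_exist_int hp hl (by omega) ξ ζ hv h1 h2 Rh
  obtain ⟨σ, hw, u, hu, hφ⟩ := hR (Polynomial.C ((p : ℤ) ^ (k * n - l * (a + s0))) * P)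
    ((natDegree_C_mul_le _ _).trans (hPdeg.trans hlm.le))
  have hφ2 : ∀ i ∈ I ∪ J, ∀ α, φ i (σ α) =
      u α * ee (((P.eval (x i) : ℤ) : ℝ) / (p : ℝ) ^ (l * (a + s0))) * φ i α := by
    intro i hi α
    rw [hφ i hi α, eval_mul, eval_C, eval_scale p _ _ hp0 h3]
  have hJ2 : ∀ α, fs φ J (σ α) = u α * fs φ J α := by
    intro α
    unfold fs
    rw [Finset.mul_sum]
    refine Finset.sum_congr rfl fun j hj => ?_
    rw [hφ2 j (Finset.mem_union_right _ hj) α, ee_congr p _ hp0 (b := 0)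
      (by simpa using hPJ _ (hJ j hj))]
    simp [ee_zero]
  refine ⟨σ, fun α => ?_, fun α => u α * ee (((-c : ℤ) : ℝ) / (p : ℝ) ^ (l * (a + s0))),
    fun α => by simp [hu], fun i hi α => ?_⟩
  · simp only [hw, hJ2, norm_mul, hu, one_mul]
  · rw [hφ2 i (Finset.mem_union_left _ hi) α]
    have h5 := hPI (x i) (by rw [hI i hi]; simp)
    have h6 : x i - ξ = (p : ℤ) ^ a * y i := by rw [hI i hi]; ring
    rw [h6, hRe] at h5
    rw [ee_congr p _ hp0 h5, Int.cast_sub, sub_div, sub_eq_add_neg, ee_add]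
    have h7 := eval_scale p (l * (a + s0)) (l * s0) hp0 (by nlinarith) (R.eval (y i))
    have h8 : l * (a + s0) - l * s0 = l * a := by rw [mul_add]; omega
    rw [h8] at h7
    rw [h7]
    have h9 : -((c : ℝ) / (p : ℝ) ^ (l * (a + s0))) = ((-c : ℤ) : ℝ) / (p : ℝ) ^ (l * (a + s0)) := by
      push_cast; ring
    rw [h9]; ring
end VMVT

namespace VMVT
open Finset Polynomial

lemma root_le {s : ℕ} (hs : 1 ≤ s) {x K V : ℝ} (hx : 0 ≤ x) (hK : 0 ≤ K) (hV : 0 ≤ V)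
    (h : x ≤ K * V ^ s) : x ^ ((1 : ℝ) / s) ≤ K ^ ((1 : ℝ) / s) * V := by
  have hs0 : (s : ℝ) ≠ 0 := by positivity
  calc x ^ ((1 : ℝ) / s) ≤ (K * V ^ s) ^ ((1 : ℝ) / s) := Real.rpow_le_rpow hx h (by positivity)
    _ = _ := by
      rw [Real.mul_rpow hK (by positivity), ← Real.rpow_natCast V, ← Real.rpow_mul hV,
        mul_one_div_cancel hs0, Real.rpow_one]

lemma root_pow {s : ℕ} (hs : 1 ≤ s) {x : ℝ} (hx : 0 ≤ x) : (x ^ ((1 : ℝ) / s)) ^ s = x := by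
  have hs0 : (s : ℝ) ≠ 0 := by positivity
  rw [← Real.rpow_natCast, ← Real.rpow_mul hx, one_div_mul_cancel hs0, Real.rpow_one]

lemma le_of_root {s : ℕ} (hs : 1 ≤ s) {x K : ℝ} (hx : 0 ≤ x)
    (h : x ^ ((1 : ℝ) / s) ≤ K) : x ≤ K ^ s := by
  rw [← root_pow hs hx]
  exact pow_le_pow_left₀ (Real.rpow_nonneg hx _) h _

lemma Nrm_pow {Ω : Type} [Fintype Ω] {s : ℕ} (hs : 1 ≤ s) {w : Ω → ℝ} (hw : ∀ α, 0 ≤ w α)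
    (f : Ω → ℂ) : (Nrm s w f) ^ s = ∑ α, w α * (‖f α‖ ^ 2) ^ s :=
  root_pow hs (Finset.sum_nonneg fun α _ => mul_nonneg (hw α) (by positivity))

/-- gluing classes -/
lemma glue {Ω : Type} [Fintype Ω] {p n A sl : ℕ} {s' : ℕ} (hA : A ≤ n) (hs : 1 ≤ sl) {w w' : Ω → ℝ}
    (hw : ∀ α, 0 ≤ w α) (hw' : ∀ α, 0 ≤ w' α) (φ : ℕ → Ω → ℂ) (x : ℕ → ℤ) (I : Finset ℕ) {D K : ℝ}
    (hD : 0 ≤ D) (hK : 0 ≤ K)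
    (h1 : Nrm sl w' (fs φ I) ≤ D * VV p A sl w' φ x I)
    (h2 : ∀ C ∈ pt p A x I, ∑ α, w' α * (‖fs φ C α‖ ^ 2) ^ sl ≤ K * VV p n s' w φ x C ^ sl) :
    ∑ α, w' α * (‖fs φ I α‖ ^ 2) ^ sl ≤ D ^ sl * (K * VV p n s' w φ x I ^ sl) := by
  have h0 : ∀ T : Finset ℕ, 0 ≤ ∑ α, w' α * (‖fs φ T α‖ ^ 2) ^ sl := fun T =>
    Finset.sum_nonneg fun α _ => mul_nonneg (hw' α) (by positivity)
  have h3 : VV p A sl w' φ x I ≤ K ^ ((1 : ℝ) / sl) * VV p n s' w φ x I := by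
    rw [← VV_add hA s' w φ x I, Finset.mul_sum]
    unfold VV
    refine Finset.sum_le_sum fun C hC => ?_
    exact root_le hs (h0 C) hK (VV_nonneg _ _ _ hw _ _ _) (h2 C hC)
  have h4 : Nrm sl w' (fs φ I) ≤ D * (K ^ ((1 : ℝ) / sl) * VV p n s' w φ x I) :=
    h1.trans (mul_le_mul_of_nonneg_left h3 hD)
  have := le_of_root hs (h0 I) h4
  rwa [mul_pow, mul_pow, root_pow hs hK] at this

lemma Bil_step {p k n l a b A : ℕ} {M D : ℝ} (hl : 1 ≤ l) (hlk : l ≤ k) (haA : a ≤ A) (hA : A ≤ n)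
    (hD : 1 ≤ D) (hM : 0 ≤ M) (hB : Bil p k n l A b M)
    (hyp : ∀ (Ω : Type) [Fintype Ω] (w : Ω → ℝ) (φ : ℕ → Ω → ℂ) (x : ℕ → ℤ) (I J : Finset ℕ),
      (∀ α, 0 ≤ w α) → Rich p k (k * n) w φ x (I ∪ J) →
      (∀ i ∈ I, ∀ j ∈ I, (p : ℤ) ^ a ∣ x i - x j) →
      (∀ i ∈ J, ∀ j ∈ J, (p : ℤ) ^ b ∣ x i - x j) →
      (∀ i ∈ I, ∀ j ∈ J, ¬ (p : ℤ) ∣ x i - x j) →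
      Nrm (sN l) (fun α => w α * (‖fs φ J α‖ ^ 2) ^ (sN k - sN l)) (fs φ I) ≤
        D * VV p A (sN l) (fun α => w α * (‖fs φ J α‖ ^ 2) ^ (sN k - sN l)) φ x I) :
    Bil p k n l a b (D * M) := by
  intro Ω _ w φ x I J hw hR h1 h2 h3
  set w' : Ω → ℝ := fun α => w α * (‖fs φ J α‖ ^ 2) ^ (sN k - sN l) with hw'd
  have hw' : ∀ α, 0 ≤ w' α := fun α => mul_nonneg (hw α) (by positivity)
  have hVI := VV_nonneg p n (sN k) hw φ x I
  have hVJ := VV_nonneg p n (sN k) hw φ x J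
  have e : ∀ T : Finset ℕ, ∑ α, w α * ((‖fs φ T α‖ ^ 2) ^ sN l * (‖fs φ J α‖ ^ 2) ^ (sN k - sN l)) =
      ∑ α, w' α * (‖fs φ T α‖ ^ 2) ^ sN l := by
    intro T; refine Finset.sum_congr rfl fun α _ => ?_
    rw [hw'd]; ring
  have := glue (p := p) (K := M ^ sN k * VV p n (sN k) w φ x J ^ (sN k - sN l)) (s' := sN k) hA
    (sN_pos hl) hw hw' φ x I (by linarith) (by positivity) (hyp Ω w φ x I J hw hR h1 h2 h3) ?_
  · rw [e]
    refine this.trans ?_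
    calc D ^ sN l * (M ^ sN k * VV p n (sN k) w φ x J ^ (sN k - sN l) * VV p n (sN k) w φ x I ^ sN l)
        ≤ D ^ sN k * (M ^ sN k * VV p n (sN k) w φ x J ^ (sN k - sN l) *
          VV p n (sN k) w φ x I ^ sN l) := by
          gcongr
          exact sN_mono hlk
      _ = _ := by rw [mul_pow]; ring
  · intro C hC
    have hCI := pt_sub hC
    have := hB Ω w φ x C J hw (Rich_sub hR (Finset.union_subset_union_left hCI))
      (pt_congr hC) h2 (fun i hi j hj => h3 i (hCI hi) j hj)
    rw [e] at this
    refine this.trans (le_of_eq (by ring))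

lemma Bil_triv {p k n l a b A : ℕ} {M : ℝ} (hp : 0 < p) (hl : 1 ≤ l) (hlk : l ≤ k) (haA : a ≤ A)
    (hA : A ≤ n) (hM : 0 ≤ M) (hB : Bil p k n l A b M) : Bil p k n l a b ((p : ℝ) ^ (A - a) * M) := by
  have hp1 : (1 : ℝ) ≤ p := by exact_mod_cast hp
  refine Bil_step hl hlk haA hA (one_le_pow₀ hp1) hM hB ?_
  intro Ω _ w φ x I J hw hR h1 h2 h3
  exact Nrm_triv hp haA (sN_pos hl) (fun α => mul_nonneg (hw α) (by positivity)) φ x I h1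

lemma Bil_trivJ {p k n l a b B : ℕ} {M : ℝ} (hp : 0 < p) (hlk : l < k) (hbB : b ≤ B)
    (hB : B ≤ n) (hM : 0 ≤ M) (hBil : Bil p k n l a B M) :
    Bil p k n l a b ((p : ℝ) ^ (B - b) * M) := by
  intro Ω _ w φ x I J hw hR h1 h2 h3
  have hp1 : (1 : ℝ) ≤ p := by exact_mod_cast hp
  have hs1 : 1 ≤ sN k - sN l := by
    have := sN_mono (show l + 1 ≤ k by omega)
    rw [sN_succ] at this; omega
  set w' : Ω → ℝ := fun α => w α * (‖fs φ I α‖ ^ 2) ^ (sN l) with hw'd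
  have hw' : ∀ α, 0 ≤ w' α := fun α => mul_nonneg (hw α) (by positivity)
  have hVI := VV_nonneg p n (sN k) hw φ x I
  have hVJ := VV_nonneg p n (sN k) hw φ x J
  have e : ∀ T : Finset ℕ, ∑ α, w α * ((‖fs φ I α‖ ^ 2) ^ sN l * (‖fs φ T α‖ ^ 2) ^ (sN k - sN l)) =
      ∑ α, w' α * (‖fs φ T α‖ ^ 2) ^ (sN k - sN l) := by
    intro T; refine Finset.sum_congr rfl fun α _ => ?_
    rw [hw'd]; ring
  have := glue (p := p) (D := (p : ℝ) ^ (B - b))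
    (K := M ^ sN k * VV p n (sN k) w φ x I ^ (sN l)) (s' := sN k) hB
    hs1 hw hw' φ x J (by positivity) (by positivity) (Nrm_triv hp hbB hs1 hw' φ x J h2) ?_
  · rw [e]
    refine this.trans ?_
    calc ((p : ℝ) ^ (B - b)) ^ (sN k - sN l) * (M ^ sN k * VV p n (sN k) w φ x I ^ (sN l) *
            VV p n (sN k) w φ x J ^ (sN k - sN l))
        ≤ ((p : ℝ) ^ (B - b)) ^ (sN k) * (M ^ sN k * VV p n (sN k) w φ x I ^ (sN l) *
            VV p n (sN k) w φ x J ^ (sN k - sN l)) := by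
          gcongr
          · exact one_le_pow₀ hp1
          · omega
      _ = _ := by rw [mul_pow]; ring
  · intro C hC
    have hCI := pt_sub hC
    have := hBil Ω w φ x I C hw (Rich_sub hR (Finset.union_subset_union_right hCI))
      h1 (pt_congr hC) (fun i hi j hj => h3 i hi j (hCI hj))
    rw [e] at this
    refine this.trans (le_of_eq (by ring))

lemma Bil_dec {p k n l a b s0 : ℕ} {M D : ℝ} (hp : p.Prime) (hkp : k < p) (hl : 1 ≤ l) (hlk : l ≤ k)
    (hA : a + s0 ≤ n) (hs : l * s0 ≤ a) (hb : l * (a + s0) ≤ (k - l + 1) * b)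
    (hD : 1 ≤ D) (hM : 0 ≤ M) (hDec : Dec p l s0 D) (hB : Bil p k n l (a + s0) b M) :
    Bil p k n l a b (D * M) := by
  have hp0 := hp.pos
  refine Bil_step hl hlk (Nat.le_add_right _ _) hA hD hM hB ?_
  intro Ω _ w φ x I J hw hR h1 h2 h3
  have hw' : ∀ α, 0 ≤ w α * (‖fs φ J α‖ ^ 2) ^ (sN k - sN l) :=
    fun α => mul_nonneg (hw α) (by positivity)
  rcases I.eq_empty_or_nonempty with rfl | hI
  · have := sN_pos hl
    have h0 : sN l ≠ 0 := by omega
    simp [Nrm, VV, pt, fs, h0, Real.zero_rpow]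
  obtain ⟨ξ, y, hy, hξ⟩ := exists_y h1
  obtain ⟨i0, hi0, hxi⟩ := hξ hI
  have : ∃ ζ : ℤ, (∀ j ∈ J, (p : ℤ) ^ b ∣ x j - ζ) ∧ ¬ (p : ℤ) ∣ ξ - ζ := by
    rcases J.eq_empty_or_nonempty with rfl | ⟨j0, hj0⟩
    · refine ⟨ξ - 1, by simp, ?_⟩
      rw [sub_sub_cancel]
      exact (Nat.prime_iff_prime_int.1 hp).not_dvd_one
    · exact ⟨x j0, fun j hj => h2 j hj j0 hj0, hxi ▸ h3 i0 hi0 j0 hj0⟩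
  obtain ⟨ζ, hζ, hv⟩ := this
  have hL := LowerRich (e := sN k - sN l) (s0 := s0) hp hl (Nat.add_sub_of_le hlk) hkp ξ ζ hR hy hζ hv
    (by nlinarith) hb (Nat.mul_le_mul hlk hA)
  have := hDec Ω _ φ y I hw' hL
  have e := pt_rescale (p := p) (n := a + s0) (t := a) hp0 (Nat.le_add_right _ _) ξ hy
  rw [Nat.add_sub_cancel_left] at e
  unfold VV at this ⊢
  rwa [e] at this

lemma lemL {p k l : ℕ} (hp : p.Prime) (hkp : k < p) (hl : 1 ≤ l) (hlk : l ≤ k)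
    (IH : ∀ ε : ℝ, 0 < ε → ∃ C : ℝ, ∀ n : ℕ, Dec p l n (C * (p : ℝ) ^ (ε * n)))
    (ε : ℝ) (hε : 0 < ε) : ∃ C : ℝ, 1 ≤ C ∧ ∀ (n a a' b : ℕ) (M : ℝ), a ≤ a' →
      l * a' ≤ (k - l + 1) * b → a' ≤ n → 0 ≤ M → Bil p k n l a' b M →
      Bil p k n l a b (C * (p : ℝ) ^ (ε * n) * M) := by
  have hp0 := hp.pos
  have hp1 : (1 : ℝ) < p := by exact_mod_cast hp.one_lt
  have hpp : (0 : ℝ) < p := by linarith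
  obtain ⟨C0, hC0⟩ := IH (ε / 2) (by linarith)
  obtain ⟨s1, hs1⟩ := pow_unbounded_of_one_lt C0 (Real.one_lt_rpow hp1 (show 0 < ε / 2 by linarith))
  set s0 := s1 + 1 with hs0
  have hDs : Dec p l s0 ((p : ℝ) ^ (ε * s0)) := by
    refine Dec_mono (hC0 s0) ?_
    have : C0 ≤ (p : ℝ) ^ (ε / 2 * s0) := by
      refine hs1.le.trans ?_
      rw [← Real.rpow_natCast, ← Real.rpow_mul hpp.le]
      apply Real.rpow_le_rpow_of_exponent_le hp1.le
      rw [hs0]; push_cast; nlinarith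
    calc C0 * (p : ℝ) ^ (ε / 2 * s0) ≤ (p : ℝ) ^ (ε / 2 * s0) * (p : ℝ) ^ (ε / 2 * s0) := by gcongr
      _ = _ := by rw [← Real.rpow_add hpp]; ring_nf
  have claim : ∀ (d n a b : ℕ) (M : ℝ), l * s0 ≤ a → l * (a + d) ≤ (k - l + 1) * b → a + d ≤ n →
      0 ≤ M → Bil p k n l (a + d) b M → Bil p k n l a b ((p : ℝ) ^ (ε * d) * ((p : ℝ) ^ s0 * M)) := by
    intro d
    induction d using Nat.strong_induction_on with
    | _ d ih =>
      intro n a b M h1 h2 h3 hM hB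
      by_cases hd : d < s0
      · have := Bil_triv hp0 hl hlk (Nat.le_add_right a d) h3 hM hB
        refine Bil_mono this (by positivity) ?_
        rw [Nat.add_sub_cancel_left]
        have e1 : (p : ℝ) ^ d ≤ (p : ℝ) ^ s0 := pow_le_pow_right₀ hp1.le hd.le
        have e2 : 1 ≤ (p : ℝ) ^ (ε * d) := Real.one_le_rpow hp1.le (by positivity)
        calc (p : ℝ) ^ d * M ≤ (p : ℝ) ^ s0 * M := by gcongr
          _ ≤ _ := le_mul_of_one_le_left (by positivity) e2
      · push Not at hd
        obtain ⟨d', rfl⟩ := Nat.exists_eq_add_of_le hd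
        have e3 : a + (s0 + d') = a + s0 + d' := by ring
        have h4 : l * (a + s0 + d') ≤ (k - l + 1) * b := by rw [← e3]; exact h2
        have := ih d' (by omega) n (a + s0) b M (by omega) h4
          (by omega) hM (by rw [← e3]; exact hB)
        have h5 := Bil_dec hp hkp hl hlk (by omega) h1
          ((Nat.mul_le_mul_left l (by omega)).trans h4)
          (Real.one_le_rpow hp1.le (by positivity)) (by positivity) hDs this
        have e4 : (p : ℝ) ^ (ε * s0) * ((p : ℝ) ^ (ε * d') * ((p : ℝ) ^ s0 * M)) =
          (p : ℝ) ^ (ε * ((s0 + d' : ℕ) : ℝ)) * ((p : ℝ) ^ s0 * M) := by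
          rw [← mul_assoc, ← Real.rpow_add hpp]; push_cast; ring_nf
        rwa [e4] at h5
  refine ⟨(p : ℝ) ^ (l * s0) * (p : ℝ) ^ s0,
    one_le_mul_of_one_le_of_one_le (one_le_pow₀ hp1.le) (one_le_pow₀ hp1.le), ?_⟩
  intro n a a' b M h1 h2 h3 hM hB
  have key : ∀ d : ℕ, d ≤ n → (p : ℝ) ^ (ε * d) ≤ (p : ℝ) ^ (ε * n) := fun d hd =>
    Real.rpow_le_rpow_of_exponent_le hp1.le (by
      have : (d : ℝ) ≤ n := by exact_mod_cast hd
      gcongr)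
  have o1 : (1 : ℝ) ≤ (p : ℝ) ^ (l * s0) := one_le_pow₀ hp1.le
  have o2 : (1 : ℝ) ≤ (p : ℝ) ^ s0 := one_le_pow₀ hp1.le
  have o3 : (1 : ℝ) ≤ (p : ℝ) ^ (ε * n) := Real.one_le_rpow hp1.le (by positivity)
  by_cases hc : a' ≤ l * s0
  · refine Bil_mono (Bil_triv hp0 hl hlk h1 h3 hM hB) (by positivity) ?_
    have : (p : ℝ) ^ (a' - a) ≤ (p : ℝ) ^ (l * s0) := pow_le_pow_right₀ hp1.le (by omega)
    calc (p : ℝ) ^ (a' - a) * M ≤ (p : ℝ) ^ (l * s0) * M := by gcongr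
      _ ≤ _ := by
        gcongr
        rw [mul_assoc]
        exact le_mul_of_one_le_right (by positivity) (one_le_mul_of_one_le_of_one_le o2 o3)
  push Not at hc
  set a1 := max a (l * s0) with ha1
  have ha1' : a1 ≤ a' := max_le h1 hc.le
  obtain ⟨d, hd⟩ := Nat.exists_eq_add_of_le ha1'
  have h4 := claim d n a1 b M (le_max_right _ _) (by rw [← hd]; exact h2) (by omega) hM
    (by rw [← hd]; exact hB)
  have h5 := Bil_triv hp0 hl hlk (le_max_left a (l * s0)) (by omega) (by positivity) h4
  refine Bil_mono h5 (by positivity) ?_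
  have e1 : (p : ℝ) ^ (a1 - a) ≤ (p : ℝ) ^ (l * s0) := pow_le_pow_right₀ hp1.le (by omega)
  have e2 := key d (by omega)
  calc (p : ℝ) ^ (a1 - a) * ((p : ℝ) ^ (ε * d) * ((p : ℝ) ^ s0 * M)) ≤
      (p : ℝ) ^ (l * s0) * ((p : ℝ) ^ (ε * n) * ((p : ℝ) ^ s0 * M)) := by gcongr
    _ = _ := by ring

lemma sN_add (l u : ℕ) : sN (l + u) = sN l + sN u + l * u := by
  have h1 := two_sN (l + u)
  have h2 := two_sN l
  have h3 := two_sN u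
  nlinarith

lemma Bil_hold {p n l u a b : ℕ} {M M1 M2 : ℝ} (hu : 1 ≤ u)
    (hM : 0 ≤ M) (hM1 : 0 ≤ M1) (hM2 : 0 ≤ M2) (h : M1 * M2 ^ u ≤ M ^ (1 + u))
    (hB1 : Bil p (l + 1 + u) n u b a M1) (hB2 : Bil p (l + 1 + u) n l a b M2) :
    Bil p (l + 1 + u) n (l + 1) a b M := by
  intro Ω _ w φ x I J hw hR h1 h2 h3
  set V := VV p n (sN (l + 1 + u)) w φ x I with hV
  set W := VV p n (sN (l + 1 + u)) w φ x J with hW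
  have hV0 : 0 ≤ V := VV_nonneg p n _ hw φ x I
  have hW0 : 0 ≤ W := VV_nonneg p n _ hw φ x J
  have g1 := hB1 Ω w φ x J I hw (by rwa [Finset.union_comm]) h2 h1
    (fun i hi j hj hd => h3 j hj i hi (by rw [← neg_sub]; exact hd.neg_right))
  have g2 := hB2 Ω w φ x I J hw hR h1 h2 h3
  rw [← hV, ← hW] at g1 g2
  have es : sN (l + 1 + u) = sN (l + 1) + sN u + (l + 1) * u := sN_add _ _
  have el : sN (l + 1) = sN l + (l + 1) := sN_succ l
  have d1 : sN (l + 1 + u) - sN u = sN l + (l + 1) + (l + 1) * u := by omega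
  have d2 : sN (l + 1 + u) - sN l = (l + 1) + sN u + (l + 1) * u := by omega
  have d3 : sN (l + 1 + u) - sN (l + 1) = sN u + (l + 1) * u := by omega
  rw [d1] at g1
  rw [d2] at g2
  rw [d3]
  set s := sN (l + 1 + u) with hs
  have hh := hold w hw 1 u le_rfl hu
    (fun α => (‖fs φ I α‖ ^ 2) ^ sN (l + 1) * (‖fs φ J α‖ ^ 2) ^ (sN u + (l + 1) * u))
    (fun α => (‖fs φ J α‖ ^ 2) ^ sN u * (‖fs φ I α‖ ^ 2) ^ (sN l + (l + 1) + (l + 1) * u))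
    (fun α => (‖fs φ I α‖ ^ 2) ^ sN l * (‖fs φ J α‖ ^ 2) ^ ((l + 1) + sN u + (l + 1) * u))
    (fun α => by positivity) (fun α => by positivity) (fun α => by positivity) (fun α => by
      rw [el]; ring)
  have hpow : (∑ α, w α * ((‖fs φ I α‖ ^ 2) ^ sN (l + 1) * (‖fs φ J α‖ ^ 2) ^ (sN u + (l + 1) * u)))
      ^ (1 + u) ≤ (M ^ s * (V ^ sN (l + 1) * W ^ (sN u + (l + 1) * u))) ^ (1 + u) := by
    refine hh.trans ?_
    calc _ ≤ (M1 ^ s * (W ^ sN u * V ^ (sN l + (l + 1) + (l + 1) * u))) ^ 1 *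
          (M2 ^ s * (V ^ sN l * W ^ ((l + 1) + sN u + (l + 1) * u))) ^ u := by
          have n1 : 0 ≤ ∑ α, w α * ((‖fs φ J α‖ ^ 2) ^ sN u * (‖fs φ I α‖ ^ 2) ^ (sN l + (l + 1) + (l + 1) * u)) :=
            Finset.sum_nonneg fun α _ => mul_nonneg (hw α) (by positivity)
          have n2 : 0 ≤ ∑ α, w α * ((‖fs φ I α‖ ^ 2) ^ sN l * (‖fs φ J α‖ ^ 2) ^ ((l + 1) + sN u + (l + 1) * u)) :=
            Finset.sum_nonneg fun α _ => mul_nonneg (hw α) (by positivity)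
          exact mul_le_mul (pow_le_pow_left₀ n1 g1 _) (pow_le_pow_left₀ n2 g2 _) (by positivity)
            (by positivity)
      _ = (M1 * M2 ^ u) ^ s * (V ^ (sN (l + 1) * (1 + u)) * W ^ ((sN u + (l + 1) * u) * (1 + u))) := by
          rw [el]; ring
      _ ≤ (M ^ (1 + u)) ^ s * (V ^ (sN (l + 1) * (1 + u)) * W ^ ((sN u + (l + 1) * u) * (1 + u))) := by
          gcongr
      _ = _ := by ring
  exact le_of_pow_le_pow_left₀ (by omega) (by positivity) hpow

lemma Bil_zero {p k n a b : ℕ} {D : ℝ} (hp : 0 < p) (hk : 1 ≤ k) (hb : b ≤ n)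
    (hD : Dec p k (n - b) D) : Bil p k n 0 a b D := by
  intro Ω _ w φ x I J hw hR h1 h2 h3
  have := Dec_class hp hb hD hw (Rich_sub hR Finset.subset_union_right) h2
  have h4 := pow_le_pow_left₀ (Nrm_nonneg _ hw _) this (sN k)
  rw [Nrm_pow (sN_pos hk) hw, mul_pow] at h4
  have e : sN 0 = 0 := rfl
  simpa [e] using h4

lemma Bil_of_Dec {p k n l a b : ℕ} {D : ℝ} (hD0 : 0 ≤ D) (hl : 1 ≤ l) (hlk : l < k)
    (hD : Dec p k n D) : Bil p k n l a b D := by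
  intro Ω _ w φ x I J hw hR h1 h2 h3
  have gI := hD Ω w φ x I hw (Rich_sub hR Finset.subset_union_left)
  have gJ := hD Ω w φ x J hw (Rich_sub hR Finset.subset_union_right)
  have hk : 1 ≤ k := by omega
  have hIp := pow_le_pow_left₀ (Nrm_nonneg _ hw _) gI (sN k)
  have hJp := pow_le_pow_left₀ (Nrm_nonneg _ hw _) gJ (sN k)
  rw [Nrm_pow (sN_pos hk) hw] at hIp hJp
  have hs1 : 1 ≤ sN k - sN l := by
    have := sN_mono (show l + 1 ≤ k by omega)
    rw [sN_succ] at this; omega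
  have hse : sN l + (sN k - sN l) = sN k := Nat.add_sub_of_le (sN_mono hlk.le)
  have hV0 : 0 ≤ VV p n (sN k) w φ x I := VV_nonneg p n _ hw φ x I
  have hW0 : 0 ≤ VV p n (sN k) w φ x J := VV_nonneg p n _ hw φ x J
  have hh := hold w hw (sN l) (sN k - sN l) (sN_pos hl) hs1
    (fun α => (‖fs φ I α‖ ^ 2) ^ sN l * (‖fs φ J α‖ ^ 2) ^ (sN k - sN l))
    (fun α => (‖fs φ I α‖ ^ 2) ^ sN k) (fun α => (‖fs φ J α‖ ^ 2) ^ sN k)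
    (fun α => by positivity) (fun α => by positivity) (fun α => by positivity) (fun α => by
      rw [hse]; ring)
  rw [hse] at hh
  have hpow : (∑ α, w α * ((‖fs φ I α‖ ^ 2) ^ sN l * (‖fs φ J α‖ ^ 2) ^ (sN k - sN l))) ^ sN k ≤
    (D ^ sN k * (VV p n (sN k) w φ x I ^ sN l * VV p n (sN k) w φ x J ^ (sN k - sN l))) ^ sN k := by
    refine hh.trans ?_
    calc _ ≤ ((D * VV p n (sN k) w φ x I) ^ sN k) ^ sN l *
          ((D * VV p n (sN k) w φ x J) ^ sN k) ^ (sN k - sN l) := by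
          have n1 : 0 ≤ ∑ α, w α * (‖fs φ I α‖ ^ 2) ^ sN k :=
            Finset.sum_nonneg fun α _ => mul_nonneg (hw α) (by positivity)
          have n2 : 0 ≤ ∑ α, w α * (‖fs φ J α‖ ^ 2) ^ sN k :=
            Finset.sum_nonneg fun α _ => mul_nonneg (hw α) (by positivity)
          exact mul_le_mul (pow_le_pow_left₀ n1 hIp _) (pow_le_pow_left₀ n2 hJp _) (by positivity)
            (by positivity)
      _ = (D ^ (sN l + (sN k - sN l)) * (VV p n (sN k) w φ x I ^ sN l * VV p n (sN k) w φ x J ^ (sN k - sN l))) ^ sN k := by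
          rw [pow_add]; simp only [mul_pow, ← pow_mul]; ring
      _ = _ := by rw [hse]
  exact le_of_pow_le_pow_left₀ (by have := sN_pos hk; omega) (by positivity) hpow
end VMVT

namespace VMVT
open Finset Polynomial

/-- gain coefficients -/
noncomputable def Aco (k : ℕ) : ℕ → ℕ → ℝ
  | 0, l => if l = 0 then 1 else 0
  | _ + 1, 0 => 1
  | r + 1, l + 1 => Aco k r (k - (l + 1)) / (l + 1) +
      ((k - (l + 1) : ℕ) : ℝ) / (((k - (l + 1) : ℕ) : ℝ) + 1) * Aco k r l

lemma Aco_zero (k r : ℕ) : Aco k r 0 = 1 := by cases r <;> simp [Aco]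

lemma Aco_sum (k r : ℕ) :
    ∑ l ∈ Finset.range (k + 1), Aco (k + 2) r (l + 1) = r * ((k + 1 : ℝ) / (k + 2)) := by
  induction r with
  | zero => simp [Aco]
  | succ r ih =>
    simp only [Aco]
    rw [Finset.sum_add_distrib]
    have e1 : ∑ l ∈ Finset.range (k + 1), Aco (k + 2) r (k + 2 - (l + 1)) / ((l : ℝ) + 1) =
        ∑ l ∈ Finset.range (k + 1), Aco (k + 2) r (l + 1) / ((k + 1 - l : ℕ) : ℝ) := by
      rw [← Finset.sum_range_reflect]
      refine Finset.sum_congr rfl fun l hl => ?_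
      have hl' := Finset.mem_range.1 hl
      have a1 : k + 2 - (k + 1 - 1 - l + 1) = l + 1 := by omega
      have a2 : k + 1 - l = (k + 1 - 1 - l) + 1 := by omega
      rw [a1, a2]
      push_cast
      rfl
    have e2 : ∑ l ∈ Finset.range (k + 1), ((k + 2 - (l + 1) : ℕ) : ℝ) / (((k + 2 - (l + 1) : ℕ) : ℝ) + 1) *
        Aco (k + 2) r l = (k + 1 : ℝ) / (k + 2) + ∑ l ∈ Finset.range (k + 1),
          ((k - l : ℕ) : ℝ) / ((k + 1 - l : ℕ) : ℝ) * Aco (k + 2) r (l + 1) := by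
      rw [Finset.sum_range_succ', Finset.sum_range_succ _ k, Aco_zero, add_comm]
      congr 1
      · push_cast [show k + 2 - (0 + 1) = k + 1 by omega]
        rw [mul_one]; congr 1; ring
      · simp only [Nat.sub_self, Nat.cast_zero, zero_div, zero_mul, add_zero]
        refine Finset.sum_congr rfl fun l hl => ?_
        have hl' := Finset.mem_range.1 hl
        have a1 : k + 2 - (l + 1 + 1) = k - l := by omega
        have a2 : k + 1 - l = (k - l) + 1 := by omega
        rw [a1, a2]; push_cast; rfl
    rw [e1, e2, add_left_comm, ← Finset.sum_add_distrib]
    have e3 : ∑ l ∈ Finset.range (k + 1), (Aco (k + 2) r (l + 1) / ((k + 1 - l : ℕ) : ℝ) +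
        ((k - l : ℕ) : ℝ) / ((k + 1 - l : ℕ) : ℝ) * Aco (k + 2) r (l + 1)) =
        ∑ l ∈ Finset.range (k + 1), Aco (k + 2) r (l + 1) := by
      refine Finset.sum_congr rfl fun l hl => ?_
      have hl' := Finset.mem_range.1 hl
      have a2 : k + 1 - l = (k - l) + 1 := by omega
      rw [a2]; push_cast
      have : ((k - l : ℕ) : ℝ) + 1 ≠ 0 := by positivity
      field_simp
      ring
    rw [e3, ih]
    push_cast; ring

lemma Aco_large (k : ℕ) (hk : 2 ≤ k) (B : ℝ) : ∃ r l : ℕ, 1 ≤ r ∧ 1 ≤ l ∧ l < k ∧ B ≤ Aco k r l := by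
  obtain ⟨k, rfl⟩ := Nat.exists_eq_add_of_le' hk
  obtain ⟨r0, hr0⟩ := exists_nat_ge (B * (k + 2))
  by_contra hcon
  push Not at hcon
  have h1 : ∑ l ∈ Finset.range (k + 1), Aco (k + 2) (r0 + 1) (l + 1) < ∑ l ∈ Finset.range (k + 1), B := by
    refine Finset.sum_lt_sum_of_nonempty (by simp) fun l hl => ?_
    have hl' := Finset.mem_range.1 hl
    exact hcon _ _ (by omega) (by omega) (by omega)
  rw [Aco_sum] at h1
  simp only [Finset.sum_const, Finset.card_range, nsmul_eq_mul] at h1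
  push_cast at h1
  have hk2 : (0 : ℝ) < k + 2 := by positivity
  have hk1 : (0 : ℝ) < k + 1 := by positivity
  rw [mul_div_assoc', div_lt_iff₀ hk2] at h1
  nlinarith

def PP (p k : ℕ) (η : ℝ) (r : ℕ) : Prop :=
  ∀ l, 1 ≤ l → l < k → ∀ ε : ℝ, 0 < ε → ∃ C : ℝ, 1 ≤ C ∧ ∀ n a b : ℕ,
    (k.factorial ^ 2) ^ r ∣ b → k ^ (r + 1) * b ≤ n → l * a = (k - l + 1) * b →
    Bil p k n l a b (C * (p : ℝ) ^ ((η + ε) * n - Aco k r l * η * b))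

def Good (p k : ℕ) (η : ℝ) : Prop := ∃ C : ℝ, ∀ n : ℕ, Dec p k n (C * (p : ℝ) ^ (η * n))

lemma PP_zero {p k : ℕ} (hp : p.Prime) {η : ℝ} (h : Good p k η) : PP p k η 0 := by
  intro l hl hlk ε hε
  obtain ⟨C, hC⟩ := h
  have hp1 : (1 : ℝ) < p := by exact_mod_cast hp.one_lt
  have hpp : (0 : ℝ) < p := by linarith
  refine ⟨max C 1, le_max_right _ _, fun n a b _ _ _ => ?_⟩
  have h0 : 0 < max C 1 := lt_of_lt_of_le one_pos (le_max_right _ _)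
  refine Bil_of_Dec (by positivity) hl hlk (Dec_mono (hC n) ?_)
  have e : Aco k 0 l = 0 := by simp [Aco]; omega
  rw [e]
  calc C * (p : ℝ) ^ (η * n) ≤ max C 1 * (p : ℝ) ^ (η * n) := by
        gcongr; exact le_max_left _ _
    _ ≤ _ := by
      gcongr
      · exact hp1.le
      · have : 0 ≤ ε * n := by positivity
        linarith

set_option maxHeartbeats 1000000 in
lemma PP_succ {p k r : ℕ} (hp : p.Prime) (hkp : k < p) {η : ℝ} (hη : 0 ≤ η) (hg : Good p k η)
    (IH : ∀ l, 1 ≤ l → l < k → ∀ ε : ℝ, 0 < ε → Good p l ε)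
    (h : PP p k η r) : PP p k η (r + 1) := by
  intro l hl hlk ε hε
  have hp0 := hp.pos
  have hp1 : (1 : ℝ) < p := by exact_mod_cast hp.one_lt
  have hpp : (0 : ℝ) < p := by linarith
  obtain ⟨l, rfl⟩ := Nat.exists_eq_add_of_le' hl
  obtain ⟨u, rfl⟩ := Nat.exists_eq_add_of_le hlk.le
  have hu : 1 ≤ u := by omega
  set k := l + 1 + u with hk
  obtain ⟨C1, hC1, H1⟩ := h u hu (by omega) (ε / 2) (by linarith)
  obtain ⟨C2, hC2, H2⟩ := lemL hp hkp hu (by omega) (IH u hu (by omega)) (ε / 2) (by linarith)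
  -- second bilinear form
  have hM2 : ∃ C3 : ℝ, 1 ≤ C3 ∧ ∀ n a b : ℕ, (k.factorial ^ 2) ^ (r + 1) ∣ b → k ^ (r + 2) * b ≤ n →
      (l + 1) * a = (k - (l + 1) + 1) * b →
      Bil p k n l a b (C3 * (p : ℝ) ^ ((η + ε) * n - Aco k r l * η * b)) := by
    rcases Nat.eq_zero_or_pos l with h0 | hlpos
    · subst h0
      obtain ⟨C, hC⟩ := hg
      refine ⟨max C 1, le_max_right _ _, fun n a b hb hbn hab => ?_⟩
      have hbn' : b ≤ n := le_trans (Nat.le_mul_of_pos_left _ (by positivity)) hbn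
      have h0 : 0 < max C 1 := lt_of_lt_of_le one_pos (le_max_right _ _)
      refine Bil_zero hp0 (by omega) hbn' (Dec_mono (hC (n - b)) ?_)
      rw [Aco_zero]
      calc C * (p : ℝ) ^ (η * ((n - b : ℕ) : ℝ)) ≤ max C 1 * (p : ℝ) ^ (η * ((n - b : ℕ) : ℝ)) := by
            gcongr; exact le_max_left _ _
        _ ≤ _ := by
          gcongr
          · exact hp1.le
          · rw [Nat.cast_sub hbn']
            have : 0 ≤ ε * n := by positivity
            linarith
    · obtain ⟨C4, hC4, H4⟩ := h l hlpos (by omega) (ε / 2) (by linarith)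
      obtain ⟨C5, hC5, H5⟩ := lemL hp hkp hlpos (by omega) (IH l hlpos (by omega)) (ε / 2) (by linarith)
      refine ⟨C5 * C4, one_le_mul_of_one_le_of_one_le hC5 hC4, fun n a b hb hbn hab => ?_⟩
      have hlb : l ∣ b := by
        refine dvd_trans ?_ hb
        refine dvd_trans (Nat.dvd_factorial hlpos (show l ≤ k by omega)) ?_
        rw [← pow_mul]
        exact dvd_pow_self _ (by omega)
      obtain ⟨b0, rfl⟩ := hlb
      have hua : (k - l + 1) * (l * b0) = l * ((k - l + 1) * b0) := by ring
      have hbk : k ^ (r + 1) * (l * b0) ≤ n := by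
        refine le_trans (Nat.mul_le_mul_right _ (Nat.pow_le_pow_right (by omega) (by omega))) hbn
      have hkn : k * (l * b0) ≤ n := by
        refine le_trans (Nat.mul_le_mul_right _ ?_) hbn
        exact Nat.le_self_pow (by omega) _
      have hB := H4 n ((k - l + 1) * b0) (l * b0)
        (dvd_trans (pow_dvd_pow _ (by omega)) hb) hbk hua.symm
      have hB2 := H5 n a ((k - l + 1) * b0) (l * b0) _ ?_ hua.ge ?_ (by positivity) hB
      · refine Bil_mono hB2 (by positivity) (le_of_eq ?_)
        rw [show C5 * (p : ℝ) ^ (ε / 2 * n) * (C4 * (p : ℝ) ^ ((η + ε / 2) * n - Aco k r l * η * ((l * b0 : ℕ) : ℝ))) =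
          C5 * C4 * ((p : ℝ) ^ (ε / 2 * n) * (p : ℝ) ^ ((η + ε / 2) * n - Aco k r l * η * ((l * b0 : ℕ) : ℝ))) by ring,
          ← Real.rpow_add hpp]
        congr 2; ring
      · -- a ≤ (k-l+1) b0
        have h6 : k - (l + 1) + 1 = u + 1 := by omega
        have h7 : k - l + 1 = u + 2 := by omega
        rw [h6] at hab
        rw [h7]
        have : (l + 1) * a ≤ (l + 1) * ((u + 2) * b0) := by
          rw [hab, show (l + 1) * ((u + 2) * b0) = ((u + 2) * (l + 1)) * b0 by ring, ← mul_assoc]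
          exact Nat.mul_le_mul_right _ (Nat.mul_le_mul (by omega) (by omega))
        exact Nat.le_of_mul_le_mul_left this (by omega)
      · refine le_trans ?_ hkn
        have h7 : k - l + 1 = u + 2 := by omega
        rw [h7, ← mul_assoc]
        exact Nat.mul_le_mul_right _ (le_trans (show u + 2 ≤ k by omega) (Nat.le_mul_of_pos_right _ hlpos))
  obtain ⟨C3, hC3, H3⟩ := hM2
  have hC21 : 1 ≤ C2 * C1 := one_le_mul_of_one_le_of_one_le hC2 hC1
  set Cm := (C2 * C1) * C3 with hCm
  have hCm1 : 1 ≤ Cm := one_le_mul_of_one_le_of_one_le hC21 hC3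
  refine ⟨Cm, hCm1, fun n a b hb hbn hab => ?_⟩
  have hB2 := H3 n a b hb hbn hab
  have h6 : k - (l + 1) + 1 = u + 1 := by omega
  rw [h6] at hab
  -- structure of b
  obtain ⟨c, hc⟩ := hb
  obtain ⟨f1, hf1⟩ := Nat.dvd_factorial (show 0 < l + 1 by omega) (show l + 1 ≤ k by omega)
  obtain ⟨f2, hf2⟩ := Nat.dvd_factorial (show 0 < u by omega) (show u ≤ k by omega)
  have hfk : k.factorial ^ 2 = (l + 1) * f1 * (u * f2) := by rw [sq]; nth_rw 1 [hf1]; rw [hf2]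
  set Kr := (k.factorial ^ 2) ^ r with hKr
  have ha : a = Kr * ((u + 1) * f1 * (u * f2) * c) := by
    have : (l + 1) * a = (l + 1) * (Kr * ((u + 1) * f1 * (u * f2) * c)) := by
      rw [hab, hc, pow_succ, ← hKr, hfk]; ring
    exact Nat.eq_of_mul_eq_mul_left (by omega) this
  set b' := (l + 2) * (Kr * ((u + 1) * f1 * f2 * c)) with hb'
  have hub' : u * b' = (k - u + 1) * a := by
    have : k - u + 1 = l + 2 := by omega
    rw [this, ha, hb']; ring
  have hab2 : a ≤ k * b := by
    have : (l + 1) * a ≤ (l + 1) * (k * b) := by rw [hab, ← mul_assoc]; exact Nat.mul_le_mul_right _ (le_trans (show u + 1 ≤ k by omega) (Nat.le_mul_of_pos_left _ (by omega)))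
    exact Nat.le_of_mul_le_mul_left this (by omega)
  have hkb : k ^ 2 * b ≤ n := le_trans (Nat.mul_le_mul_right _ (Nat.pow_le_pow_right (by omega) (by omega))) hbn
  have hbb' : b ≤ b' := by
    have : ((l + 1) * u) * b ≤ ((l + 1) * u) * b' := by
      rw [mul_assoc, mul_assoc, hub', show k - u + 1 = l + 2 by omega]
      have : (l + 1) * ((l + 2) * a) = (l + 2) * ((u + 1) * b) := by rw [← hab]; ring
      rw [this, ← mul_assoc, ← mul_assoc]
      exact Nat.mul_le_mul_right _ (Nat.mul_le_mul (by omega) (by omega))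
    exact Nat.le_of_mul_le_mul_left this (by positivity)
  have hb'n : b' ≤ n := by
    refine le_trans ?_ hkb
    have : u * b' ≤ u * (k ^ 2 * b) := by
      rw [hub', show k - u + 1 = l + 2 by omega]
      have : (l + 2) * a ≤ k * (k * b) := Nat.mul_le_mul (by omega) hab2
      refine this.trans ?_
      rw [← mul_assoc, ← sq]
      exact Nat.le_mul_of_pos_left _ (by omega)
    exact Nat.le_of_mul_le_mul_left this (by omega)
  have hB1 := H1 n b' a ⟨_, ha⟩ (by
    refine le_trans (Nat.mul_le_mul_left _ hab2) ?_
    rw [← mul_assoc, ← pow_succ]; exact hbn) hub'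
  have hB1' := H2 n b b' a _ hbb' hub'.le hb'n (by positivity) hB1
  refine Bil_hold hu (by positivity) (by positivity) (by positivity) ?_ hB1' hB2
  have hareal : ((l : ℝ) + 1) * a = ((u : ℝ) + 1) * b := by exact_mod_cast hab
  calc C2 * (p : ℝ) ^ (ε / 2 * n) * (C1 * (p : ℝ) ^ ((η + ε / 2) * n - Aco k r u * η * a)) *
        (C3 * (p : ℝ) ^ ((η + ε) * n - Aco k r l * η * b)) ^ u
      = (C2 * C1) * C3 ^ u * (p : ℝ) ^ ((1 + u) * ((η + ε) * n) - Aco k r u * η * a - u * (Aco k r l * η * b)) := by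
        rw [mul_pow, ← Real.rpow_natCast _ u, ← Real.rpow_natCast ((p : ℝ) ^ _) u, ← Real.rpow_mul hpp.le]
        rw [show ∀ A B C D E F : ℝ, A * B * (C * D) * (E * F) = A * C * E * (B * D * F) by intros; ring,
          ← Real.rpow_add hpp, ← Real.rpow_add hpp]
        congr 2; ring
    _ ≤ Cm ^ (1 + u) * (p : ℝ) ^ ((1 + u) * ((η + ε) * n) - Aco k r u * η * a - u * (Aco k r l * η * b)) := by
        gcongr
        rw [hCm, pow_add, pow_one]
        have e1 : C2 * C1 ≤ C2 * C1 * C3 := le_mul_of_one_le_right (by positivity) hC3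
        have e2 : C3 ^ u ≤ (C2 * C1 * C3) ^ u :=
          pow_le_pow_left₀ (by positivity) (le_mul_of_one_le_left (by positivity) hC21) _
        exact mul_le_mul e1 e2 (by positivity) (by positivity)
    _ = _ := by
        rw [mul_pow Cm, ← Real.rpow_natCast ((p : ℝ) ^ _), ← Real.rpow_mul hpp.le]
        congr 2
        simp only [Aco]
        rw [show k - (l + 1) = u by omega]
        push_cast
        have hl0 : (l : ℝ) + 1 ≠ 0 := by positivity
        have hu0 : (u : ℝ) + 1 ≠ 0 := by positivity
        have e5 : (a : ℝ) = ((u : ℝ) + 1) * b / (l + 1) := by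
          field_simp; linarith
        rw [e5]
        field_simp
        ring

lemma PP_all {p k : ℕ} (hp : p.Prime) (hkp : k < p) {η : ℝ} (hη : 0 ≤ η) (hg : Good p k η)
    (IH : ∀ l, 1 ≤ l → l < k → ∀ ε : ℝ, 0 < ε → Good p l ε) (r : ℕ) : PP p k η r := by
  induction r with
  | zero => exact PP_zero hp hg
  | succ r ih => exact PP_succ hp hkp hη hg IH ih

lemma Bil_amono {p k n l a b a' b' : ℕ} {M : ℝ} (h : Bil p k n l a b M) (ha : a ≤ a') (hb : b ≤ b') :
    Bil p k n l a' b' M := by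
  intro Ω _ w φ x I J hw hR h1 h2 h3
  exact h Ω w φ x I J hw hR (fun i hi j hj => (pow_dvd_pow _ ha).trans (h1 i hi j hj))
    (fun i hi j hj => (pow_dvd_pow _ hb).trans (h2 i hi j hj)) h3

/-- gain of bilinear form at level (1,1) -/
lemma Bil_gain {p k : ℕ} (hp : p.Prime) (hk : 2 ≤ k) (hkp : k < p) {η0 : ℝ} (hη0 : 0 < η0)
    (IH : ∀ l, 1 ≤ l → l < k → ∀ ε : ℝ, 0 < ε → Good p l ε) :
    ∃ c : ℝ, 0 < c ∧ ∃ l, 1 ≤ l ∧ l < k ∧ ∀ η, η0 ≤ η → Good p k η → ∃ C : ℝ, 1 ≤ C ∧ ∀ n : ℕ,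
      Bil p k n l 1 1 (C * (p : ℝ) ^ ((η - c) * n)) := by
  have hp0 := hp.pos
  have hp1 : (1 : ℝ) < p := by exact_mod_cast hp.one_lt
  have hpp : (0 : ℝ) < p := by linarith
  obtain ⟨r, l, hr, hl, hlk, hA⟩ := Aco_large k hk ((k + 2) / η0)
  have hkr : (0 : ℝ) < (k : ℝ) ^ (r + 1) := by positivity
  refine ⟨1 / (2 * (k : ℝ) ^ (r + 1)), by positivity, l, hl, hlk, fun η hη hg => ?_⟩
  obtain ⟨C, hC, H⟩ := PP_all hp hkp (hη0.le.trans hη) hg IH r l hl hlk (1 / (2 * (k : ℝ) ^ (r + 1)))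
    (by positivity)
  set Kr := (k.factorial ^ 2) ^ r with hKr
  have hKr0 : 0 < Kr := by positivity
  refine ⟨C * (p : ℝ) ^ Kr, one_le_mul_of_one_le_of_one_le hC (one_le_pow₀ hp1.le), fun n => ?_⟩
  set t := n / (k ^ (r + 1) * Kr) with ht
  set b := Kr * t with hb
  have hbn : k ^ (r + 1) * b ≤ n := by
    rw [hb, ← mul_assoc]; exact Nat.mul_div_le _ _
  have hbn2 : n < k ^ (r + 1) * (b + Kr) := by
    have := Nat.lt_mul_div_succ n (show 0 < k ^ (r + 1) * Kr by positivity)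
    rw [← ht] at this
    calc n < _ := this
      _ = _ := by rw [hb]; ring
  have hlb : l ∣ b := by
    refine dvd_trans (Nat.dvd_factorial hl hlk.le) (dvd_trans ?_ (Dvd.intro _ rfl))
    rw [hKr, ← pow_mul]
    exact dvd_pow_self _ (by omega)
  obtain ⟨b0, hb0⟩ := hlb
  have hab : l * ((k - l + 1) * b0) = (k - l + 1) * b := by rw [hb0]; ring
  have hB := H n ((k - l + 1) * b0) b (Dvd.intro _ rfl) hbn hab
  set a := (k - l + 1) * b0 with ha
  have hakb : a ≤ k * b := by
    rw [ha, hb0]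
    calc (k - l + 1) * b0 ≤ k * b0 := Nat.mul_le_mul_right _ (by omega)
      _ ≤ _ := Nat.mul_le_mul_left _ (Nat.le_mul_of_pos_left _ (by omega))
  have hkbn : k * b ≤ n := le_trans (Nat.mul_le_mul_right _ (Nat.le_self_pow (by omega) _)) hbn
  have hbn' : b ≤ n := le_trans (Nat.le_mul_of_pos_left _ (by omega)) hkbn
  have hB1 := Bil_triv hp0 hl hlk.le (Nat.zero_le a) (hakb.trans hkbn) (by positivity) hB
  have hB2 := Bil_trivJ hp0 hlk (Nat.zero_le b) hbn' (by positivity) hB1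
  refine Bil_mono (Bil_amono hB2 (Nat.zero_le 1) (Nat.zero_le 1)) (by positivity) ?_
  rw [Nat.sub_zero, Nat.sub_zero]
  rw [show ∀ x y z w : ℝ, x * (y * (z * w)) = z * (x * y * w) by intros; ring, mul_assoc C]
  refine mul_le_mul_of_nonneg_left ?_ (by positivity)
  rw [← Real.rpow_natCast _ b, ← Real.rpow_natCast _ a, ← Real.rpow_natCast _ Kr, ← Real.rpow_add hpp,
    ← Real.rpow_add hpp, ← Real.rpow_add hpp]
  apply Real.rpow_le_rpow_of_exponent_le hp1.le
  have r1 : (a : ℝ) ≤ k * b := by exact_mod_cast hakb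
  have r2 : (n : ℝ) ≤ (k : ℝ) ^ (r + 1) * (b + Kr) := by exact_mod_cast hbn2.le
  have r3 : (k : ℝ) + 2 ≤ Aco k r l * η := by
    rw [div_le_iff₀ hη0] at hA
    refine hA.trans ?_
    have : 0 ≤ Aco k r l := by
      by_contra hneg
      push Not at hneg
      have : (0 : ℝ) < k + 2 := by positivity
      nlinarith
    gcongr
  have r4 : ((k : ℝ) + 2) * b ≤ Aco k r l * η * b := by gcongr
  set δ := 1 / (2 * (k : ℝ) ^ (r + 1)) with hδ
  have r5 : 2 * δ * n ≤ b + Kr := by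
    have : 2 * δ * (k : ℝ) ^ (r + 1) = 1 := by rw [hδ]; field_simp
    have hd : 0 ≤ 2 * δ := by positivity
    calc 2 * δ * n ≤ 2 * δ * ((k : ℝ) ^ (r + 1) * (b + Kr)) := by gcongr
      _ = _ := by rw [← mul_assoc, this, one_mul]
  nlinarith

lemma Dec_rec {p k n l : ℕ} (hp : p.Prime) (hk : 1 ≤ k) (hlk : l < k) {D M : ℝ}
    (hM : 0 ≤ M) (hD : Dec p k n D) (hB : Bil p k (n + 1) l 1 1 M) :
    Dec p k (n + 1) (D + (p : ℝ) ^ 2 * M) := by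
  intro Ω _ w φ x S hw hR
  have hp0 := hp.pos
  have hs := sN_pos hk
  set V := VV p (n + 1) (sN k) w φ x S with hV
  have hV0 : 0 ≤ V := VV_nonneg _ _ _ hw _ _ _
  set T := pt p 1 x S with hT
  have hTc : (T.card : ℝ) ≤ p := by
    have := card_pt (a := 0) hp0 (Nat.zero_le 1) x S (by simp)
    simp only [Nat.sub_zero, pow_one] at this
    exact_mod_cast this
  have hVC : ∀ C ∈ T, VV p (n + 1) (sN k) w φ x C ≤ V := by
    intro C hC
    rw [hV, ← VV_add (show 1 ≤ n + 1 by omega) (sN k) w φ x S]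
    exact Finset.single_le_sum (f := fun C => VV p (n + 1) (sN k) w φ x C)
      (fun C _ => VV_nonneg _ _ _ hw _ _ _) hC
  have hpt : ∀ α, ‖fs φ S α‖ ^ 2 ≤ ∑ q ∈ T ×ˢ T, ‖fs φ q.1 α‖ * ‖fs φ q.2 α‖ := by
    intro α
    rw [Finset.sum_product]
    show _ ≤ ∑ c ∈ T, ∑ c' ∈ T, ‖fs φ c α‖ * ‖fs φ c' α‖
    rw [← Finset.sum_mul_sum, ← sq, fs_pt p 1 x S φ α]
    gcongr; exact norm_sum_le _ _
  have h1 : Nrm (sN k) w (fs φ S) ≤ ∑ q ∈ T ×ˢ T,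
      (∑ α, w α * (‖fs φ q.1 α‖ * ‖fs φ q.2 α‖) ^ sN k) ^ ((1 : ℝ) / sN k) := by
    refine le_trans ?_ (mink (sN k) hs w hw (T ×ˢ T) (fun q α => ‖fs φ q.1 α‖ * ‖fs φ q.2 α‖)
      (fun q α => by positivity))
    unfold Nrm
    refine Real.rpow_le_rpow
          (Finset.sum_nonneg fun α _ => mul_nonneg (hw α) (by positivity)) ?_ (by positivity)
    refine Finset.sum_le_sum fun α _ => mul_le_mul_of_nonneg_left ?_ (hw α)
    exact pow_le_pow_left₀ (by positivity) (hpt α) _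
  have h2 : ∀ q ∈ T ×ˢ T, (∑ α, w α * (‖fs φ q.1 α‖ * ‖fs φ q.2 α‖) ^ sN k) ^ ((1 : ℝ) / sN k) ≤
      (if q.1 = q.2 then D * VV p (n + 1) (sN k) w φ x q.1 else 0) + M * V := by
    intro q hq
    obtain ⟨hq1, hq2⟩ := Finset.mem_product.1 hq
    split_ifs with hqq
    · rw [← hqq]
      simp_rw [← sq]
      have := Dec_class (n := n + 1) (t := 1) hp0 (by omega) (by simpa using hD) hw
        (Rich_sub hR (pt_sub hq1)) (pt_congr hq1)
      refine le_trans this ?_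
      have : 0 ≤ M * V := by positivity
      linarith
    · rw [zero_add]
      have hd := pt_ne hq1 hq2 hqq
      have g1 := hB Ω w φ x q.1 q.2 hw
        (Rich_sub hR (Finset.union_subset (pt_sub hq1) (pt_sub hq2)))
        (pt_congr hq1) (pt_congr hq2) (by simpa using hd)
      have g2 := hB Ω w φ x q.2 q.1 hw
        (Rich_sub hR (Finset.union_subset (pt_sub hq2) (pt_sub hq1)))
        (pt_congr hq2) (pt_congr hq1) (by simpa using pt_ne hq2 hq1 (Ne.symm hqq))
      have hse : sN l + (sN k - sN l) = sN k := Nat.add_sub_of_le (sN_mono hlk.le)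
      have bd : ∀ C ∈ T, ∀ C' ∈ T, M ^ sN k * (VV p (n + 1) (sN k) w φ x C ^ sN l *
          VV p (n + 1) (sN k) w φ x C' ^ (sN k - sN l)) ≤ (M * V) ^ sN k := by
        intro C hC C' hC'
        have v1 := VV_nonneg p (n + 1) (sN k) hw φ x C
        have v2 := VV_nonneg p (n + 1) (sN k) hw φ x C'
        rw [mul_pow]
        gcongr
        calc _ ≤ V ^ sN l * V ^ (sN k - sN l) := by
              gcongr
              · exact hVC C hC
              · exact hVC C' hC'
          _ = V ^ sN k := by rw [← pow_add, hse]
      have g1' := g1.trans (bd _ hq1 _ hq2)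
      have g2' := g2.trans (bd _ hq2 _ hq1)
      have hh := hold w hw 1 1 le_rfl le_rfl (fun α => (‖fs φ q.1 α‖ * ‖fs φ q.2 α‖) ^ sN k)
        (fun α => (‖fs φ q.1 α‖ ^ 2) ^ sN l * (‖fs φ q.2 α‖ ^ 2) ^ (sN k - sN l))
        (fun α => (‖fs φ q.2 α‖ ^ 2) ^ sN l * (‖fs φ q.1 α‖ ^ 2) ^ (sN k - sN l))
        (fun α => by positivity) (fun α => by positivity) (fun α => by positivity) (fun α => by
          conv_lhs => rw [← hse]
          ring)
      rw [pow_one, pow_one] at hh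
      have n0 : 0 ≤ ∑ α, w α * (‖fs φ q.1 α‖ * ‖fs φ q.2 α‖) ^ sN k :=
        Finset.sum_nonneg fun α _ => mul_nonneg (hw α) (by positivity)
      have n2 : 0 ≤ ∑ α, w α * ((‖fs φ q.2 α‖ ^ 2) ^ sN l * (‖fs φ q.1 α‖ ^ 2) ^ (sN k - sN l)) :=
        Finset.sum_nonneg fun α _ => mul_nonneg (hw α) (by positivity)
      have hfin : ∑ α, w α * (‖fs φ q.1 α‖ * ‖fs φ q.2 α‖) ^ sN k ≤ (M * V) ^ sN k := by
        refine le_of_pow_le_pow_left₀ (n := 1 + 1) (by omega) (by positivity) (hh.trans ?_)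
        rw [pow_add, pow_one]
        exact mul_le_mul g1' g2' n2 (by positivity)
      have := root_le hs n0 (show (0 : ℝ) ≤ 1 by norm_num) (show 0 ≤ M * V by positivity)
        (by simpa using hfin)
      simpa using this
  refine h1.trans ((Finset.sum_le_sum h2).trans ?_)
  rw [Finset.sum_add_distrib, Finset.sum_const, nsmul_eq_mul, Finset.card_product, add_mul,
    Finset.sum_product]
  have e1 : ∑ C ∈ T, ∑ C' ∈ T, (if C = C' then D * VV p (n + 1) (sN k) w φ x C else 0) = D * V := by
    rw [hV, ← VV_add (show 1 ≤ n + 1 by omega) (sN k) w φ x S, Finset.mul_sum]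
    refine Finset.sum_congr rfl fun C hC => ?_
    rw [Finset.sum_ite_eq, if_pos hC]
  simp only at e1 ⊢
  rw [e1]
  refine add_le_add le_rfl ?_
  push_cast
  have : (T.card : ℝ) * T.card ≤ (p : ℝ) ^ 2 := by rw [sq]; gcongr
  have hMV : 0 ≤ M * V := by positivity
  calc (T.card : ℝ) * T.card * (M * V) ≤ (p : ℝ) ^ 2 * (M * V) := by gcongr
    _ = _ := by ring

lemma Good_mono {p k : ℕ} (hp : p.Prime) {η η' : ℝ} (h : Good p k η) (hη : η ≤ η') : Good p k η' := by
  have hp1 : (1 : ℝ) < p := by exact_mod_cast hp.one_lt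
  have hpp : (0 : ℝ) < p := by linarith
  obtain ⟨C, hC⟩ := h
  refine ⟨max C 0, fun n => Dec_mono (hC n) ?_⟩
  have h0 : 0 ≤ max C 0 := le_max_right _ _
  calc C * (p : ℝ) ^ (η * n) ≤ max C 0 * (p : ℝ) ^ (η * n) := by
        gcongr; exact le_max_left _ _
    _ ≤ _ := by
      gcongr
      exact hp1.le

lemma Good_descend {p k : ℕ} (hp : p.Prime) (hk : 2 ≤ k) (hkp : k < p) {η0 : ℝ} (hη0 : 0 < η0)
    (IH : ∀ l, 1 ≤ l → l < k → ∀ ε : ℝ, 0 < ε → Good p l ε) :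
    ∃ c : ℝ, 0 < c ∧ ∀ η, η0 ≤ η → Good p k η → Good p k (max (η - c) η0) := by
  have hp0 := hp.pos
  have hp1 : (1 : ℝ) < p := by exact_mod_cast hp.one_lt
  have hpp : (0 : ℝ) < p := by linarith
  obtain ⟨c, hc, l, hl, hlk, H⟩ := Bil_gain hp hk hkp hη0 IH
  refine ⟨c, hc, fun η hη hg => ?_⟩
  obtain ⟨C, hC, HB⟩ := H η hη hg
  set η' := max (η - c) η0 with hη'
  have hη'0 : 0 < η' := lt_of_lt_of_le hη0 (le_max_right _ _)
  have hq : (p : ℝ) ^ (-η') < 1 := Real.rpow_lt_one_of_one_lt_of_neg hp1 (by linarith)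
  have hq' : 0 < 1 - (p : ℝ) ^ (-η') := by linarith
  refine ⟨1 + (p : ℝ) ^ 2 * C / (1 - (p : ℝ) ^ (-η')), fun n => ?_⟩
  set E := 1 + (p : ℝ) ^ 2 * C / (1 - (p : ℝ) ^ (-η')) with hE
  have hE1 : 1 ≤ E := by
    have : 0 ≤ (p : ℝ) ^ 2 * C / (1 - (p : ℝ) ^ (-η')) := by positivity
    linarith
  induction n with
  | zero =>
    refine Dec_mono (Dec_triv hp0 (by omega) 0) ?_
    simpa using hE1
  | succ n ih =>
    refine Dec_mono (Dec_rec hp (by omega) hlk (by positivity) ih (HB (n + 1))) ?_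
    have e1 : (p : ℝ) ^ ((η - c) * ((n + 1 : ℕ) : ℝ)) ≤ (p : ℝ) ^ (η' * ((n + 1 : ℕ) : ℝ)) := by
      gcongr
      · exact hp1.le
      · exact le_max_left _ _
    have e2 : (p : ℝ) ^ (η' * (n : ℝ)) = (p : ℝ) ^ (-η') * (p : ℝ) ^ (η' * ((n + 1 : ℕ) : ℝ)) := by
      rw [← Real.rpow_add hpp]; congr 1; push_cast; ring
    have e3 : (p : ℝ) ^ 2 * C ≤ E * (1 - (p : ℝ) ^ (-η')) := by
      rw [hE, add_mul, div_mul_cancel₀ _ hq'.ne']; linarith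
    rw [e2]
    set Y := (p : ℝ) ^ (η' * ((n + 1 : ℕ) : ℝ)) with hY
    have hY0 : 0 < Y := by positivity
    calc E * ((p : ℝ) ^ (-η') * Y) + (p : ℝ) ^ 2 * (C * (p : ℝ) ^ ((η - c) * ((n + 1 : ℕ) : ℝ)))
        ≤ E * ((p : ℝ) ^ (-η') * Y) + (p : ℝ) ^ 2 * (C * Y) := by gcongr
      _ = E * (p : ℝ) ^ (-η') * Y + ((p : ℝ) ^ 2 * C) * Y := by ring
      _ ≤ E * (p : ℝ) ^ (-η') * Y + (E * (1 - (p : ℝ) ^ (-η'))) * Y := by gcongr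
      _ = E * Y := by ring

theorem decoupling {p : ℕ} (hp : p.Prime) : ∀ k : ℕ, 1 ≤ k → k < p → ∀ ε : ℝ, 0 < ε →
    Good p k ε := by
  intro k
  induction k using Nat.strong_induction_on with
  | _ k ih =>
    intro hk hkp ε hε
    rcases Nat.lt_or_ge 1 k with h2 | h1
    · obtain ⟨c, hc, H⟩ := Good_descend hp h2 hkp hε (fun l hl hlk => ih l hlk hl (by omega))
      have key : ∀ j : ℕ, Good p k (max (1 - j * c) ε) := by
        intro j
        induction j with
        | zero =>
          refine Good_mono hp (η := 1) ⟨1, fun n => ?_⟩ (by simp)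
          refine Dec_mono (Dec_triv hp.pos hk n) ?_
          simp
        | succ j ihj =>
          refine Good_mono hp (H _ (le_max_right _ _) ihj) ?_
          refine max_le ?_ (le_max_right _ _)
          rcases le_total (1 - j * c) ε with h | h
          · rw [max_eq_right h]; exact le_trans (by linarith) (le_max_right _ _)
          · rw [max_eq_left h]; refine le_trans ?_ (le_max_left _ _); push_cast; linarith
      obtain ⟨j, hj⟩ := exists_nat_ge (1 / c)
      have := key j
      rwa [max_eq_right] at this
      rw [div_le_iff₀ hc] at hj
      linarith
    · have : k = 1 := by omega
      subst this
      refine ⟨1, fun n => Dec_mono (Dec_one hp.pos n) ?_⟩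
      have hp1 : (1 : ℝ) < p := by exact_mod_cast hp.one_lt
      rw [one_mul]
      exact Real.one_le_rpow hp1.le (by positivity)
end VMVT

namespace VMVT
open Finset

lemma abel_id (a ψ : ℕ → ℂ) (M : ℕ) :
    ∑ x ∈ range M, a x * ψ x = (∑ x ∈ range M, a x) * ψ M -
      ∑ x ∈ range M, (∑ t ∈ range (x + 1), a t) * (ψ (x + 1) - ψ x) := by
  induction M with
  | zero => simp
  | succ M ih => rw [sum_range_succ, ih, sum_range_succ (fun x => (∑ t ∈ range (x + 1), a t) * _),
      sum_range_succ a M]; ring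

lemma abel_le (a ψ : ℕ → ℂ) (M : ℕ) (K V : ℝ) (hK : ∀ m ≤ M, ‖∑ x ∈ range m, a x‖ ≤ K)
    (hψ : ‖ψ M‖ ≤ 1) (hV : ∑ x ∈ range M, ‖ψ (x + 1) - ψ x‖ ≤ V) :
    ‖∑ x ∈ range M, a x * ψ x‖ ≤ K * (1 + V) := by
  have hK0 : 0 ≤ K := le_trans (norm_nonneg _) (hK 0 (by omega))
  rw [abel_id]
  refine (norm_sub_le _ _).trans ?_
  rw [mul_add, mul_one]
  refine add_le_add ?_ ?_
  · rw [norm_mul]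
    calc _ ≤ K * 1 := mul_le_mul (hK M le_rfl) hψ (norm_nonneg _) hK0
      _ = K := mul_one _
  · refine (norm_sum_le _ _).trans (le_trans ?_ (mul_le_mul_of_nonneg_left hV hK0))
    rw [mul_sum]
    refine sum_le_sum fun x hx => ?_
    rw [norm_mul]
    exact mul_le_mul_of_nonneg_right (hK _ (by have := mem_range.1 hx; omega)) (norm_nonneg _)

lemma ee_sub_le (a b : ℝ) : ‖ee a - ee b‖ ≤ 2 * Real.pi * |a - b| := by
  have h : ee a - ee b = ee b * (Complex.exp (Complex.I * ((2 * Real.pi * (a - b) : ℝ) : ℂ)) - 1) := by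
    have : Complex.exp (Complex.I * ((2 * Real.pi * (a - b) : ℝ) : ℂ)) = ee (a - b) := by
      unfold ee; congr 1; push_cast; ring
    rw [this, mul_sub, ← ee_add, mul_one]; congr 2; ring
  rw [h, norm_mul, ee_norm, one_mul]
  refine (Real.norm_exp_I_mul_ofReal_sub_one_le).trans ?_
  rw [Real.norm_eq_abs, abs_mul, abs_of_pos (by positivity)]

lemma tele (S : ℕ → ℂ) (T : ℝ) (w t : ℕ) (h : ∀ v, w ≤ v → v < w + t → ‖S (v + 1) - S v‖ ≤ T) :
    ‖S (w + t) - S w‖ ≤ t * T := by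
  induction t with
  | zero => simp
  | succ t ih =>
    have h1 := ih (fun v h1 h2 => h v h1 (by omega))
    have h2 := h (w + t) (by omega) (by omega)
    calc ‖S (w + (t + 1)) - S w‖ = ‖(S (w + t + 1) - S (w + t)) + (S (w + t) - S w)‖ := by
          congr 1; ring_nf
      _ ≤ T + t * T := (norm_add_le _ _).trans (add_le_add h2 h1)
      _ = _ := by push_cast; ring

/-- prefix sums controlled by p-adic intervals -/
lemma padic_prefix {p n : ℕ} (hp : 1 < p) (S : ℕ → ℂ) (hS : S 0 = 0) (T : ℝ) (hT : 0 ≤ T)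
    (h : ∀ i ≤ n, ∀ u < p ^ (n - i), ‖S (p ^ i * (u + 1)) - S (p ^ i * u)‖ ≤ T) (M : ℕ) (hM : M ≤ p ^ n) :
    ‖S M‖ ≤ (n * p + 1) * T := by
  have key : ∀ i ≤ n, ‖S M - S (p ^ i * (M / p ^ i))‖ ≤ i * p * T := by
    intro i
    induction i with
    | zero => intro _; simp
    | succ i ih =>
      intro hi
      have ih := ih (by omega)
      set v := M / p ^ i with hv
      have e1 : M / p ^ (i + 1) = v / p := by rw [pow_succ, Nat.div_div_eq_div_mul]
      have e2 : p * (v / p) + v % p = v := Nat.div_add_mod v p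
      have hlt : v % p < p := Nat.mod_lt _ (by omega)
      have h1 := tele (fun z => S (p ^ i * z)) T (p * (v / p)) (v % p) (fun z hz1 hz2 => by
        refine h i (by omega) z ?_
        have h3 : z < v := by omega
        refine lt_of_lt_of_le h3 ?_
        rw [hv]
        calc M / p ^ i ≤ p ^ n / p ^ i := Nat.div_le_div_right hM
          _ = p ^ (n - i) := Nat.pow_div (by omega) (by omega))
      rw [e2] at h1
      have e3 : p ^ (i + 1) * (M / p ^ (i + 1)) = p ^ i * (p * (v / p)) := by rw [e1]; ring
      rw [e3]
      calc ‖S M - S (p ^ i * (p * (v / p)))‖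
          = ‖(S M - S (p ^ i * v)) + (S (p ^ i * v) - S (p ^ i * (p * (v / p))))‖ := by congr 1; ring
        _ ≤ i * p * T + ((v % p : ℕ) : ℝ) * T := (norm_add_le _ _).trans (add_le_add ih h1)
        _ ≤ i * p * T + p * T := by
            gcongr
        _ = _ := by push_cast; ring
  have h1 := key n le_rfl
  have h2 : ‖S (p ^ n * (M / p ^ n))‖ ≤ T := by
    have hpn : 0 < p ^ n := by positivity
    rcases lt_or_eq_of_le hM with hlt | heq
    · rw [Nat.div_eq_of_lt hlt, mul_zero, hS, norm_zero]; exact hT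
    · rw [heq, Nat.div_self hpn]
      have := h n le_rfl 0 (by simp)
      simpa [hS] using this
  calc ‖S M‖ = ‖(S M - S (p ^ n * (M / p ^ n))) + S (p ^ n * (M / p ^ n))‖ := by congr 1; ring
    _ ≤ n * p * T + T := (norm_add_le _ _).trans (add_le_add h1 h2)
    _ = _ := by ring

/-- near-integer predicate -/
def NI (x τ : ℝ) : Prop := ∃ z : ℤ, |x - z| ≤ τ

lemma NI.mono {x τ τ' : ℝ} (h : NI x τ) (h' : τ ≤ τ') : NI x τ' := h.imp fun _ hz => hz.trans h'

lemma NI.sub {x y τ τ' : ℝ} (h : NI x τ) (h' : NI y τ') : NI (x - y) (τ + τ') := by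
  obtain ⟨z, hz⟩ := h
  obtain ⟨z', hz'⟩ := h'
  refine ⟨z - z', ?_⟩
  push_cast
  calc |x - y - (z - z')| = |(x - z) - (y - z')| := by congr 1; ring
    _ ≤ _ := (abs_sub _ _).trans (add_le_add hz hz')

lemma NI.mul {x τ : ℝ} (h : NI x τ) (m : ℤ) : NI (m * x) (|(m : ℝ)| * τ) := by
  obtain ⟨z, hz⟩ := h
  refine ⟨m * z, ?_⟩
  push_cast
  rw [← mul_sub, abs_mul]
  gcongr

lemma NI.sum {ι : Type} (s : Finset ι) (f : ι → ℝ) (τ : ι → ℝ) (h : ∀ i ∈ s, NI (f i) (τ i)) :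
    NI (∑ i ∈ s, f i) (∑ i ∈ s, τ i) := by
  choose! z hz using h
  refine ⟨∑ i ∈ s, z i, ?_⟩
  push_cast
  rw [← sum_sub_distrib]
  exact (abs_sum_le_sum_abs _ _).trans (sum_le_sum hz)

end VMVT

namespace VMVT
open Finset Polynomial

/-- exponential polynomial term on the finite grid -/
noncomputable def phi {d Q : ℕ} (c : ℕ → ℂ) (x : ℕ) (ω : Fin d → ZMod Q) : ℂ :=
  c x * ee ((∑ h : Fin d, ((ω h).val : ℝ) * (x : ℝ) ^ ((h : ℕ) + 1)) / Q)

lemma ee_congr' {Q : ℕ} (hQ : 0 < Q) {a b : ℤ} (h : (Q : ℤ) ∣ a - b) :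
    ee ((a : ℝ) / Q) = ee ((b : ℝ) / Q) := by
  simpa using ee_congr Q 1 hQ (a := a) (b := b) (by simpa using h)

lemma phi_rich {p d n : ℕ} [Fact p.Prime] (c : ℕ → ℂ) (S : Finset ℕ) :
    Rich p d (d * n) (fun _ : Fin d → ZMod (p ^ (d * n)) => (1 : ℝ)) (phi c) (fun x => (x : ℤ)) S := by
  intro P hP
  have hp : 0 < p := (Fact.out : p.Prime).pos
  have hQ : 0 < p ^ (d * n) := by positivity
  set Q := p ^ (d * n) with hQdef
  have : NeZero Q := ⟨hQ.ne'⟩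
  set v : Fin d → ZMod Q := fun h => ((P.coeff ((h : ℕ) + 1) : ℤ) : ZMod Q) with hv
  refine ⟨Equiv.addRight v, fun _ => rfl, fun _ => ee (((-P.coeff 0 : ℤ) : ℝ) / Q), fun _ => ee_norm _, ?_⟩
  intro x _ ω
  simp only [phi, Equiv.coe_addRight]
  have hev : P.eval (x : ℤ) = P.coeff 0 + ∑ h : Fin d, P.coeff ((h : ℕ) + 1) * (x : ℤ) ^ ((h : ℕ) + 1) := by
    rw [Polynomial.eval_eq_sum_range' (n := d + 1) (by omega), Finset.sum_range_succ',
      Fin.sum_univ_eq_sum_range (fun h => P.coeff (h + 1) * (x : ℤ) ^ (h + 1)) d]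
    simp [add_comm]
  have hcast : ((p : ℝ) ^ (d * n)) = (Q : ℝ) := by rw [hQdef]; push_cast; rfl
  rw [hcast, show ∀ a b c e : ℂ, a * b * (c * e) = c * (a * b * e) by intros; ring, ← ee_add, ← ee_add]
  congr 1
  have e1 : ((∑ h : Fin d, (((ω + v) h).val : ℝ) * (x : ℝ) ^ ((h : ℕ) + 1)) / Q) =
      ((∑ h : Fin d, (((ω + v) h).val : ℤ) * (x : ℤ) ^ ((h : ℕ) + 1) : ℤ) : ℝ) / Q := by
    push_cast; rfl
  have e2 : ((-P.coeff 0 : ℤ) : ℝ) / Q + ((P.eval (x : ℤ) : ℤ) : ℝ) / Q + (∑ h : Fin d, ((ω h).val : ℝ) * (x : ℝ) ^ ((h : ℕ) + 1)) / Q =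
      ((-P.coeff 0 + P.eval (x : ℤ) + ∑ h : Fin d, ((ω h).val : ℤ) * (x : ℤ) ^ ((h : ℕ) + 1) : ℤ) : ℝ) / Q := by
    push_cast; ring
  rw [e1, e2]
  apply ee_congr' hQ
  rw [← ZMod.intCast_zmod_eq_zero_iff_dvd, hev]
  push_cast
  simp only [ZMod.natCast_val, Pi.add_apply, ZMod.cast_id', id_eq, hv]
  simp only [add_mul, sum_add_distrib]
  ring

lemma MV {p d : ℕ} [Fact p.Prime] (hd : 1 ≤ d) (hdp : d < p) (η : ℝ) (hη : 0 < η) :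
    ∃ C : ℝ, 1 ≤ C ∧ ∀ (n : ℕ) (c : ℕ → ℂ), (∀ x, ‖c x‖ ≤ 1) → ∀ S ⊆ range (p ^ n),
      ∑ ω : Fin d → ZMod (p ^ (d * n)), (‖∑ x ∈ S, phi c x ω‖ ^ 2) ^ sN d ≤
        C * (p : ℝ) ^ (η * n) * (S.card : ℝ) ^ sN d * (((p : ℝ) ^ (d * n)) ^ d) := by
  have hp : p.Prime := Fact.out
  have hp0 : (0 : ℝ) < p := by exact_mod_cast hp.pos
  have hs := sN_pos hd
  have hsR : (0 : ℝ) < sN d := by exact_mod_cast hs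
  obtain ⟨C0, hC0⟩ := decoupling hp d hd hdp (η / sN d) (by positivity)
  refine ⟨(max C0 1) ^ sN d, one_le_pow₀ (le_max_right _ _), fun n c hc S hS => ?_⟩
  have hcard : (Fintype.card (Fin d → ZMod (p ^ (d * n))) : ℝ) = ((p : ℝ) ^ (d * n)) ^ d := by
    rw [Fintype.card_fun, ZMod.card, Fintype.card_fin]; push_cast; rfl
  set W := ((p : ℝ) ^ (d * n)) ^ d with hW
  have hW0 : 0 < W := by positivity
  have hD := hC0 n (Fin d → ZMod (p ^ (d * n))) (fun _ => 1) (phi c) (fun x => (x : ℤ)) S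
    (fun _ => zero_le_one) (phi_rich c S)
  have hsing : ∀ i ∈ S, cl p n (fun x => (x : ℤ)) S i = {i} := by
    intro i hi
    ext j
    rw [mem_cl, mem_singleton]
    constructor
    · rintro ⟨hj, hdvd⟩
      have hi' := mem_range.1 (hS hi)
      have hj' := mem_range.1 (hS hj)
      have h1 : ((j : ℤ) - i) = 0 := by
        refine Int.eq_zero_of_abs_lt_dvd hdvd ?_
        rw [abs_lt]
        have : ((p ^ n : ℕ) : ℤ) = (p : ℤ) ^ n := by push_cast; rfl
        rw [← this]
        constructor <;> omega
      omega
    · rintro rfl; exact ⟨hi, by simp⟩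
  have hVV : VV p n (sN d) (fun _ : Fin d → ZMod (p ^ (d * n)) => 1) (phi c) (fun x => (x : ℤ)) S ≤
      S.card * W ^ ((1 : ℝ) / sN d) := by
    unfold VV pt
    have hcard2 : ((image (cl p n (fun x => (x : ℤ)) S) S).card : ℝ) ≤ S.card := by
      exact_mod_cast card_image_le
    refine le_trans ?_ (mul_le_mul_of_nonneg_right hcard2 (by positivity))
    rw [← nsmul_eq_mul]
    refine sum_le_card_nsmul _ _ _ fun K hK => ?_
    obtain ⟨i, hi, rfl⟩ := mem_image.1 hK
    rw [hsing i hi]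
    unfold Nrm
    refine Real.rpow_le_rpow (Finset.sum_nonneg fun α _ => by positivity) ?_ (by positivity)
    rw [← hcard, ← nsmul_one, ← Finset.card_univ]
    refine Finset.sum_le_card_nsmul _ _ _ fun ω _ => ?_
    rw [one_mul]
    simp only [fs, sum_singleton, phi]
    rw [norm_mul, ee_norm, mul_one]
    refine pow_le_one₀ (by positivity) (pow_le_one₀ (by positivity) (hc i))
  have hfin : Nrm (sN d) (fun _ : Fin d → ZMod (p ^ (d * n)) => (1 : ℝ)) (fs (phi c) S) ≤
      (max C0 1) * (p : ℝ) ^ (η / sN d * n) * (S.card * W ^ ((1 : ℝ) / sN d)) := by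
    refine hD.trans ?_
    have hV0 := VV_nonneg p n (sN d) (w := fun _ : Fin d → ZMod (p ^ (d * n)) => (1 : ℝ)) (fun _ => zero_le_one) (phi c) (fun x => (x : ℤ)) S
    have : 0 ≤ max C0 1 := le_trans zero_le_one (le_max_right _ _)
    refine mul_le_mul ?_ hVV hV0 (by positivity)
    gcongr
    exact le_max_left _ _
  have hN := Nrm_pow hs (w := fun _ : Fin d → ZMod (p ^ (d * n)) => (1 : ℝ)) (fun _ => zero_le_one) (fs (phi c) S)
  simp only [one_mul, fs] at hN
  rw [← hN]
  refine (pow_le_pow_left₀ (Nrm_nonneg _ (fun _ => zero_le_one) _) hfin _).trans (le_of_eq ?_)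
  rw [mul_pow, mul_pow, mul_pow]
  have t1 : (W ^ ((1 : ℝ) / sN d)) ^ sN d = W := by
    rw [← Real.rpow_natCast, ← Real.rpow_mul hW0.le, one_div, inv_mul_cancel₀ hsR.ne', Real.rpow_one]
  have t2 : ((p : ℝ) ^ (η / sN d * n)) ^ sN d = (p : ℝ) ^ (η * n) := by
    rw [← Real.rpow_natCast, ← Real.rpow_mul hp0.le]
    congr 1; field_simp
  rw [t1, t2]; ring
end VMVT

namespace VMVT
open Finset

lemma loc_const {p d n Q : ℕ} (hp : 0 < p) (c : ℕ → ℂ) (γ : Fin d → ℝ) (ω : Fin d → ZMod Q)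
    (hω : ∀ h : Fin d, NI (((ω h).val : ℝ) / Q - γ h) (1 / ((p : ℝ) ^ n) ^ ((h : ℕ) + 1)))
    (M : ℕ) (hM : M ≤ p ^ n) (K : ℝ) (hK : ∀ m ≤ M, ‖∑ x ∈ range m, phi c x ω‖ ≤ K) :
    ‖∑ x ∈ range M, c x * ee (∑ h : Fin d, γ h * (x : ℝ) ^ ((h : ℕ) + 1))‖ ≤ K * (1 + 2 * Real.pi * d) := by
  choose z hz using hω
  set δ : Fin d → ℝ := fun h => ((ω h).val : ℝ) / Q - γ h - z h with hδ
  set ψ : ℕ → ℂ := fun x => ee (-∑ h : Fin d, δ h * (x : ℝ) ^ ((h : ℕ) + 1)) with hψ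
  have e : ∀ x : ℕ, c x * ee (∑ h : Fin d, γ h * (x : ℝ) ^ ((h : ℕ) + 1)) = phi c x ω * ψ x := by
    intro x
    simp only [phi, hψ]
    rw [mul_assoc, ← ee_add]
    congr 1
    have : (∑ h : Fin d, ((ω h).val : ℝ) * (x : ℝ) ^ ((h : ℕ) + 1)) / Q + -∑ h : Fin d, δ h * (x : ℝ) ^ ((h : ℕ) + 1)
      = (∑ h : Fin d, γ h * (x : ℝ) ^ ((h : ℕ) + 1)) + ((∑ h : Fin d, z h * (x : ℤ) ^ ((h : ℕ) + 1) : ℤ) : ℝ) := by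
      push_cast
      rw [sum_div, ← sub_eq_add_neg, ← sum_sub_distrib, ← sum_add_distrib]
      refine sum_congr rfl fun h _ => ?_
      simp only [hδ]; ring
    rw [this, ee_add_int]
  simp_rw [e]
  refine abel_le _ _ M K _ hK (by simp [hψ]) ?_
  have hpi := Real.pi_pos
  calc ∑ x ∈ range M, ‖ψ (x + 1) - ψ x‖
      ≤ ∑ x ∈ range M, 2 * Real.pi * ∑ h : Fin d, |δ h| * (((x + 1 : ℕ) : ℝ) ^ ((h : ℕ) + 1) - (x : ℝ) ^ ((h : ℕ) + 1)) := by
        refine sum_le_sum fun x _ => (ee_sub_le _ _).trans ?_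
        gcongr
        rw [neg_sub_neg, ← sum_sub_distrib]
        refine (abs_sum_le_sum_abs _ _).trans (sum_le_sum fun h _ => ?_)
        rw [← mul_sub, abs_mul, abs_sub_comm ((x : ℝ) ^ _)]
        refine mul_le_mul_of_nonneg_left (le_of_eq (abs_of_nonneg ?_)) (abs_nonneg _)
        rw [sub_nonneg]
        gcongr
        omega
    _ = 2 * Real.pi * ∑ h : Fin d, |δ h| * (M : ℝ) ^ ((h : ℕ) + 1) := by
        rw [← mul_sum, sum_comm]
        congr 1
        refine sum_congr rfl fun h _ => ?_
        rw [← mul_sum, Finset.sum_range_sub (fun x : ℕ => (x : ℝ) ^ ((h : ℕ) + 1))]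
        simp
    _ ≤ 2 * Real.pi * ∑ h : Fin d, (1 : ℝ) := by
        gcongr with h _
        have h1 := hz h
        have hpn : (0 : ℝ) < (p : ℝ) ^ n := by positivity
        have h2 : (M : ℝ) ≤ (p : ℝ) ^ n := by exact_mod_cast hM
        calc |δ h| * (M : ℝ) ^ ((h : ℕ) + 1) ≤ 1 / ((p : ℝ) ^ n) ^ ((h : ℕ) + 1) * ((p : ℝ) ^ n) ^ ((h : ℕ) + 1) := by
              gcongr
          _ = 1 := by field_simp
    _ = 2 * Real.pi * d := by simp

open Classical in
lemma box_coord {B R Q : ℕ} (hB : 0 < B) (hR : 0 < R) (hQ : Q = B * R) [NeZero Q] (γ : ℝ) :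
    B ≤ (univ.filter (fun t : ZMod Q => NI ((t.val : ℝ) / Q - γ) (1 / R))).card := by
  set g : ℕ → ZMod Q := fun t => ((⌊γ * Q⌋ + 1 + t : ℤ) : ZMod Q) with hg
  have hQ0 : 0 < Q := NeZero.pos Q
  have hinj : Set.InjOn g (range B : Set ℕ) := by
    intro s hs t ht h
    simp only [coe_range, Set.mem_Iio] at hs ht
    simp only [hg] at h
    have h2 := (ZMod.intCast_eq_intCast_iff_dvd_sub _ _ _).1 h
    have hBQ : B ≤ Q := by rw [hQ]; exact Nat.le_mul_of_pos_right _ hR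
    have : (⌊γ * Q⌋ + 1 + (t : ℤ) - (⌊γ * Q⌋ + 1 + (s : ℤ))) = 0 := by
      refine Int.eq_zero_of_abs_lt_dvd h2 ?_
      rw [abs_lt]; constructor <;> omega
    omega
  rw [← card_range B, ← card_image_of_injOn hinj]
  refine card_le_card ?_
  intro t ht
  obtain ⟨s, hs, rfl⟩ := mem_image.1 ht
  rw [mem_filter]
  refine ⟨mem_univ _, ?_⟩
  set a : ℤ := ⌊γ * Q⌋ + 1 + s with ha
  have hv : ((g s).val : ℤ) = a % Q := by simp only [hg]; rw [ZMod.val_intCast]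
  refine ⟨-(a / Q), ?_⟩
  have h3 : ((g s).val : ℝ) = a - Q * ((a / Q : ℤ) : ℝ) := by
    have : ((g s).val : ℤ) = a - Q * (a / Q) := by rw [hv, Int.emod_def]
    exact_mod_cast this
  have hQR : (0 : ℝ) < Q := by exact_mod_cast hQ0
  have e1 : ((g s).val : ℝ) / Q - γ - ((-(a / Q) : ℤ) : ℝ) = (a - γ * Q) / Q := by
    rw [h3]; push_cast; field_simp; ring
  rw [e1, abs_div, abs_of_pos hQR, div_le_div_iff₀ hQR (by exact_mod_cast hR), one_mul]
  have hQ' : (Q : ℝ) = B * R := by rw [hQ]; push_cast; rfl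
  rw [hQ']
  gcongr
  rw [← hQ', abs_le]
  have f1 := Int.floor_le (γ * Q)
  have f2 := Int.lt_floor_add_one (γ * Q)
  have f3 : (s : ℝ) + 1 ≤ B := by exact_mod_cast mem_range.1 hs
  have f4 : (0 : ℝ) ≤ s := by positivity
  rw [ha]; push_cast
  constructor <;> linarith

lemma sum_sN (d : ℕ) : ∑ h : Fin d, ((h : ℕ) + 1) = sN d := by
  rw [Fin.sum_univ_eq_sum_range (fun h => h + 1) d]
  induction d with
  | zero => rfl
  | succ d ih => rw [sum_range_succ, ih, sN_succ]

open Classical in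
/-- box around a point -/
noncomputable def box (p d n : ℕ) [Fact p.Prime] (γ : Fin d → ℝ) : Finset (Fin d → ZMod (p ^ (d * n))) :=
  Fintype.piFinset fun h => univ.filter (fun t : ZMod (p ^ (d * n)) =>
    NI ((t.val : ℝ) / (p ^ (d * n) : ℕ) - γ h) (1 / ((p ^ n) ^ ((h : ℕ) + 1) : ℕ)))

lemma card_box {p d n : ℕ} [Fact p.Prime] (γ : Fin d → ℝ) :
    (p ^ (d * n)) ^ d ≤ (box p d n γ).card * (p ^ n) ^ sN d := by
  classical
  have hp : 0 < p := (Fact.out : p.Prime).pos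
  rw [box, Fintype.card_piFinset, ← sum_sN, ← prod_pow_eq_pow_sum, ← prod_mul_distrib]
  have : (p ^ (d * n)) ^ d = ∏ h : Fin d, p ^ (d * n) := by simp
  rw [this]
  refine prod_le_prod' fun h _ => ?_
  have hh := h.2
  have key : p ^ (d * n) = (p ^ n) ^ (d - (h + 1)) * (p ^ n) ^ ((h : ℕ) + 1) := by
    rw [← pow_add, Nat.sub_add_cancel hh, ← pow_mul, mul_comm]
  have hb := box_coord (B := (p ^ n) ^ (d - (h + 1))) (R := (p ^ n) ^ ((h : ℕ) + 1)) (Q := p ^ (d * n))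
    (by positivity) (by positivity) key (γ h)
  refine (le_of_eq key).trans (Nat.mul_le_mul_right _ ?_)
  convert hb using 3
end VMVT

namespace VMVT
open Finset

/-- sum of p-adic interval contributions -/
noncomputable def GG {d Q : ℕ} (p n : ℕ) (c : ℕ → ℂ) (ω : Fin d → ZMod Q) : ℝ :=
  ∑ i ∈ range (n + 1), ∑ u ∈ range (p ^ (n - i)),
    (‖∑ x ∈ Ico (p ^ i * u) (p ^ i * (u + 1)), phi c x ω‖ ^ 2) ^ sN d

lemma GG_nonneg {d Q : ℕ} (p n : ℕ) (c : ℕ → ℂ) (ω : Fin d → ZMod Q) : 0 ≤ GG p n c ω :=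
  sum_nonneg fun _ _ => sum_nonneg fun _ _ => by positivity

lemma GG_prefix {p d n Q : ℕ} (hp : 1 < p) (hd : 1 ≤ d) (c : ℕ → ℂ) (ω : Fin d → ZMod Q) (M : ℕ) (hM : M ≤ p ^ n) :
    ‖∑ x ∈ range M, phi c x ω‖ ≤ (n * p + 1) * (GG p n c ω) ^ ((1 : ℝ) / (2 * sN d)) := by
  have hs := sN_pos hd
  have hG := GG_nonneg p n c ω
  refine padic_prefix hp (fun M => ∑ x ∈ range M, phi c x ω) (by simp) _ (by positivity) ?_ M hM
  intro i hi u hu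
  rw [← sum_Ico_eq_sub _ (Nat.mul_le_mul_left _ (Nat.le_succ u))]
  refine le_of_pow_le_pow_left₀ (n := 2 * sN d) (by omega) (by positivity) ?_
  have e1 : (GG p n c ω ^ ((1 : ℝ) / (2 * sN d))) ^ (2 * sN d) = GG p n c ω := by
    rw [← Real.rpow_natCast, ← Real.rpow_mul hG]
    push_cast
    have : (0 : ℝ) < sN d := by exact_mod_cast hs
    rw [one_div, inv_mul_cancel₀ (by positivity), Real.rpow_one]
  rw [e1, pow_mul, GG]
  refine le_trans ?_ (single_le_sum (f := fun i => ∑ u ∈ range (p ^ (n - i)),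
    (‖∑ x ∈ Ico (p ^ i * u) (p ^ i * (u + 1)), phi c x ω‖ ^ 2) ^ sN d)
    (fun i _ => sum_nonneg fun _ _ => by positivity) (mem_range.2 (Nat.lt_succ_of_le hi)))
  exact single_le_sum (f := fun u => (‖∑ x ∈ Ico (p ^ i * u) (p ^ i * (u + 1)), phi c x ω‖ ^ 2) ^ sN d)
    (fun u _ => by positivity) (mem_range.2 hu)

lemma GG_sum {p d : ℕ} [Fact p.Prime] (hd : 1 ≤ d) (hdp : d < p) (η : ℝ) (hη : 0 < η) :
    ∃ C : ℝ, 1 ≤ C ∧ ∀ (n : ℕ) (c : ℕ → ℂ), (∀ x, ‖c x‖ ≤ 1) →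
      ∑ ω : Fin d → ZMod (p ^ (d * n)), GG p n c ω ≤
        C * (n + 1) * (p : ℝ) ^ (η * n) * ((p : ℝ) ^ n) ^ sN d * (((p : ℝ) ^ (d * n)) ^ d) := by
  obtain ⟨C, hC, H⟩ := MV (p := p) hd hdp η hη
  have hp : p.Prime := Fact.out
  have hp0 : (0 : ℝ) < p := by exact_mod_cast hp.pos
  refine ⟨C, hC, fun n c hc => ?_⟩
  unfold GG
  rw [sum_comm]
  set W := (((p : ℝ) ^ (d * n)) ^ d) with hW
  have hW0 : 0 < W := by positivity
  calc ∑ i ∈ range (n + 1), ∑ ω : Fin d → ZMod (p ^ (d * n)), ∑ u ∈ range (p ^ (n - i)),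
        (‖∑ x ∈ Ico (p ^ i * u) (p ^ i * (u + 1)), phi c x ω‖ ^ 2) ^ sN d
      ≤ ∑ i ∈ range (n + 1), C * (p : ℝ) ^ (η * n) * ((p : ℝ) ^ n) ^ sN d * W := by
        refine sum_le_sum fun i hi => ?_
        have hi' : i ≤ n := by have := mem_range.1 hi; omega
        rw [sum_comm]
        calc ∑ u ∈ range (p ^ (n - i)), ∑ ω : Fin d → ZMod (p ^ (d * n)),
              (‖∑ x ∈ Ico (p ^ i * u) (p ^ i * (u + 1)), phi c x ω‖ ^ 2) ^ sN d
            ≤ ∑ u ∈ range (p ^ (n - i)), C * (p : ℝ) ^ (η * n) * ((p : ℝ) ^ i) ^ sN d * W := by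
              refine sum_le_sum fun u hu => ?_
              have := H n c hc (Ico (p ^ i * u) (p ^ i * (u + 1))) (by
                intro x hx
                rw [mem_Ico] at hx
                rw [mem_range]
                refine lt_of_lt_of_le hx.2 ?_
                calc p ^ i * (u + 1) ≤ p ^ i * p ^ (n - i) := Nat.mul_le_mul_left _ (mem_range.1 hu)
                  _ = p ^ n := by rw [← pow_add]; congr 1; omega)
              refine this.trans (le_of_eq ?_)
              rw [Nat.card_Ico, show p ^ i * (u + 1) - p ^ i * u = p ^ i by
                rw [mul_add, mul_one, Nat.add_sub_cancel_left]]
              push_cast; rfl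
          _ = (p : ℝ) ^ (n - i) * (C * (p : ℝ) ^ (η * n) * ((p : ℝ) ^ i) ^ sN d * W) := by
              rw [sum_const, card_range, nsmul_eq_mul]; push_cast; rfl
          _ = C * (p : ℝ) ^ (η * n) * ((p : ℝ) ^ (n - i) * ((p : ℝ) ^ i) ^ sN d) * W := by ring
          _ ≤ C * (p : ℝ) ^ (η * n) * (((p : ℝ) ^ (n - i)) ^ sN d * ((p : ℝ) ^ i) ^ sN d) * W := by
              have hs := sN_pos hd
              have : (1 : ℝ) ≤ (p : ℝ) ^ (n - i) := one_le_pow₀ (by exact_mod_cast hp.one_le)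
              gcongr
              exact le_self_pow₀ this (by omega)
          _ = _ := by rw [← mul_pow, ← pow_add, Nat.sub_add_cancel hi']
    _ = _ := by rw [sum_const, card_range, nsmul_eq_mul]; push_cast; ring

open Classical in
lemma core {p d : ℕ} [Fact p.Prime] (hd : 1 ≤ d) (hdp : d < p) (η : ℝ) (hη : 0 < η) :
    ∃ C : ℝ, 1 ≤ C ∧ ∀ (n : ℕ) (c : ℕ → ℂ), (∀ x, ‖c x‖ ≤ 1) → ∀ (Y : Finset ℕ) (γ : ℕ → Fin d → ℝ) (F μ : ℝ),
      0 ≤ F → 0 ≤ μ →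
      (∀ y ∈ Y, ∃ M1 ≤ p ^ n, ∃ M2 ≤ p ^ n,
        F ≤ ‖∑ x ∈ range M1, c x * ee (∑ h : Fin d, γ y h * (x : ℝ) ^ ((h : ℕ) + 1))‖ +
          ‖∑ x ∈ range M2, c x * ee (∑ h : Fin d, γ y h * (x : ℝ) ^ ((h : ℕ) + 1))‖) →
      (∀ y0 ∈ Y, ((Y.filter fun y => ∀ h : Fin d, NI (γ y h - γ y0 h) (2 / ((p : ℝ) ^ n) ^ ((h : ℕ) + 1))).card : ℝ) ≤ μ) →
      (F ^ 2) ^ sN d * Y.card ≤ C * (n + 1) ^ (2 * sN d + 1) * (p : ℝ) ^ (η * n) * ((p : ℝ) ^ n) ^ (2 * sN d) * μ := by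
  obtain ⟨C, hC, H⟩ := GG_sum (p := p) hd hdp η hη
  have hp : p.Prime := Fact.out
  have hp0 : (0 : ℝ) < p := by exact_mod_cast hp.pos
  have hs := sN_pos hd
  set E : ℝ := 2 * (1 + 2 * Real.pi * d) * p with hE
  have hpi := Real.pi_pos
  have hd0 : (0 : ℝ) ≤ d := by positivity
  have hp1 : (1 : ℝ) ≤ p := by exact_mod_cast hp.one_le
  have hE1 : 1 ≤ E := by
    rw [hE]
    have : (1 : ℝ) ≤ 2 * (1 + 2 * Real.pi * d) := by
      have : 0 ≤ 2 * Real.pi * d := by positivity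
      linarith
    exact one_le_mul_of_one_le_of_one_le this hp1
  refine ⟨E ^ (2 * sN d) * C, one_le_mul_of_one_le_of_one_le (one_le_pow₀ hE1) hC, ?_⟩
  intro n c hc Y γ F μ hF hμ hpt hmult
  set W := (((p : ℝ) ^ (d * n)) ^ d) with hW
  have hW0 : 0 < W := by positivity
  set R := ((p : ℝ) ^ n) ^ sN d with hR
  have hR0 : 0 < R := by positivity
  -- pointwise
  have h1 : ∀ y ∈ Y, ∀ ω ∈ box p d n (γ y), (F ^ 2) ^ sN d ≤ (E * (n + 1)) ^ (2 * sN d) * GG p n c ω := by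
    intro y hy ω hω
    obtain ⟨M1, hM1, M2, hM2, hle⟩ := hpt y hy
    have hG := GG_nonneg p n c ω
    set T := (GG p n c ω) ^ ((1 : ℝ) / (2 * sN d)) with hT
    have hT0 : 0 ≤ T := by positivity
    have hω' : ∀ h : Fin d, NI (((ω h).val : ℝ) / (p ^ (d * n) : ℕ) - γ y h) (1 / ((p : ℝ) ^ n) ^ ((h : ℕ) + 1)) := by
      intro h
      have := (mem_filter.1 (Fintype.mem_piFinset.1 hω h)).2
      push_cast at this ⊢
      exact this
    have b : ∀ M ≤ p ^ n, ‖∑ x ∈ range M, c x * ee (∑ h : Fin d, γ y h * (x : ℝ) ^ ((h : ℕ) + 1))‖ ≤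
        ((n * p + 1) * T) * (1 + 2 * Real.pi * d) := fun M hM =>
      loc_const hp.pos c (γ y) ω hω' M hM _ (fun m hm => GG_prefix hp.one_lt hd c ω m (hm.trans hM))
    have hFT : F ≤ E * (n + 1) * T := by
      refine hle.trans ((add_le_add (b M1 hM1) (b M2 hM2)).trans ?_)
      rw [hE]
      have : (n : ℝ) * p + 1 ≤ p * (n + 1) := by nlinarith
      calc ((n : ℝ) * p + 1) * T * (1 + 2 * Real.pi * d) + (n * p + 1) * T * (1 + 2 * Real.pi * d)
          = 2 * (1 + 2 * Real.pi * d) * T * (n * p + 1) := by ring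
        _ ≤ 2 * (1 + 2 * Real.pi * d) * T * (p * (n + 1)) := by gcongr
        _ = _ := by ring
    rw [← pow_mul]
    refine (pow_le_pow_left₀ hF hFT _).trans (le_of_eq ?_)
    rw [mul_pow]
    congr 1
    rw [hT, ← Real.rpow_natCast, ← Real.rpow_mul hG]
    push_cast
    have : (0 : ℝ) < sN d := by exact_mod_cast hs
    rw [one_div, inv_mul_cancel₀ (by positivity), Real.rpow_one]
  -- double count
  have h2 : (F ^ 2) ^ sN d * Y.card * W ≤ R * ∑ y ∈ Y, ∑ ω ∈ box p d n (γ y), (E * (n + 1)) ^ (2 * sN d) * GG p n c ω := by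
    rw [mul_comm ((F ^ 2) ^ sN d), mul_assoc, ← nsmul_eq_mul, ← sum_const, mul_sum]
    refine sum_le_sum fun y hy => ?_
    have hb : W ≤ (box p d n (γ y)).card * R := by
      rw [hW, hR]; exact_mod_cast card_box (γ y)
    calc (F ^ 2) ^ sN d * W ≤ (F ^ 2) ^ sN d * ((box p d n (γ y)).card * R) := by gcongr
      _ = R * ∑ ω ∈ box p d n (γ y), (F ^ 2) ^ sN d := by rw [sum_const, nsmul_eq_mul]; ring
      _ ≤ _ := by
        gcongr with ω hω
        exact h1 y hy ω hω
  have h3 : ∑ y ∈ Y, ∑ ω ∈ box p d n (γ y), (E * (n + 1)) ^ (2 * sN d) * GG p n c ω ≤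
      ∑ ω : Fin d → ZMod (p ^ (d * n)), μ * ((E * (n + 1)) ^ (2 * sN d) * GG p n c ω) := by
    calc _ = ∑ y ∈ Y, ∑ ω : Fin d → ZMod (p ^ (d * n)), if ω ∈ box p d n (γ y) then (E * (n + 1)) ^ (2 * sN d) * GG p n c ω else 0 := by
          refine sum_congr rfl fun y _ => ?_
          rw [← sum_filter]; congr 1; ext ω; simp
      _ = ∑ ω : Fin d → ZMod (p ^ (d * n)), ∑ y ∈ Y, if ω ∈ box p d n (γ y) then (E * (n + 1)) ^ (2 * sN d) * GG p n c ω else 0 := sum_comm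
      _ ≤ _ := by
        refine sum_le_sum fun ω _ => ?_
        rw [← sum_filter, sum_const, nsmul_eq_mul]
        have hG := GG_nonneg p n c ω
        refine mul_le_mul_of_nonneg_right ?_ (by positivity)
        rcases (Y.filter fun y => ω ∈ box p d n (γ y)).eq_empty_or_nonempty with h0 | ⟨y0, hy0⟩
        · rw [h0]; simpa using hμ
        · rw [mem_filter] at hy0
          refine le_trans ?_ (hmult y0 hy0.1)
          norm_cast
          refine card_le_card fun y hy => ?_
          rw [mem_filter] at hy ⊢
          refine ⟨hy.1, fun h => ?_⟩
          have a1 := (mem_filter.1 (Fintype.mem_piFinset.1 hy.2 h)).2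
          have a2 := (mem_filter.1 (Fintype.mem_piFinset.1 hy0.2 h)).2
          have := a2.sub a1
          convert this using 1
          · ring
          · push_cast; ring
  have h4 := H n c hc
  refine le_of_mul_le_mul_right (a := W) ?_ hW0
  refine h2.trans ((mul_le_mul_of_nonneg_left h3 hR0.le).trans ?_)
  rw [← mul_sum, ← mul_sum]
  calc R * (μ * ((E * (n + 1)) ^ (2 * sN d) * ∑ ω : Fin d → ZMod (p ^ (d * n)), GG p n c ω)) ≤
      R * (μ * ((E * (n + 1)) ^ (2 * sN d) * (C * (n + 1) * (p : ℝ) ^ (η * n) * R * W))) := by gcongr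
    _ = _ := by
      rw [mul_pow, pow_add ((n : ℝ) + 1), hR, two_mul, pow_add ((p : ℝ) ^ n)]
      ring
end VMVT

namespace VMVT
open Finset

lemma sep {α : ℝ} {a : ℤ} {q : ℕ} (hq : 0 < q) (hg : Int.gcd a q = 1) (hα : |α - (a : ℝ) / q| ≤ ((q : ℝ) ^ 2)⁻¹)
    (m : ℤ) (hm : m ≠ 0) (hmq : 2 * |m| ≤ q) (z : ℤ) : 1 / (2 * q) ≤ |m * α - z| := by
  have hq' : (0 : ℝ) < q := by exact_mod_cast hq
  have h1 : (1 : ℝ) ≤ |(m : ℝ) * a - z * q| := by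
    have : m * a - z * q ≠ 0 := by
      intro h
      have hd : (q : ℤ) ∣ m * a := ⟨z, by linarith⟩
      have hd2 : (q : ℤ) ∣ m := by
        refine IsCoprime.dvd_of_dvd_mul_right ?_ hd
        rw [Int.isCoprime_iff_gcd_eq_one, Int.gcd_comm]; exact hg
      have h0 : m = 0 := Int.eq_zero_of_abs_lt_dvd hd2 (by
        have := abs_nonneg m
        have : (0:ℤ) < q := by exact_mod_cast hq
        omega)
      exact hm h0
    have := Int.one_le_abs this
    exact_mod_cast this
  have h2 : |(m : ℝ) * a - z * q| = q * |m * ((a : ℝ) / q) - z| := by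
    rw [← abs_of_pos hq', ← abs_mul, abs_of_pos hq']
    congr 1; field_simp
  have h3 : |(m : ℝ) * ((a : ℝ) / q) - z| ≤ |m * α - z| + |(m : ℝ)| * ((q : ℝ) ^ 2)⁻¹ := by
    have : (m : ℝ) * ((a : ℝ) / q) - z = (m * α - z) - m * (α - a / q) := by ring
    rw [this]
    refine (abs_sub _ _).trans ?_
    rw [abs_mul]
    gcongr
  have h4 : 2 * |(m : ℝ)| ≤ q := by exact_mod_cast hmq
  rw [h2] at h1
  have h5 : |(m : ℝ)| * ((q : ℝ) ^ 2)⁻¹ ≤ 1 / (2 * q) := by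
    rw [← div_eq_mul_inv, div_le_div_iff₀ (by positivity) (by positivity)]
    nlinarith
  have h6 : 1 / (q : ℝ) ≤ |m * ((a : ℝ) / q) - z| := by
    rw [div_le_iff₀ hq']; linarith
  have h7 : 1 / (q : ℝ) = 1 / (2 * q) + 1 / (2 * q) := by field_simp; ring
  linarith

lemma count {α : ℝ} {a : ℤ} {q : ℕ} (hq : 0 < q) (hg : Int.gcd a q = 1) (hα : |α - (a : ℝ) / q| ≤ ((q : ℝ) ^ 2)⁻¹)
    (β A H τ : ℝ) (hH : 0 ≤ H) (hτ : 0 ≤ τ) (S : Finset ℤ) (hS : ∀ n ∈ S, A ≤ n ∧ (n : ℝ) ≤ A + H)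
    (hN : ∀ n ∈ S, NI (n * α + β) τ) :
    (S.card : ℝ) ≤ (2 * H / q + 1) * (4 * q * τ + 1) := by
  have hq' : (0 : ℝ) < q := by exact_mod_cast hq
  choose! z hz using hN
  set r : ℤ → ℝ := fun n => n * α + β - z n with hr
  set g : ℤ → ℕ × ℕ := fun n => (⌊2 * (n - A) / q⌋₊, ⌊2 * q * (r n + τ)⌋₊) with hgdef
  have hmaps : ∀ n ∈ S, g n ∈ range (⌊2 * H / q⌋₊ + 1) ×ˢ range (⌊4 * q * τ⌋₊ + 1) := by
    intro n hn
    obtain ⟨h1, h2⟩ := hS n hn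
    have h3 := abs_le.1 (hz n hn)
    simp only [hgdef, mem_product, mem_range]
    refine ⟨Nat.lt_succ_of_le (Nat.floor_le_floor ?_), Nat.lt_succ_of_le (Nat.floor_le_floor ?_)⟩
    · gcongr; linarith
    · have : r n ≤ τ := h3.2
      nlinarith
  have hinj : Set.InjOn g S := by
    intro m hm n hn hmn
    by_contra hne
    simp only [hgdef, Prod.mk.injEq] at hmn
    obtain ⟨e1, e2⟩ := hmn
    have fl : ∀ x y : ℝ, 0 ≤ x → 0 ≤ y → ⌊x⌋₊ = ⌊y⌋₊ → |x - y| < 1 := by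
      intro x y hx hy h
      have a1 := Nat.floor_le hx
      have a2 := Nat.lt_floor_add_one x
      have a3 := Nat.floor_le hy
      have a4 := Nat.lt_floor_add_one y
      rw [h] at a1 a2
      rw [abs_lt]; constructor <;> linarith
    have m1 := hS m hm
    have n1 := hS n hn
    have m2 := abs_le.1 (hz m hm)
    have n2 := abs_le.1 (hz n hn)
    have f1 := fl _ _ (div_nonneg (by linarith [m1.1]) hq'.le) (div_nonneg (by linarith [n1.1]) hq'.le) e1
    have f2 := fl _ _ (mul_nonneg (by positivity) (by simp only [hr]; linarith [m2.1]))
      (mul_nonneg (by positivity) (by simp only [hr]; linarith [n2.1])) e2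
    have g1 : 2 * |m - n| ≤ q := by
      have : 2 * (m - A) / q - 2 * (n - A) / q = (2 * ((m : ℝ) - n)) / q := by ring
      rw [this, abs_div, abs_of_pos hq', div_lt_one hq', abs_mul, abs_two] at f1
      have : (2 * |m - n| : ℤ) < (q : ℤ) := by exact_mod_cast f1
      exact this.le
    have g2 := sep hq hg hα (m - n) (sub_ne_zero.2 hne) g1 (z m - z n)
    have g3 : 2 * q * (r m + τ) - 2 * q * (r n + τ) = (2 * q) * (((m - n : ℤ) : ℝ) * α - ((z m - z n : ℤ) : ℝ)) := by
      simp only [hr]; push_cast; ring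
    rw [g3, abs_mul, abs_of_pos (show (0 : ℝ) < 2 * q by positivity)] at f2
    rw [div_le_iff₀ (by positivity)] at g2
    linarith
  have hc := card_le_card_of_injOn g hmaps hinj
  rw [card_product, card_range, card_range] at hc
  have hc' : (S.card : ℝ) ≤ ((⌊2 * H / q⌋₊ : ℝ) + 1) * ((⌊4 * q * τ⌋₊ : ℝ) + 1) := by exact_mod_cast hc
  refine hc'.trans ?_
  gcongr
  · exact Nat.floor_le (by positivity)
  · exact Nat.floor_le (by positivity)

/-- coefficients of the shifted polynomial -/
noncomputable def gam (k : ℕ) (a : ℕ → ℝ) (y h : ℕ) : ℝ :=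
  ∑ i ∈ range (k + 1), a i * ((i.choose h : ℕ) * (-(y : ℝ)) ^ (i - h))

lemma gam_id (k : ℕ) (a : ℕ → ℝ) (y : ℕ) (x : ℝ) :
    ∑ i ∈ range (k + 1), a i * (x - y) ^ i = ∑ h ∈ range (k + 1), gam k a y h * x ^ h := by
  simp only [gam, sum_mul]
  rw [sum_comm]
  refine sum_congr rfl fun i hi => ?_
  rw [sub_eq_add_neg, add_pow, mul_sum]
  have hi' : i + 1 ≤ k + 1 := by have := mem_range.1 hi; omega
  rw [← sum_subset (range_mono hi') (f := fun h => a i * ((i.choose h : ℕ) * (-(y : ℝ)) ^ (i - h)) * x ^ h)]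
  · refine sum_congr rfl fun h _ => by ring
  · intro h _ hh
    rw [mem_range, not_lt] at hh
    rw [Nat.choose_eq_zero_of_lt (by omega)]; simp

lemma gam_top (k : ℕ) (a : ℕ → ℝ) (y : ℕ) : gam k a y k = a k := by
  unfold gam
  rw [sum_eq_single k]
  · simp
  · intro i hi hne
    have := mem_range.1 hi
    rw [Nat.choose_eq_zero_of_lt (by omega)]; simp
  · simp

lemma pow_diff (k i h : ℕ) (hik : i ≤ k) (R : ℝ) (hR : 1 ≤ R) (y y0 : ℕ) (hy : (y : ℝ) ≤ R) (hy0 : (y0 : ℝ) ≤ R) :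
    ∃ m : ℤ, ((i.choose h : ℕ) : ℝ) * (-(y : ℝ)) ^ (i - h) - (i.choose h : ℕ) * (-(y0 : ℝ)) ^ (i - h) = m * ((y : ℝ) - y0) ∧
      |(m : ℝ)| ≤ 2 ^ k * k * R ^ (i - h - 1) := by
  refine ⟨-((i.choose h : ℕ) : ℤ) * ∑ t ∈ range (i - h), (-(y : ℤ)) ^ t * (-(y0 : ℤ)) ^ (i - h - 1 - t), ?_, ?_⟩
  · push_cast
    rw [← mul_sub, ← (Commute.all (-(y : ℝ)) (-(y0 : ℝ))).geom_sum₂_mul]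
    ring
  · push_cast
    rw [abs_mul, abs_neg, mul_assoc]
    gcongr
    · rw [Nat.abs_cast]
      have : i.choose h ≤ 2 ^ k := (Nat.choose_le_two_pow i h).trans (Nat.pow_le_pow_right (by norm_num) hik)
      exact_mod_cast this
    · refine (abs_sum_le_sum_abs _ _).trans ?_
      have : ∀ t ∈ range (i - h), |(-(y : ℝ)) ^ t * (-(y0 : ℝ)) ^ (i - h - 1 - t)| ≤ R ^ (i - h - 1) := by
        intro t ht
        have ht' := mem_range.1 ht
        rw [abs_mul, abs_pow, abs_pow, abs_neg, abs_neg, Nat.abs_cast, Nat.abs_cast]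
        calc (y : ℝ) ^ t * (y0 : ℝ) ^ (i - h - 1 - t) ≤ R ^ t * R ^ (i - h - 1 - t) := by gcongr
          _ = _ := by rw [← pow_add]; congr 1; omega
      refine (sum_le_card_nsmul _ _ _ this).trans ?_
      rw [card_range, nsmul_eq_mul]
      gcongr
      omega

lemma mult_ind (k : ℕ) : ∀ t, t + 1 ≤ k → ∃ E : ℝ, 0 ≤ E ∧ ∀ (a : ℕ → ℝ) (R : ℝ) (y y0 : ℕ),
    1 ≤ R → (y : ℝ) ≤ R → (y0 : ℝ) ≤ R →
    (∀ h, 1 ≤ h → h < k → NI (gam k a y h - gam k a y0 h) (2 / R ^ h)) →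
    ∀ i, k - t < i → i ≤ k → NI ((k.factorial ^ (k - i + 1) : ℕ) * (a i * ((y : ℝ) - y0))) (E / R ^ (i - 1)) := by
  intro t
  induction t with
  | zero => intro _; exact ⟨0, le_rfl, fun a R y y0 _ _ _ _ i h1 h2 => by omega⟩
  | succ t ih =>
    intro ht
    obtain ⟨E, hE, H⟩ := ih (by omega)
    set K : ℝ := ((k.factorial ^ (k + 1) : ℕ) : ℝ) with hK
    have hK0 : 0 ≤ K := by positivity
    refine ⟨E + (K * 2 + k * (K * (2 ^ k * k) * E)), by positivity, ?_⟩
    intro a R y y0 hR hy hy0 hN i hi hik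
    have H' := H a R y y0 hR hy hy0 hN
    have hR0 : 0 < R := by linarith
    rcases Nat.lt_or_ge (k - t) i with hlt | hge
    · refine (H' i hlt hik).mono ?_
      gcongr
      have : 0 ≤ K * 2 + k * (K * (2 ^ k * k) * E) := by positivity
      linarith
    · have hi0 : i = k - t := by omega
      have hi2 : 2 ≤ i := by omega
      obtain ⟨h, rfl⟩ : ∃ h, i = h + 1 := ⟨i - 1, by omega⟩
      have hD := hN h (by omega) (by omega)
      obtain ⟨f, hf⟩ := Nat.dvd_factorial (show 0 < h + 1 by omega) hik
      choose m hm hmb using fun (i : ℕ) (hik : i ≤ k) => pow_diff k i h hik R hR y y0 hy hy0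
      set m' : ℕ → ℤ := fun i => if hik : i ≤ k then m i hik else 0 with hm'
      have hm1 : ∀ i ≤ k, ((i.choose h : ℕ) : ℝ) * (-(y : ℝ)) ^ (i - h) - (i.choose h : ℕ) * (-(y0 : ℝ)) ^ (i - h) = m' i * ((y : ℝ) - y0) := by
        intro i hi; simp only [hm', hi, dif_pos]; exact hm i hi
      have hm2 : ∀ i ≤ k, |(m' i : ℝ)| ≤ 2 ^ k * k * R ^ (i - h - 1) := by
        intro i hi; simp only [hm', hi, dif_pos]; exact hmb i hi
      have hDeq : gam k a y h - gam k a y0 h = -((h + 1 : ℕ) : ℝ) * (a (h + 1) * ((y : ℝ) - y0)) +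
          ∑ i ∈ Ico (h + 2) (k + 1), m' i * (a i * ((y : ℝ) - y0)) := by
        unfold gam
        rw [← sum_sub_distrib, ← sum_range_add_sum_Ico _ (show h + 2 ≤ k + 1 by omega), sum_range_succ]
        congr 1
        · rw [sum_eq_zero, zero_add]
          · have : h + 1 - h = 1 := by omega
            rw [this, Nat.choose_succ_self_right]
            push_cast; ring
          · intro i hi
            have := mem_range.1 hi
            rw [show i - h = 0 by omega]; simp
        · refine sum_congr rfl fun i hi => ?_
          rw [← mul_sub, hm1 i (by have := mem_Ico.1 hi; omega)]; ring
      set c : ℕ := k.factorial ^ (k - (h + 1)) * f with hc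
      have hc1 : k.factorial ^ (k - (h + 1) + 1) = c * (h + 1) := by
        rw [hc, pow_succ]; nth_rw 2 [hf]; ring
      have hfk : f ≤ k.factorial := by rw [hf]; exact Nat.le_mul_of_pos_left _ (by omega)
      have hcK : ∀ e, e ≤ k → ((k.factorial ^ e * f : ℕ) : ℝ) ≤ K := by
        intro e he
        rw [hK]
        norm_cast
        rw [pow_succ]
        exact Nat.mul_le_mul (Nat.pow_le_pow_right (Nat.factorial_pos _) (by omega)) hfk
      have heq : ((k.factorial ^ (k - (h + 1) + 1) : ℕ) : ℝ) * (a (h + 1) * ((y : ℝ) - y0)) =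
          ∑ i ∈ Ico (h + 2) (k + 1), (((k.factorial ^ (i - (h + 2)) * f : ℕ) : ℤ) * m' i : ℤ) * ((k.factorial ^ (k - i + 1) : ℕ) * (a i * ((y : ℝ) - y0)))
          - ((c : ℕ) : ℤ) * (gam k a y h - gam k a y0 h) := by
        have e2 : ∀ i ∈ Ico (h + 2) (k + 1), (((k.factorial ^ (i - (h + 2)) * f : ℕ) : ℤ) * m' i : ℤ) * ((k.factorial ^ (k - i + 1) : ℕ) * (a i * ((y : ℝ) - y0)))
            = (c : ℝ) * (m' i * (a i * ((y : ℝ) - y0))) := by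
          intro i hi
          have hi := mem_Ico.1 hi
          have : (c : ℝ) = (k.factorial : ℝ) ^ (i - (h + 2)) * f * (k.factorial : ℝ) ^ (k - i + 1) := by
            rw [hc, show k - (h + 1) = i - (h + 2) + (k - i + 1) by omega, pow_add]; push_cast; ring
          rw [this]; push_cast; ring
        rw [sum_congr rfl e2, hDeq, ← mul_sum, hc1]
        push_cast; ring
      rw [heq]
      refine (NI.sub (NI.sum _ _ (fun _ => K * (2 ^ k * k) * E / R ^ h) ?_) (hD.mul (c : ℤ))).mono ?_
      · intro i hi
        have hi := mem_Ico.1 hi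
        refine ((H' i (by omega) (by omega)).mul _).mono ?_
        push_cast
        rw [abs_mul]
        have b1 := hm2 i (by omega)
        have b2 : |(k.factorial : ℝ) ^ (i - (h + 2)) * (f : ℝ)| ≤ K := by
          rw [abs_of_nonneg (by positivity)]
          have := hcK (i - (h + 2)) (by omega)
          push_cast at this; exact this
        have e3 : R ^ (i - 1) = R ^ (i - h - 1) * R ^ h := by rw [← pow_add]; congr 1; omega
        calc _ ≤ K * (2 ^ k * k * R ^ (i - h - 1)) * (E / R ^ (i - 1)) := by gcongr
          _ = _ := by rw [e3]; field_simp
      · rw [sum_const, nsmul_eq_mul, Nat.card_Ico]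
        have b2 : |(((c : ℕ) : ℤ) : ℝ)| ≤ K := by
          rw [Int.cast_natCast, Nat.abs_cast]; exact hcK _ (by omega)
        have b3 : ((k + 1 - (h + 2) : ℕ) : ℝ) ≤ k := by exact_mod_cast (by omega)
        rw [Nat.add_sub_cancel]
        calc _ ≤ k * (K * (2 ^ k * k) * E / R ^ h) + K * (2 / R ^ h) := by gcongr
          _ = (K * 2 + k * (K * (2 ^ k * k) * E)) / R ^ h := by ring
          _ ≤ _ := div_le_div_of_nonneg_right (by linarith) (by positivity)
end VMVT

namespace VMVT
open Finset

lemma poly_le_exp (p : ℝ) (hp : 1 < p) (η : ℝ) (hη : 0 < η) (m : ℕ) :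
    ∃ C : ℝ, 1 ≤ C ∧ ∀ n : ℕ, ((n : ℝ) + 1) ^ m ≤ C * p ^ (η * n) := by
  have hlog := Real.log_pos hp
  set δ := η * Real.log p / (m + 1) with hδ
  have hδ0 : 0 < δ := by positivity
  refine ⟨max 1 ((δ⁻¹ * Real.exp δ) ^ m), le_max_left _ _, fun n => ?_⟩
  have h1 : (n : ℝ) + 1 ≤ δ⁻¹ * Real.exp δ * Real.exp (δ * n) := by
    have := Real.add_one_le_exp (δ * (n + 1))
    rw [mul_assoc, ← Real.exp_add, inv_mul_eq_div, le_div_iff₀ hδ0]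
    have e : δ * (n + 1) = δ + δ * n := by ring
    rw [e] at this
    linarith
  calc ((n : ℝ) + 1) ^ m ≤ (δ⁻¹ * Real.exp δ * Real.exp (δ * n)) ^ m := by gcongr
    _ = (δ⁻¹ * Real.exp δ) ^ m * Real.exp (m * (δ * n)) := by rw [mul_pow, Real.exp_nat_mul]
    _ ≤ max 1 ((δ⁻¹ * Real.exp δ) ^ m) * p ^ (η * n) := by
      refine mul_le_mul (le_max_right _ _) ?_ (by positivity) (by positivity)
      rw [Real.rpow_def_of_pos (by linarith), Real.exp_le_exp]
      have : m * δ ≤ η * Real.log p := by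
        rw [hδ, ← mul_div_assoc, div_le_iff₀ (by positivity)]
        have : 0 ≤ η * Real.log p := by positivity
        nlinarith
      calc m * (δ * n) = m * δ * n := by ring
        _ ≤ η * Real.log p * n := by gcongr
        _ = _ := by ring

lemma shift_sum (k : ℕ) (hk : 1 ≤ k) (a : ℕ → ℝ) (N y : ℕ) :
    ‖∑ x ∈ Icc 1 N, ee (∑ i ∈ range (k + 1), a i * (x : ℝ) ^ i)‖ ≤
      ‖∑ x ∈ range (y + N + 1), ee (a k * (x : ℝ) ^ k) * ee (∑ h : Fin (k - 1), gam k a y ((h : ℕ) + 1) * (x : ℝ) ^ ((h : ℕ) + 1))‖ +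
      ‖∑ x ∈ range (y + 1), ee (a k * (x : ℝ) ^ k) * ee (∑ h : Fin (k - 1), gam k a y ((h : ℕ) + 1) * (x : ℝ) ^ ((h : ℕ) + 1))‖ := by
  obtain ⟨d, rfl⟩ : ∃ d, k = d + 1 := ⟨k - 1, by omega⟩
  refine le_trans (le_of_eq ?_) (norm_sub_le _ _)
  rw [← sum_Ico_eq_sub _ (by omega)]
  have h1 : ∑ x ∈ Icc 1 N, ee (∑ i ∈ range (d + 1 + 1), a i * (x : ℝ) ^ i) =
      ee (gam (d + 1) a y 0) * ∑ x ∈ Ico (y + 1) (y + N + 1), ee (a (d + 1) * (x : ℝ) ^ (d + 1)) *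
        ee (∑ h : Fin d, gam (d + 1) a y ((h : ℕ) + 1) * (x : ℝ) ^ ((h : ℕ) + 1)) := by
    have e0 : Icc 1 N = Ico 1 (N + 1) := by ext; simp [Nat.lt_succ_iff]
    rw [e0, show y + 1 = 1 + y by ring, show y + N + 1 = (N + 1) + y by ring,
      ← Finset.sum_Ico_add' (fun x : ℕ => ee (a (d + 1) * (x : ℝ) ^ (d + 1)) *
        ee (∑ h : Fin d, gam (d + 1) a y ((h : ℕ) + 1) * (x : ℝ) ^ ((h : ℕ) + 1))) 1 (N + 1) y]
    rw [mul_sum]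
    refine sum_congr rfl fun x _ => ?_
    rw [← ee_add, ← ee_add]
    congr 1
    have := gam_id (d + 1) a y ((x + y : ℕ) : ℝ)
    rw [sum_range_succ (fun h => gam (d + 1) a y h * ((x + y : ℕ) : ℝ) ^ h), gam_top,
      sum_range_succ' (fun h => gam (d + 1) a y h * ((x + y : ℕ) : ℝ) ^ h)] at this
    rw [Fin.sum_univ_eq_sum_range (fun h => gam (d + 1) a y (h + 1) * ((x + y : ℕ) : ℝ) ^ (h + 1)) d]
    have e2 : ((x + y : ℕ) : ℝ) - y = x := by push_cast; ring
    rw [e2] at this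
    rw [this]; ring
  rw [h1, norm_mul, ee_norm, one_mul]
  rfl

theorem weyl_gen (k : ℕ) (hk : 2 ≤ k) (ε : ℝ) (hε : 0 < ε) : ∃ C : ℝ, 1 ≤ C ∧
    ∀ (a : ℕ → ℝ) (b : ℤ) (q j N : ℕ), 0 < q → Int.gcd b q = 1 → 2 ≤ j → j ≤ k → 1 ≤ N →
      |a j - (b : ℝ) / q| ≤ ((q : ℝ) ^ 2)⁻¹ →
      (‖∑ x ∈ Icc 1 N, ee (∑ i ∈ range (k + 1), a i * (x : ℝ) ^ i)‖ ^ 2) ^ sN (k - 1) ≤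
        C * (N : ℝ) ^ ((2 * sN (k - 1) : ℕ) + ε) * (1 / (q : ℝ) + 1 / N + q / (N : ℝ) ^ j) := by
  classical
  obtain ⟨p, hkp, hp⟩ := Nat.exists_infinite_primes k
  have : Fact p.Prime := ⟨hp⟩
  have hp1 : (1 : ℝ) < p := by exact_mod_cast hp.one_lt
  have hp0 : (0 : ℝ) < p := by linarith
  set d := k - 1 with hd
  set s := sN d with hs
  obtain ⟨C1, hC1, H1⟩ := core (p := p) (d := d) (by omega) (by omega) (ε / 2) (by linarith)
  obtain ⟨C2, hC2, H2⟩ := poly_le_exp p hp1 (ε / 2) (by linarith) (2 * s + 1)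
  obtain ⟨E, hE, H3⟩ := mult_ind k (k - 1) (by omega)
  set K : ℝ := ((k.factorial ^ (k + 1) : ℕ) : ℝ) with hK
  have hK1 : 1 ≤ K := by
    rw [hK]; exact_mod_cast Nat.one_le_pow _ _ (Nat.factorial_pos _)
  set D : ℝ := 8 * K * E + 2 * K + 4 * E + 1 with hD
  have hKE : 0 ≤ 8 * K * E := by positivity
  have hD1 : 1 ≤ D := by linarith
  set P : ℝ := (3 * p) ^ ε * (3 * p) ^ (2 * s) with hP
  have h3p : (1 : ℝ) ≤ 3 * p := by linarith
  have hP1 : 1 ≤ P := one_le_mul_of_one_le_of_one_le (Real.one_le_rpow h3p hε.le) (one_le_pow₀ h3p)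
  refine ⟨C1 * C2 * P * D, one_le_mul_of_one_le_of_one_le (one_le_mul_of_one_le_of_one_le
    (one_le_mul_of_one_le_of_one_le hC1 hC2) hP1) hD1, ?_⟩
  intro a b q j N hq hg hj hjk hN ha
  have hq' : (0 : ℝ) < q := by exact_mod_cast hq
  have hN' : (1 : ℝ) ≤ N := by exact_mod_cast hN
  have hN0 : (0 : ℝ) < N := by linarith
  -- choice of n
  set n := Nat.clog p (2 * N) with hn
  have hn1 : 2 * N ≤ p ^ n := Nat.le_pow_clog hp.one_lt _
  have hn2 : p ^ n ≤ p * (2 * N) := by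
    have h1 : p ^ (n - 1) < 2 * N := Nat.pow_pred_clog_lt_self hp.one_lt (by omega)
    have h2 : 0 < n := Nat.clog_pos hp.one_lt (by omega)
    calc p ^ n = p * p ^ (n - 1) := by rw [← pow_succ']; congr 1; omega
      _ ≤ _ := Nat.mul_le_mul_left _ h1.le
  set R : ℝ := (p : ℝ) ^ n with hR
  have hR1 : 2 * (N : ℝ) ≤ R := by rw [hR]; exact_mod_cast hn1
  have hR2 : R ≤ 3 * p * N := by
    have : R ≤ p * (2 * N) := by rw [hR]; exact_mod_cast hn2
    nlinarith
  have hR0 : 0 < R := by linarith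
  set Br : ℝ := 1 / (q : ℝ) + 1 / N + q / (N : ℝ) ^ j with hBr
  have hBr0 : 0 ≤ Br := by positivity
  set F := ‖∑ x ∈ Icc 1 N, ee (∑ i ∈ range (k + 1), a i * (x : ℝ) ^ i)‖ with hF
  have hcore := H1 n (fun x => ee (a k * (x : ℝ) ^ k)) (fun x => by simp) (range N)
    (fun y h => gam k a y ((h : ℕ) + 1)) F (D * (N * Br)) (norm_nonneg _) (by positivity) ?_ ?_
  · rw [card_range] at hcore
    have hRn : (p : ℝ) ^ (ε / 2 * n) * (p : ℝ) ^ (ε / 2 * n) = R ^ ε := by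
      rw [← Real.rpow_add hp0, hR, ← Real.rpow_natCast, ← Real.rpow_mul hp0.le]; congr 1; ring
    have hb : ((n : ℝ) + 1) ^ (2 * s + 1) * (p : ℝ) ^ (ε / 2 * n) ≤ C2 * (3 * p * N) ^ ε := by
      calc ((n : ℝ) + 1) ^ (2 * s + 1) * (p : ℝ) ^ (ε / 2 * n) ≤ C2 * (p : ℝ) ^ (ε / 2 * n) * (p : ℝ) ^ (ε / 2 * n) := by
            gcongr; exact H2 n
        _ = C2 * R ^ ε := by rw [mul_assoc, hRn]
        _ ≤ _ := by gcongr
    refine le_of_mul_le_mul_right (a := (N : ℝ)) (hcore.trans ?_) hN0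
    calc C1 * ((n : ℝ) + 1) ^ (2 * s + 1) * (p : ℝ) ^ (ε / 2 * n) * R ^ (2 * s) * (D * (N * Br))
        = C1 * (((n : ℝ) + 1) ^ (2 * s + 1) * (p : ℝ) ^ (ε / 2 * n)) * R ^ (2 * s) * (D * (N * Br)) := by ring
      _ ≤ C1 * (C2 * (3 * p * N) ^ ε) * (3 * p * N) ^ (2 * s) * (D * (N * Br)) := by gcongr
      _ = _ := by
        rw [Real.rpow_add hN0, Real.rpow_natCast, Real.mul_rpow (by positivity) hN0.le, mul_pow (3 * (p : ℝ)), hP]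
        ring
  · intro y hy
    have hy := mem_range.1 hy
    exact ⟨y + N + 1, by omega, y + 1, by omega, shift_sum k (by omega) a N y⟩
  · intro y0 hy0
    have hy0 := mem_range.1 hy0
    set c : ℕ := k.factorial ^ (k - j + 1) with hc
    have hc0 : 0 < c := by rw [hc]; exact pow_pos (Nat.factorial_pos _) _
    have hcK : (c : ℝ) ≤ K := by
      rw [hK, hc]; exact_mod_cast Nat.pow_le_pow_right (Nat.factorial_pos _) (by omega)
    set Z := (range N).filter (fun y => ∀ h : Fin d, NI (gam k a y ((h : ℕ) + 1) - gam k a y0 ((h : ℕ) + 1)) (2 / R ^ ((h : ℕ) + 1))) with hZ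
    have hinj : Function.Injective (fun y : ℕ => (c : ℤ) * y) := by
      intro x y hxy
      have : (c : ℤ) ≠ 0 := by exact_mod_cast hc0.ne'
      have := mul_left_cancel₀ this hxy
      exact_mod_cast this
    have hcount := count hq hg ha (-(c * a j * y0)) 0 (K * N) (E / R ^ (j - 1)) (by positivity) (by positivity)
      (Z.image (fun y : ℕ => (c : ℤ) * y)) ?_ ?_
    · rw [card_image_of_injective _ hinj] at hcount
      refine hcount.trans ?_
      have hNR : E / R ^ (j - 1) ≤ E / (N : ℝ) ^ (j - 1) := by
        gcongr; linarith
      have hNj : (N : ℝ) ^ j = N ^ (j - 1) * N := by rw [← pow_succ]; congr 1; omega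
      have hNj1 : (N : ℝ) ≤ N ^ (j - 1) := le_self_pow₀ hN' (by omega)
      have hNjp : (0 : ℝ) < N ^ (j - 1) := by positivity
      have hNBr : N * Br = N / q + 1 + q / N ^ (j - 1) := by
        rw [hBr, hNj]; field_simp
      have t1 : 0 ≤ (N : ℝ) / q := by positivity
      have t2 : 0 ≤ (q : ℝ) / N ^ (j - 1) := by positivity
      have t3 : (N : ℝ) / N ^ (j - 1) ≤ 1 := (div_le_one hNjp).2 hNj1
      rw [hNBr]
      calc (2 * (K * N) / q + 1) * (4 * q * (E / R ^ (j - 1)) + 1)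
          ≤ (2 * (K * N) / q + 1) * (4 * q * (E / (N : ℝ) ^ (j - 1)) + 1) := by gcongr
        _ = 8 * K * E * (N / N ^ (j - 1)) + 2 * K * (N / q) + 4 * E * (q / N ^ (j - 1)) + 1 := by
            field_simp; ring
        _ ≤ 8 * K * E * 1 + 2 * K * (N / q) + 4 * E * (q / N ^ (j - 1)) + 1 := by gcongr
        _ ≤ D * (N / q) + D * (q / N ^ (j - 1)) + D := by
            have u1 : 2 * K * ((N : ℝ) / q) ≤ D * (N / q) := by gcongr; linarith
            have u2 : 4 * E * ((q : ℝ) / N ^ (j - 1)) ≤ D * (q / N ^ (j - 1)) := by gcongr; linarith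
            linarith
        _ = _ := by ring
    · intro m hm
      obtain ⟨y, hy, rfl⟩ := mem_image.1 hm
      have hy := mem_range.1 (mem_filter.1 hy).1
      push_cast
      refine ⟨by positivity, ?_⟩
      rw [zero_add]
      gcongr
    · intro m hm
      obtain ⟨y, hy, rfl⟩ := mem_image.1 hm
      have hy' := mem_range.1 (mem_filter.1 hy).1
      have hyR : (y : ℝ) ≤ R := by
        have : (y : ℝ) ≤ N := by exact_mod_cast hy'.le
        linarith
      have hy0R : (y0 : ℝ) ≤ R := by
        have : (y0 : ℝ) ≤ N := by exact_mod_cast hy0.le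
        linarith
      have := H3 a R y y0 (by linarith) hyR hy0R (fun h h1 h2 => by
        have := (mem_filter.1 hy).2 ⟨h - 1, by omega⟩
        simp only [Nat.sub_add_cancel h1] at this
        exact this) j (by omega) hjk
      convert this using 1
      push_cast [hc]
      ring
end VMVT

namespace VMVT
open Finset

lemma div_bound (ε : ℝ) (hε : 0 < ε) : ∃ C : ℝ, 1 ≤ C ∧ ∀ n : ℕ, n ≠ 0 →
    ((n.divisors.card : ℕ) : ℝ) ≤ C * (n : ℝ) ^ ε := by
  obtain ⟨K, hK1, hK⟩ := poly_le_exp 2 (by norm_num) ε hε 1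
  obtain ⟨P, hP⟩ := exists_nat_ge ((2 : ℝ) ^ (1 / ε))
  refine ⟨K ^ P, one_le_pow₀ hK1, fun n hn => ?_⟩
  have h1 : ∀ p ∈ n.primeFactors, ((n.factorization p : ℝ) + 1) ≤
      (if p < P then K else 1) * ((p : ℝ) ^ ε) ^ (n.factorization p) := by
    intro p hp
    have hp2 : 2 ≤ p := (Nat.prime_of_mem_primeFactors hp).two_le
    have hp2' : (2 : ℝ) ≤ p := by exact_mod_cast hp2
    split_ifs with h
    · have := hK (n.factorization p)
      rw [pow_one] at this
      refine this.trans ?_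
      rw [Real.rpow_mul (by norm_num), Real.rpow_natCast]
      gcongr
    · push Not at h
      have h2 : (2 : ℝ) ≤ (p : ℝ) ^ ε := by
        have : (2 : ℝ) ^ (1 / ε) ≤ p := hP.trans (by exact_mod_cast h)
        calc (2 : ℝ) = ((2 : ℝ) ^ (1 / ε)) ^ ε := by
              rw [← Real.rpow_mul (by norm_num)]; field_simp; simp
          _ ≤ _ := by gcongr
      rw [one_mul]
      calc ((n.factorization p : ℝ) + 1) ≤ (2 : ℝ) ^ (n.factorization p) := by
            exact_mod_cast Nat.lt_two_pow_self
        _ ≤ _ := by gcongr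
  have h3 : ((n.divisors.card : ℕ) : ℝ) = ∏ p ∈ n.primeFactors, ((n.factorization p : ℝ) + 1) := by
    rw [Nat.card_divisors hn]; push_cast; rfl
  have h4 : (n : ℝ) ^ ε = ∏ p ∈ n.primeFactors, ((p : ℝ) ^ ε) ^ (n.factorization p) := by
    conv_lhs => rw [← Nat.prod_factorization_pow_eq_self hn]
    rw [Finsupp.prod, Nat.support_factorization]
    push_cast
    rw [← Real.finsetProd_rpow _ _ (fun i _ => by positivity)]
    refine prod_congr rfl fun p _ => ?_
    rw [← Real.rpow_natCast, ← Real.rpow_mul (by positivity), ← Real.rpow_natCast,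
      ← Real.rpow_mul (by positivity), mul_comm]
  rw [h3, h4]
  refine (prod_le_prod (fun p _ => by positivity) h1).trans ?_
  rw [prod_mul_distrib]
  gcongr
  rw [← prod_filter, prod_const]
  refine pow_le_pow_right₀ hK1 ?_
  calc _ ≤ (range P).card := card_le_card (by intro p hp; simp at hp ⊢; exact hp.2)
    _ = P := card_range P

/-- minimal vector and line counting for the lattice `(l, l ϑ - z)` -/
lemma lat_count (ϑ φ τ L c : ℝ) (S : Finset ℤ) (hS : ∀ l ∈ S, c ≤ l ∧ (l : ℝ) ≤ c + L)
    (hN : ∀ l ∈ S, NI (l * ϑ + φ) τ) (h2 : 2 ≤ S.card) :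
    ∃ (m z : ℤ) (F : ℕ), 1 ≤ m ∧ (m : ℝ) ≤ L ∧ |m * ϑ - z| ≤ 2 * τ ∧ 1 ≤ F ∧
      ((F : ℝ) - 1) * m ≤ L ∧ ((F : ℝ) - 1) * |m * ϑ - z| ≤ 2 * τ ∧
      (∀ l : ℤ, 1 ≤ l → NI (l * ϑ) (2 * τ) → m ≤ l) ∧
      ((S.card : ℝ) ≤ F ∨ 1 ≤ 2 * m * τ + L * |m * ϑ - z|) ∧
      (S.card : ℝ) ≤ (2 * (2 * m * τ + L * |m * ϑ - z|) + 1) * F := by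
  have hd : ∀ l ∈ S, ∀ l' ∈ S, l < l' → NI (((l' - l : ℤ) : ℝ) * ϑ) (2 * τ) := by
    intro l hl l' hl' hlt
    obtain ⟨z, hz⟩ := hN l hl
    obtain ⟨z', hz'⟩ := hN l' hl'
    refine ⟨z' - z, ?_⟩
    have : (((l' - l : ℤ) : ℝ) * ϑ - ((z' - z : ℤ) : ℝ)) = (l' * ϑ + φ - z') - (l * ϑ + φ - z) := by
      push_cast; ring
    rw [this]
    exact (abs_sub _ _).trans (by linarith)
  obtain ⟨x, hx, y, hy, hxy⟩ := (one_lt_card (s := S)).1 h2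
  wlog hlt : x < y generalizing x y
  · exact this y hy x hx hxy.symm (lt_of_le_of_ne (not_lt.1 hlt) hxy.symm)
  classical
  have hex : ∃ m : ℕ, 1 ≤ m ∧ NI (((m : ℤ) : ℝ) * ϑ) (2 * τ) := by
    refine ⟨(y - x).toNat, by omega, ?_⟩
    rw [Int.toNat_of_nonneg (by omega)]
    exact hd x hx y hy hlt
  obtain ⟨hm1, hmN⟩ := Nat.find_spec hex
  set m := Nat.find hex with hm
  have hmin : ∀ l : ℤ, 1 ≤ l → NI (l * ϑ) (2 * τ) → (m : ℤ) ≤ l := by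
    intro l hl hN
    have := Nat.find_min' hex (m := l.toNat) ⟨by omega, by rw [Int.toNat_of_nonneg (by omega)]; exact hN⟩
    omega
  obtain ⟨z, hz⟩ := hmN
  have hm0 : (1 : ℝ) ≤ m := by exact_mod_cast hm1
  have hτ : 0 ≤ τ := by have := (abs_nonneg _).trans hz; linarith
  choose! Z hZ using hN
  set u : ℤ → ℝ := fun l => l * ϑ + φ - Z l with hu
  set u0 : ℝ := ((m : ℤ) : ℝ) * ϑ - z with hu0
  -- determinant
  let dt : ℤ → ℤ := fun l => (l - x) * z - m * (Z l - Z x)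
  have hdt : ∀ l, (dt l : ℝ) = m * (u l - u x) - (l - x) * u0 := by
    intro l; simp only [dt, hu, hu0]; push_cast; ring
  set D : ℝ := 2 * m * τ + L * |u0| with hD
  have hu2 : ∀ l ∈ S, ∀ l' ∈ S, |u l' - u l| ≤ 2 * τ := fun l hl l' hl' =>
    (abs_sub _ _).trans (by have := hZ l hl; have := hZ l' hl'; simp only [hu]; linarith)
  have hdtb : ∀ l ∈ S, |(dt l : ℝ)| ≤ D := by
    intro l hl
    rw [hdt]
    refine (abs_sub _ _).trans ?_
    rw [abs_mul, abs_mul, hD, abs_of_nonneg (by positivity : (0:ℝ) ≤ m)]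
    have h1 := hu2 x hx l hl
    have h3 : |(l : ℝ) - x| ≤ L := by
      rw [abs_le]; have := hS l hl; have := hS x hx; constructor <;> linarith
    have : (m : ℝ) * |u l - u x| ≤ m * (2 * τ) := by gcongr
    have : |(l : ℝ) - x| * |u0| ≤ L * |u0| := by gcongr
    linarith
  -- fibre
  have hfib : ∀ l ∈ S, ∀ l' ∈ S, l < l' → dt l = dt l' → (m : ℤ) ≤ l' - l ∧
      m * (u l' - u l) = (l' - l) * u0 := by
    intro l hl l' hl' hlt he
    refine ⟨hmin _ (by omega) (hd l hl l' hl' hlt), ?_⟩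
    have : (dt l : ℝ) = dt l' := by rw [he]
    rw [hdt, hdt] at this
    linarith
  -- fibre cardinalities
  have hF : ∀ T ⊆ S, T.Nonempty → (∀ l ∈ T, ∀ l' ∈ T, dt l = dt l') →
      ((T.card : ℝ) - 1) * m ≤ L ∧ ((T.card : ℝ) - 1) * |u0| ≤ 2 * τ := by
    intro T hTS hT hTd
    have hspread : ∃ l ∈ T, ∃ l' ∈ T, ((T.card : ℝ) - 1) * m ≤ l' - l := by
      refine ⟨T.min' hT, T.min'_mem hT, T.max' hT, T.max'_mem hT, ?_⟩
      have hcard : T.card ≤ (range ((T.max' hT - T.min' hT).toNat / m + 1)).card := by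
        refine card_le_card_of_injOn (fun l => (l - T.min' hT).toNat / m) ?_ ?_
        · intro l hl
          have h1 := T.le_max' l hl
          have h3 := T.min'_le l hl
          simp only [coe_range, Set.mem_Iio, Nat.lt_succ_iff]
          exact Nat.div_le_div_right (by omega)
        · have key : ∀ l ∈ T, ∀ l' ∈ T, l < l' →
              (l - T.min' hT).toNat / m < (l' - T.min' hT).toNat / m := by
            intro l hl l' hl' h
            have h1 := (hfib l (hTS hl) l' (hTS hl') h (hTd l hl l' hl')).1
            have h3 := T.min'_le l hl
            rw [Nat.lt_iff_add_one_le, Nat.le_div_iff_mul_le (by omega), add_mul, one_mul]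
            have := Nat.div_mul_le_self (l - T.min' hT).toNat m
            omega
          intro l hl l' hl' he
          rcases lt_trichotomy l l' with h | h | h
          · exact absurd he (key l hl l' hl' h).ne
          · exact h
          · exact absurd he (key l' hl' l hl h).ne'
      rw [card_range] at hcard
      have h1 : (T.card - 1) * m ≤ (T.max' hT - T.min' hT).toNat :=
        (Nat.mul_le_mul_right m (Nat.sub_le_of_le_add hcard)).trans (Nat.div_mul_le_self _ m)
      have hc1 : 1 ≤ T.card := hT.card_pos
      have h3 := T.min'_le _ (T.max'_mem hT)
      have h4 : ((T.card - 1 : ℕ) : ℤ) * m ≤ T.max' hT - T.min' hT := by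
        have : (((T.card - 1) * m : ℕ) : ℤ) ≤ ((T.max' hT - T.min' hT).toNat : ℤ) := by exact_mod_cast h1
        rw [Int.toNat_of_nonneg (by omega)] at this
        push_cast at this ⊢; exact this
      rw [Nat.cast_sub hc1] at h4
      exact_mod_cast h4
    obtain ⟨l, hl, l', hl', h⟩ := hspread
    have hLb : (l' : ℝ) - l ≤ L := by
      have := hS l (hTS hl); have := hS l' (hTS hl'); linarith
    refine ⟨h.trans hLb, ?_⟩
    have he : (m : ℝ) * (u l' - u l) = (l' - l) * u0 := by
      have := hTd l hl l' hl'
      have : (dt l : ℝ) = dt l' := by rw [this]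
      rw [hdt, hdt] at this
      linarith
    have hc1 : (1 : ℝ) ≤ T.card := by exact_mod_cast hT.card_pos
    have h5 : (((T.card : ℝ) - 1) * |u0|) * m ≤ 2 * τ * m := by
      calc (((T.card : ℝ) - 1) * |u0|) * m = (((T.card : ℝ) - 1) * m) * |u0| := by ring
        _ ≤ (l' - l) * |u0| := by gcongr
        _ ≤ |((l' : ℝ) - l) * u0| := by rw [abs_mul]; gcongr; exact le_abs_self _
        _ = m * |u l' - u l| := by rw [← he, abs_mul, abs_of_nonneg (by positivity : (0:ℝ) ≤ m)]
        _ ≤ m * (2 * τ) := by gcongr; exact hu2 l (hTS hl) l' (hTS hl')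
        _ = _ := by ring
    exact le_of_mul_le_mul_right h5 (by linarith)
  -- biggest fibre
  obtain ⟨v, hv, hvmax⟩ := exists_max_image (S.image dt) (fun v => (S.filter (fun l => dt l = v)).card)
    (⟨dt x, mem_image_of_mem dt hx⟩)
  set T := S.filter (fun l => dt l = v) with hT
  have hTne : T.Nonempty := by
    obtain ⟨l, hl, rfl⟩ := mem_image.1 hv
    exact ⟨l, mem_filter.2 ⟨hl, rfl⟩⟩
  have hTF := hF T (filter_subset _ _) hTne (by
    intro l hl l' hl'
    rw [(mem_filter.1 hl).2, (mem_filter.1 hl').2])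
  have hcardS : S.card ≤ (S.image dt).card * T.card := by
    rw [card_eq_sum_card_image dt S, ← smul_eq_mul, ← sum_const]
    exact sum_le_sum fun v hv => hvmax v hv
  have hmL : (m : ℝ) ≤ L := by
    have h1 := hmin _ (by omega) (hd x hx y hy hlt)
    have h1' : (m : ℝ) ≤ y - x := by exact_mod_cast h1
    have := hS x hx; have := hS y hy; linarith
  have hD0 : 0 ≤ D := by have : 0 ≤ L := by linarith
                         positivity
  refine ⟨m, z, T.card, by exact_mod_cast hm1, by exact_mod_cast hmL, hz, hTne.card_pos, by exact_mod_cast hTF.1,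
    hTF.2, hmin, ?_, ?_⟩
  · by_cases hD1 : D < 1
    · left
      have : S.image dt ⊆ {0} := by
        intro v hv
        obtain ⟨l, hl, rfl⟩ := mem_image.1 hv
        have := (hdtb l hl).trans_lt hD1
        have : |dt l| < 1 := by exact_mod_cast this
        rw [mem_singleton]; exact Int.abs_lt_one_iff.1 this
      have := card_le_card this
      rw [card_singleton] at this
      have : S.card ≤ T.card := by nlinarith
      exact_mod_cast this
    · right; rw [not_lt, hD, hu0] at hD1; push_cast at hD1 ⊢; exact hD1
  · have h1 : ((S.image dt).card : ℝ) ≤ 2 * D + 1 := by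
      have : S.image dt ⊆ Icc (-⌊D⌋) ⌊D⌋ := by
        intro v hv
        obtain ⟨l, hl, rfl⟩ := mem_image.1 hv
        have h3 := abs_le.1 (hdtb l hl)
        rw [mem_Icc]
        constructor
        · have : -dt l ≤ ⌊D⌋ := Int.le_floor.2 (by push_cast; linarith)
          omega
        · exact Int.le_floor.2 h3.2
      have h3 := card_le_card this
      rw [Int.card_Icc] at h3
      have h4 : 0 ≤ ⌊D⌋ := Int.floor_nonneg.2 hD0
      have h5 : ((S.image dt).card : ℤ) ≤ 2 * ⌊D⌋ + 1 := by omega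
      have h6 : ((S.image dt).card : ℝ) ≤ 2 * ⌊D⌋ + 1 := by exact_mod_cast h5
      have := Int.floor_le D
      linarith
    calc (S.card : ℝ) ≤ ((S.image dt).card : ℝ) * T.card := by exact_mod_cast hcardS
      _ ≤ _ := by
        have : (2 * D + 1) * (T.card : ℝ) = (2 * (2 * ((m : ℤ) : ℝ) * τ + L * |((m : ℤ) : ℝ) * ϑ - z|) + 1) * T.card := by
          rw [hD, hu0]; push_cast; ring
        rw [← this]; gcongr
end VMVT

namespace VMVT
open Finset

def Hsep (B q : ℝ) : Prop := ∀ n : ℤ, 1 ≤ n → ∀ τ, NI (n * B) τ → q ≤ 12 * n ∨ 1 ≤ 2 * q * τ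

lemma hsep_of {α : ℝ} {a : ℤ} {q : ℕ} (hq : 0 < q) (hg : Int.gcd a q = 1)
    (hα : |α - (a : ℝ) / q| ≤ ((q : ℝ) ^ 2)⁻¹) (c : ℕ) (hc : 1 ≤ c) (hc6 : c ≤ 6) :
    Hsep (c * α) q := by
  intro n hn τ hN
  have hq' : (0 : ℝ) < q := by exact_mod_cast hq
  by_cases h : (q : ℝ) ≤ 12 * n
  · exact Or.inl h
  · right
    push Not at h
    have h1 : 12 * n < q := by exact_mod_cast h
    obtain ⟨z, hz⟩ := hN
    have hcn : (0:ℤ) < c * n := by positivity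
    have hcn2 : (c : ℤ) * n ≤ 6 * n := by
      have : (c : ℤ) ≤ 6 := by exact_mod_cast hc6
      nlinarith
    have := sep hq hg hα (c * n) hcn.ne' (by rw [abs_of_pos hcn]; omega) z
    have e : (((c * n : ℤ) : ℝ) * α - z) = n * (c * α) - z := by push_cast; ring
    rw [e] at this
    have := this.trans hz
    rw [div_le_iff₀ (by positivity)] at this
    linarith

lemma arith1 {m τ L u F : ℝ} (hF : 1 ≤ F) (hτ : 0 ≤ τ) (hL : 0 ≤ L) (h1 : (F - 1) * m ≤ L)
    (h2 : m ≤ L) (h3 : (F - 1) * u ≤ 2 * τ) (h4 : u ≤ 2 * τ) :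
    (2 * m * τ + L * u) * F ≤ 8 * τ * L := by
  have a1 : F * m ≤ 2 * L := by linarith
  have a2 : F * u ≤ 4 * τ := by linarith
  have a3 := mul_le_mul_of_nonneg_right a1 hτ
  have a4 := mul_le_mul_of_nonneg_right a2 hL
  nlinarith

lemma lat_sep {B q : ℝ} (hq : 0 < q) (hB : Hsep B q) (n0 : ℤ) (hn0 : 1 ≤ n0) (τ L : ℝ) (hτ : 0 ≤ τ)
    (hL : 0 ≤ L) (S : Finset ℤ) (hS : ∀ l ∈ S, 1 ≤ l ∧ (l : ℝ) ≤ L) (hN : ∀ l ∈ S, NI (l * (n0 * B)) τ) :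
    (S.card : ℝ) ≤ 16 * τ * L + 1 + 12 * L * n0 / q + 4 * q * τ := by
  have hn0' : (1 : ℝ) ≤ n0 := by exact_mod_cast hn0
  rcases S.eq_empty_or_nonempty with rfl | hne
  · simp; positivity
  have h0 : (0 : ℤ) ∉ S := fun h => by have := (hS 0 h).1; omega
  have hc : (insert 0 S).card = S.card + 1 := card_insert_of_notMem h0
  obtain ⟨m, z, F, hm, hmL, hu, hF, hFm, hFu, -, -, hcard⟩ := lat_count (n0 * B) 0 τ L 0 (insert 0 S) (by
    intro l hl
    rcases mem_insert.1 hl with rfl | hl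
    · simpa using hL
    · have := hS l hl
      have : (1 : ℝ) ≤ l := by exact_mod_cast this.1
      constructor <;> linarith) (by
    intro l hl
    rcases mem_insert.1 hl with rfl | hl
    · exact ⟨0, by simpa using hτ⟩
    · rw [add_zero]; exact hN l hl) (by have := hne.card_pos; omega)
  have hF' : (1 : ℝ) ≤ F := by exact_mod_cast hF
  have hm' : (1 : ℝ) ≤ m := by exact_mod_cast hm
  have h1 := arith1 hF' hτ hL hFm hmL hFu hu
  rw [hc] at hcard
  push_cast at hcard
  have h2 : (F : ℝ) - 1 ≤ 12 * L * n0 / q + 4 * q * τ := by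
    rcases hF'.eq_or_lt with h | h
    · rw [← h]; simp; positivity
    have hpos : 0 < (F : ℝ) - 1 := by linarith
    have hNI : NI (((m * n0 : ℤ) : ℝ) * B) (2 * τ / (F - 1)) := by
      refine ⟨z, ?_⟩
      rw [le_div_iff₀ hpos]
      have : ((m * n0 : ℤ) : ℝ) * B - z = m * (n0 * B) - z := by push_cast; ring
      rw [this]; linarith
    rcases hB (m * n0) (by nlinarith) _ hNI with h3 | h3
    · have : (F : ℝ) - 1 ≤ 12 * L * n0 / q := by
        rw [le_div_iff₀ hq]
        push_cast at h3
        calc ((F : ℝ) - 1) * q ≤ (F - 1) * (12 * (m * n0)) := by gcongr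
          _ = 12 * ((F - 1) * m) * n0 := by ring
          _ ≤ _ := by gcongr
      have : 0 ≤ 4 * q * τ := by positivity
      linarith
    · have : (F : ℝ) - 1 ≤ 4 * q * τ := by
        rw [← mul_div_assoc, le_div_iff₀ hpos] at h3
        linarith
      have : 0 ≤ 12 * L * n0 / q := by positivity
      linarith
  nlinarith

lemma step1 (N : ℕ) (hN : 1 ≤ N) (A B : ℝ) (h : ℤ) (hh : 1 ≤ h) (W : Finset ℤ)
    (hW : ∀ w ∈ W, (0 : ℝ) ≤ w ∧ (w : ℝ) ≤ 3 * N) (hWN : ∀ w ∈ W, NI (h * (A * w + B)) (1 / N)) (t : ℝ)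
    (ht : 256 ≤ t) (htW : t ≤ W.card) :
    ∃ m : ℤ, 1 ≤ m ∧ m * t ≤ 4 * N ∧ NI ((h * m : ℤ) * A) (8 / (N * t)) ∧ NI ((h * m : ℤ) * B) (12 / t) ∧
      ∀ l : ℤ, 1 ≤ l → NI (l * (h * A)) (2 / N) → m ≤ l := by
  have hN' : (1 : ℝ) ≤ N := by exact_mod_cast hN
  have hWc : 2 ≤ W.card := by
    have : (2 : ℝ) ≤ W.card := by linarith
    exact_mod_cast this
  obtain ⟨m, z, F, hm, hmL, hu, hF, hFm, hFu, hmin, -, hcard⟩ := lat_count (h * A) (h * B) (1 / N) (3 * N) 0 W (by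
    intro l hl; simpa using hW l hl) (by
    intro l hl
    have := hWN l hl
    rwa [show (h : ℝ) * (A * l + B) = l * (h * A) + h * B by ring] at this) hWc
  have hF' : (1 : ℝ) ≤ F := by exact_mod_cast hF
  have hm' : (1 : ℝ) ≤ m := by exact_mod_cast hm
  have h1 := arith1 hF' (by positivity) (by positivity) hFm hmL hFu hu
  have h2 : 8 * (1 / (N : ℝ)) * (3 * N) = 24 := by field_simp; norm_num
  rw [h2] at h1
  have hFt : 3 / 4 * t ≤ (F : ℝ) - 1 := by nlinarith
  have ht0 : 0 < t := by linarith
  have hmt : m * t ≤ 4 * N := by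
    have : 3 / 4 * t * m ≤ (F - 1) * m := by gcongr
    linarith
  have hut : |m * (h * A) - z| ≤ 8 / 3 / (N * t) := by
    rw [le_div_iff₀ (by positivity)]
    have : 3 / 4 * t * |m * (h * A) - z| ≤ 2 * (1 / N) := le_trans (by gcongr) hFu
    have h3 : N * (3 / 4 * t * |m * (h * A) - z|) ≤ N * (2 * (1 / N)) := by gcongr
    have h4 : (N : ℝ) * (2 * (1 / N)) = 2 := by field_simp
    nlinarith
  have hNA : NI ((h * m : ℤ) * A) (8 / 3 / (N * t)) := ⟨z, by
    rw [show ((h * m : ℤ) : ℝ) * A = m * (h * A) by push_cast; ring]; exact hut⟩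
  refine ⟨m, hm, hmt, hNA.mono (by gcongr; norm_num), ?_, ?_⟩
  · obtain ⟨w, hw⟩ := card_pos.1 (show 0 < W.card by omega)
    have a1 := (hWN w hw).mul m
    have a2 := hNA.mul w
    have a3 := a1.sub a2
    rw [show (m : ℝ) * (h * (A * w + B)) - w * ((h * m : ℤ) * A) = (h * m : ℤ) * B by push_cast; ring] at a3
    refine a3.mono ?_
    have hw3 := hW w hw
    rw [abs_of_nonneg (by linarith : (0:ℝ) ≤ m), abs_of_nonneg hw3.1]
    have b1 : (m : ℝ) * (1 / N) ≤ 4 / t := by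
      rw [mul_one_div, div_le_div_iff₀ (by positivity) ht0]; exact hmt
    have b2 : (w : ℝ) * (8 / 3 / (N * t)) ≤ 8 / t := by
      calc (w : ℝ) * (8 / 3 / (N * t)) ≤ (3 * N) * (8 / 3 / (N * t)) := by gcongr; exact hw3.2
        _ = 8 / t := by field_simp
    have b3 : 4 / t + 8 / t = 12 / t := by ring
    linarith
  · intro l hl hN; exact hmin l hl (hN.mono (by rw [mul_one_div]))

def Eprop (N : ℕ) (A B t : ℝ) (n : ℤ) : Prop := ∃ h m : ℤ, n = h * m ∧ 1 ≤ h ∧ h ≤ N ∧ 1 ≤ m ∧ m * t ≤ 4 * N ∧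
  NI (n * A) (8 / (N * t)) ∧ NI (n * B) (12 / t) ∧ ∀ l : ℤ, 1 ≤ l → NI (l * (h * A)) (2 / N) → m ≤ l

lemma Eprop.range {N : ℕ} {A B t : ℝ} {n : ℤ} (ht : 0 < t) (h : Eprop N A B t n) :
    1 ≤ n ∧ (n : ℝ) ≤ 4 * N ^ 2 / t := by
  obtain ⟨h, m, rfl, h1, h2, h3, h4, -⟩ := h
  refine ⟨by nlinarith, ?_⟩
  rw [le_div_iff₀ ht]
  have h2' : (h : ℝ) ≤ N := by exact_mod_cast h2
  have h1' : (1 : ℝ) ≤ h := by exact_mod_cast h1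
  have h3' : (1 : ℝ) ≤ m := by exact_mod_cast h3
  push_cast
  calc (h : ℝ) * m * t = h * (m * t) := by ring
    _ ≤ N * (4 * N) := by gcongr
    _ = _ := by ring

lemma step2a (N : ℕ) (hN : 1 ≤ N) (A B q t : ℝ) (hq : 0 < q) (ht : 1 ≤ t) (htN : t ≤ 4 * N) (hA : Hsep A q)
    (E : Finset ℤ) (hE : ∀ n ∈ E, Eprop N A B t n) :
    t * E.card ≤ 1000 * (N + N ^ 2 / q + q / N) := by
  have hN' : (1 : ℝ) ≤ N := by exact_mod_cast hN
  have ht0 : 0 < t := by linarith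
  have := lat_sep hq hA 1 le_rfl (8 / (N * t)) (4 * N ^ 2 / t) (by positivity) (by positivity) E
    (fun l hl => (hE l hl).range ht0) (fun l hl => by
      obtain ⟨h, m, -, -, -, -, -, h1, -⟩ := hE l hl
      simpa using h1)
  calc t * E.card ≤ t * (16 * (8 / (N * t)) * (4 * N ^ 2 / t) + 1 + 12 * (4 * N ^ 2 / t) * ((1 : ℤ) : ℝ) / q + 4 * q * (8 / (N * t))) := by
        gcongr
    _ = 512 * N / t + t + 48 * (N ^ 2 / q) + 32 * (q / N) := by
        push_cast; field_simp; ring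
    _ ≤ 512 * N / 1 + 4 * N + 48 * (N ^ 2 / q) + 32 * (q / N) := by gcongr
    _ ≤ _ := by
      have : 0 ≤ N ^ 2 / q := by positivity
      have : 0 ≤ q / N := by positivity
      linarith

lemma step2b (N : ℕ) (hN : 1 ≤ N) (A B q t : ℝ) (hq : 0 < q) (ht : 1 ≤ t) (htN : t ≤ 4 * N) (hB : Hsep B q)
    (E : Finset ℤ) (hE : ∀ n ∈ E, Eprop N A B t n) :
    t * E.card ≤ 1000 * (N + N ^ 2 / q + q) := by
  have hN' : (1 : ℝ) ≤ N := by exact_mod_cast hN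
  have ht0 : 0 < t := by linarith
  have hX : 0 ≤ N ^ 2 / q := by positivity
  rcases E.eq_empty_or_nonempty with rfl | hne
  · simp; positivity
  have h0 : (0 : ℤ) ∉ E := fun h => by have := ((hE 0 h).range ht0).1; omega
  have hc : (insert 0 E).card = E.card + 1 := card_insert_of_notMem h0
  set τ : ℝ := 8 / (N * t) with hτdef
  set L : ℝ := 4 * N ^ 2 / t with hLdef
  have hτ : 0 ≤ τ := by positivity
  have hL : 0 ≤ L := by positivity
  have hτL : τ * L = 32 * N / t ^ 2 := by rw [hτdef, hLdef]; field_simp; norm_num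
  have hEA : ∀ l ∈ E, NI (l * A) τ := fun l hl => by
    obtain ⟨h, m, -, -, -, -, -, h1, -⟩ := hE l hl
    exact h1
  obtain ⟨m0, z, F, hm, hmL, hu, hF, hFm, hFu, hmin, hdis, hcard⟩ := lat_count A 0 τ L 0 (insert 0 E) (by
    intro l hl
    rcases mem_insert.1 hl with rfl | hl
    · simpa using hL
    · have := (hE l hl).range ht0
      have : (1 : ℝ) ≤ l := by exact_mod_cast this.1
      constructor <;> linarith) (by
    intro l hl
    rcases mem_insert.1 hl with rfl | hl
    · exact ⟨0, by simpa using hτ⟩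
    · rw [add_zero]; exact hEA l hl) (by have := hne.card_pos; omega)
  have hF' : (1 : ℝ) ≤ F := by exact_mod_cast hF
  have hm' : (1 : ℝ) ≤ m0 := by exact_mod_cast hm
  have h1 := arith1 hF' hτ hL hFm hmL hFu hu
  rw [hc] at hcard hdis
  push_cast at hcard hdis
  by_cases hD : 1 ≤ 2 * m0 * τ + L * |m0 * A - z|
  · have h3 : (E.card : ℝ) ≤ 24 * (τ * L) := by nlinarith
    rw [hτL] at h3
    calc t * E.card ≤ t * (24 * (32 * N / t ^ 2)) := by gcongr
      _ = 768 * N / t := by field_simp; norm_num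
      _ ≤ 768 * N / 1 := by gcongr
      _ ≤ _ := by linarith
  have hcF : (E.card : ℝ) + 1 ≤ F := hdis.resolve_right hD
  push Not at hD
  by_cases hF8 : ((F : ℝ) - 1) * t ≤ 8 * N
  · have : t * E.card ≤ t * (F - 1) := by gcongr; linarith
    linarith
  push Not at hF8
  -- small u0
  have hu0 : |m0 * A - z| * N ≤ 2 / N := by
    have hpos : 0 < (F : ℝ) - 1 := by
      by_contra hcon; push Not at hcon
      have : ((F : ℝ) - 1) * t ≤ 0 := mul_nonpos_of_nonpos_of_nonneg hcon ht0.le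
      linarith
    have a1 : (((F : ℝ) - 1) * t) * |m0 * A - z| ≤ 16 / N := by
      have : t * (((F : ℝ) - 1) * |m0 * A - z|) ≤ t * (2 * τ) := by gcongr
      have e : t * (2 * τ) = 16 / N := by rw [hτdef]; field_simp; norm_num
      linarith
    have a2 : 8 * N * |m0 * A - z| ≤ (((F : ℝ) - 1) * t) * |m0 * A - z| := by gcongr
    have e : (16 : ℝ) / N = 8 * (2 / N) := by ring
    rw [e] at a1
    linarith
  have hdvd : ∀ n ∈ E, m0 ∣ n := by
    intro n hn
    obtain ⟨zn, hzn⟩ := hEA n hn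
    have hr := (hE n hn).range ht0
    have hn1 : (1 : ℝ) ≤ n := by exact_mod_cast hr.1
    have hint : n * z - m0 * zn = 0 := by
      have : |((n * z - m0 * zn : ℤ) : ℝ)| < 1 := by
        have e : ((n * z - m0 * zn : ℤ) : ℝ) = m0 * (n * A - zn) - n * (m0 * A - z) := by push_cast; ring
        rw [e]
        refine lt_of_le_of_lt (abs_sub _ _) (lt_of_le_of_lt ?_ hD)
        rw [abs_mul, abs_mul, abs_of_nonneg (by linarith : (0:ℝ) ≤ m0), abs_of_nonneg (by linarith : (0:ℝ) ≤ n)]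
        have b1 : (m0 : ℝ) * |n * A - zn| ≤ m0 * τ := by gcongr
        have b2 : (n : ℝ) * |m0 * A - z| ≤ L * |m0 * A - z| := by gcongr; exact hr.2
        have b3 : 0 ≤ m0 * τ := by positivity
        linarith
      exact Int.abs_lt_one_iff.1 (by exact_mod_cast this)
    have hrn : 0 ≤ n % m0 := Int.emod_nonneg _ (by omega)
    have hrm : n % m0 < m0 := Int.emod_lt_of_pos _ (by omega)
    rw [Int.dvd_iff_emod_eq_zero]
    by_contra hne0
    have hkey : NI (((n % m0 : ℤ) : ℝ) * A) (2 * τ) := by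
      refine ⟨zn - (n / m0) * z, ?_⟩
      have hdm : (n : ℝ) = m0 * ((n / m0 : ℤ) : ℝ) + ((n % m0 : ℤ) : ℝ) := by
        exact_mod_cast (Int.mul_ediv_add_emod n m0).symm
      have hint' : (n : ℝ) * z = m0 * zn := by
        have : n * z = m0 * zn := by linarith
        exact_mod_cast this
      set r : ℝ := ((n % m0 : ℤ) : ℝ) with hrdef
      have hr0 : 0 ≤ r := by rw [hrdef]; exact_mod_cast hrn
      have hr1 : r ≤ m0 := by rw [hrdef]; exact_mod_cast hrm.le
      set k : ℝ := ((n / m0 : ℤ) : ℝ) with hkdef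
      have e : (m0 : ℝ) * (r * A - ((zn - (n / m0) * z : ℤ) : ℝ)) = r * (m0 * A - z) := by
        push_cast
        have : r = n - m0 * k := by linarith
        rw [← hkdef, this]
        linear_combination hint'
      have e2 : m0 * |r * A - ((zn - (n / m0) * z : ℤ) : ℝ)| ≤ m0 * (2 * τ) := by
        rw [← abs_of_nonneg (by linarith : (0:ℝ) ≤ m0), ← abs_mul, abs_of_nonneg (by linarith : (0:ℝ) ≤ m0), e, abs_mul,
          abs_of_nonneg hr0]
        gcongr
      exact le_of_mul_le_mul_left e2 (by linarith)
    have := hmin _ (by omega) hkey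
    omega
  have hlN : ∀ n ∈ E, 1 ≤ n / m0 ∧ n / m0 ≤ N := by
    intro n hn
    have hr := (hE n hn).range ht0
    obtain ⟨l, hl⟩ := hdvd n hn
    have hll : n / m0 = l := by rw [hl]; exact Int.mul_ediv_cancel_left _ (by omega)
    obtain ⟨h, m, hnm, hh1, hhN, hm1, hmt, -, -, hmin2⟩ := hE n hn
    have hmm : m ≤ m0 := by
      refine hmin2 m0 hm ⟨h * z, ?_⟩
      have e : (m0 : ℝ) * (h * A) - ((h * z : ℤ) : ℝ) = h * (m0 * A - z) := by push_cast; ring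
      have hh1' : (1 : ℝ) ≤ h := by exact_mod_cast hh1
      rw [e, abs_mul, abs_of_nonneg (by linarith)]
      refine le_trans ?_ hu0
      rw [mul_comm]
      gcongr
      exact_mod_cast hhN
    rw [hll]
    constructor
    · have : 0 < m0 * l := by rw [← hl]; omega
      have := pos_of_mul_pos_right this (by omega)
      omega
    · have h5 : m0 * l ≤ m0 * h := by
        rw [← hl, hnm, mul_comm]; exact mul_le_mul_of_nonneg_right hmm (by omega)
      have := le_of_mul_le_mul_left h5 (by omega)
      omega
  have hinj : (E.image (fun n => n / m0)).card = E.card := by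
    refine card_image_of_injOn ?_
    intro x hx y hy hxy
    simp only at hxy
    rw [← Int.ediv_mul_cancel (hdvd x hx), ← Int.ediv_mul_cancel (hdvd y hy), hxy]
  have hfin := lat_sep hq hB m0 hm (12 / t) (min (N : ℝ) (L / m0)) (by positivity) (by positivity)
    (E.image (fun n => n / m0)) (by
      intro l hl
      obtain ⟨n, hn, rfl⟩ := mem_image.1 hl
      refine ⟨(hlN n hn).1, le_min (by exact_mod_cast (hlN n hn).2) ?_⟩
      rw [le_div_iff₀ (by linarith)]
      refine le_trans (le_of_eq ?_) ((hE n hn).range ht0).2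
      exact_mod_cast Int.ediv_mul_cancel (hdvd n hn)) (by
      intro l hl
      obtain ⟨n, hn, rfl⟩ := mem_image.1 hl
      obtain ⟨h, m, -, -, -, -, -, -, h1, -⟩ := hE n hn
      have e : (((n / m0 : ℤ) : ℝ) * (m0 * B)) = n * B := by
        rw [← mul_assoc]; congr 1
        exact_mod_cast Int.ediv_mul_cancel (hdvd n hn)
      simp only [e]
      exact h1)
  rw [hinj] at hfin
  have c1 : 16 * (12 / t) * min (N : ℝ) (L / m0) ≤ 192 * N / t := by
    calc 16 * (12 / t) * min (N : ℝ) (L / m0) ≤ 16 * (12 / t) * N := by gcongr; exact min_le_left _ _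
      _ = _ := by ring
  have c2 : 12 * min (N : ℝ) (L / m0) * m0 / q ≤ 48 * (N ^ 2 / q) / t := by
    calc 12 * min (N : ℝ) (L / m0) * m0 / q ≤ 12 * (L / m0) * m0 / q := by gcongr; exact min_le_right _ _
      _ = _ := by rw [hLdef]; field_simp; norm_num
  have c3 : (E.card : ℝ) ≤ 192 * N / t + 1 + 48 * (N ^ 2 / q) / t + 48 * q / t := by
    have : 4 * q * (12 / t) = 48 * q / t := by ring
    linarith
  calc t * E.card ≤ t * (192 * N / t + 1 + 48 * (N ^ 2 / q) / t + 48 * q / t) := by gcongr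
    _ = 192 * N + t + 48 * (N ^ 2 / q) + 48 * q := by field_simp
    _ ≤ _ := by linarith
end VMVT

namespace VMVT
open Finset

noncomputable def Hn (n : ℕ) : ℝ := ∑ t ∈ range n, 1 / ((t : ℝ) + 1)

lemma Hn_nonneg (n : ℕ) : 0 ≤ Hn n := sum_nonneg fun _ _ => by positivity

lemma Hn_le (n : ℕ) : Hn n ≤ 1 + Real.log n := by
  have := harmonic_le_one_add_log n
  refine le_trans (le_of_eq ?_) this
  unfold Hn harmonic; push_cast; simp

lemma harm (ε : ℝ) (hε : 0 < ε) : ∃ C : ℝ, 1 ≤ C ∧ ∀ n : ℕ, 1 ≤ n → Hn n ≤ C * (n : ℝ) ^ ε := by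
  refine ⟨1 + 1 / ε, by have : 0 < 1 / ε := by positivity
                        linarith, fun n hn => ?_⟩
  have hn' : (1 : ℝ) ≤ n := by exact_mod_cast hn
  refine (Hn_le n).trans ?_
  have h1 := Real.log_le_rpow_div (x := n) (by linarith) hε
  have h2 : 1 ≤ (n : ℝ) ^ ε := Real.one_le_rpow hn' hε.le
  calc 1 + Real.log n ≤ (n : ℝ) ^ ε + (n : ℝ) ^ ε / ε := by linarith
    _ = _ := by ring

lemma Ht_bound (ε : ℝ) (hε : 0 < ε) : ∃ C : ℝ, 1 ≤ C ∧ ∀ (N : ℕ) (A B M t : ℝ), 1 ≤ N → 256 ≤ t → 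
    (∀ E : Finset ℤ, (∀ n ∈ E, Eprop N A B t n) → t * E.card ≤ M) → ∀ H : Finset ℤ,
    (∀ h ∈ H, 1 ≤ h ∧ h ≤ N ∧ ∃ W : Finset ℤ, (∀ w ∈ W, (0 : ℝ) ≤ w ∧ (w : ℝ) ≤ 3 * N) ∧
      (∀ w ∈ W, NI (h * (A * w + B)) (1 / N)) ∧ t ≤ W.card) →
    t * H.card ≤ C * (N : ℝ) ^ ε * M := by
  obtain ⟨C, hC1, hC⟩ := div_bound (ε / 2) (by positivity)
  refine ⟨C * 4 ^ (ε / 2), by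
    have := Real.one_le_rpow (x := 4) (by norm_num) (half_pos hε).le
    nlinarith, ?_⟩
  intro N A B M t hN ht hM H hH
  have hN' : (1 : ℝ) ≤ N := by exact_mod_cast hN
  have h1 : ∀ h ∈ H, ∃ m : ℤ, Eprop N A B t (h * m) := by
    intro h hh
    obtain ⟨a1, a2, W, a3, a4, a5⟩ := hH h hh
    obtain ⟨m, b1, b2, b3, b4, b5⟩ := step1 N hN A B h a1 W a3 a4 t ht a5
    exact ⟨m, h, m, rfl, a1, a2, b1, b2, b3, b4, b5⟩
  choose! m hm using h1
  have hE := hM (H.image (fun h => h * m h)) (by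
    intro n hn
    obtain ⟨h, hh, rfl⟩ := mem_image.1 hn
    exact hm h hh)
  have ht0 : 0 < t := by linarith
  set K : ℕ := ⌊C * (4 * (N : ℝ) ^ 2) ^ (ε / 2)⌋₊
  have hcard : H.card ≤ K * (H.image (fun h => h * m h)).card := by
    refine card_le_mul_card_image H K ?_
    intro n hn
    obtain ⟨h0, hh0, hn0⟩ := mem_image.1 hn
    have hr := (hm h0 hh0).range ht0
    rw [hn0] at hr
    have hnat : ((n.toNat : ℕ) : ℤ) = n := Int.toNat_of_nonneg (by omega)
    have hc : (H.filter (fun h => h * m h = n)).card ≤ n.toNat.divisors.card := by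
      refine card_le_card_of_injOn (fun h => h.toNat) ?_ ?_
      · intro h hh
        have hh := mem_filter.1 hh
        have hh1 := (hH h hh.1).1
        simp only [mem_coe, Nat.mem_divisors]
        refine ⟨?_, by omega⟩
        rw [← Int.natCast_dvd_natCast, hnat, Int.toNat_of_nonneg (by omega)]
        exact ⟨m h, hh.2.symm⟩
      · intro h hh h' hh' he
        have a1 := (hH h (mem_filter.1 hh).1).1
        have a2 := (hH h' (mem_filter.1 hh').1).1
        simp only at he
        omega
    refine hc.trans (Nat.le_floor ?_)
    refine (hC _ (by omega)).trans ?_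
    have : ((n.toNat : ℕ) : ℝ) ≤ 4 * N ^ 2 := by
      have e : ((n.toNat : ℕ) : ℝ) = n := by exact_mod_cast hnat
      rw [e]
      refine hr.2.trans (div_le_self (by positivity) (by linarith))
    gcongr
  have hK : (K : ℝ) ≤ C * 4 ^ (ε / 2) * (N : ℝ) ^ ε := by
    refine (Nat.floor_le (by positivity)).trans (le_of_eq ?_)
    rw [Real.mul_rpow (by norm_num) (by positivity), ← Real.rpow_natCast, ← Real.rpow_mul (by positivity), mul_assoc]
    congr 3; push_cast; ring
  calc t * H.card ≤ t * (K * (H.image (fun h => h * m h)).card) := by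
        gcongr; exact_mod_cast hcard
    _ = K * (t * (H.image (fun h => h * m h)).card) := by ring
    _ ≤ K * M := by gcongr
    _ ≤ _ := by
      have : 0 ≤ M := le_trans (by positivity) hE
      gcongr

open Classical in
noncomputable def Wset (N : ℕ) (A B : ℝ) (h : ℤ) : Finset ℤ :=
  (Icc (0 : ℤ) (3 * N)).filter (fun w => NI (h * (A * w + B)) (1 / N))

lemma mem_Wset {N : ℕ} {A B : ℝ} {h w : ℤ} : w ∈ Wset N A B h ↔
    (0 ≤ w ∧ w ≤ 3 * N) ∧ NI (h * (A * w + B)) (1 / N) := by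
  simp [Wset]

lemma Wset_card (N : ℕ) (hN : 1 ≤ N) (A B : ℝ) (h : ℤ) : (Wset N A B h).card ≤ 4 * N := by
  have : Wset N A B h ⊆ Icc (0 : ℤ) (3 * N) := fun w hw => mem_Icc.2 (mem_Wset.1 hw).1
  refine (card_le_card this).trans ?_
  rw [Int.card_Icc]; omega

lemma Z_bound (ε : ℝ) (hε : 0 < ε) : ∃ C : ℝ, 1 ≤ C ∧ ∀ (N : ℕ) (A B M : ℝ), 1 ≤ N → 0 ≤ M →
    (∀ t : ℝ, 1 ≤ t → t ≤ 4 * N → ∀ E : Finset ℤ, (∀ n ∈ E, Eprop N A B t n) → t * E.card ≤ M) →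
    (∑ h ∈ Icc (1 : ℤ) N, ((Wset N A B h).card : ℝ)) ≤ C * (N : ℝ) ^ ε * (N + M) := by
  obtain ⟨C1, hC11, hC1⟩ := Ht_bound (ε / 2) (by positivity)
  obtain ⟨C2, hC21, hC2⟩ := harm (ε / 2) (by positivity)
  have h4 : (1 : ℝ) ≤ 4 ^ (ε / 2) := Real.one_le_rpow (by norm_num) (half_pos hε).le
  refine ⟨256 + C1 * C2 * 4 ^ (ε / 2), by
    have : 0 ≤ C1 * C2 * 4 ^ (ε / 2) := by positivity
    linarith, ?_⟩
  intro N A B M hN hM0 hM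
  obtain ⟨T0, hT0⟩ : ∃ T0 : ℕ, T0 = 256 := ⟨256, rfl⟩
  have hN' : (1 : ℝ) ≤ N := by exact_mod_cast hN
  have layer : ∀ s : ℕ, s ≤ 4 * N → s ≤ T0 + ∑ t ∈ Ico T0 (4 * N + 1), (if t ≤ s then 1 else 0) := by
    intro s hs
    rw [← sum_filter, sum_const, smul_eq_mul, mul_one]
    have : Ico T0 (s + 1) ⊆ (Ico T0 (4 * N + 1)).filter (fun t => t ≤ s) := by
      intro t ht
      simp only [mem_filter, mem_Ico] at ht ⊢
      omega
    have := card_le_card this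
    rw [Nat.card_Ico] at this
    omega
  have h1 : ∑ h ∈ Icc (1 : ℤ) N, (Wset N A B h).card ≤
      T0 * N + ∑ t ∈ Ico T0 (4 * N + 1), ((Icc (1 : ℤ) N).filter (fun h => t ≤ (Wset N A B h).card)).card := by
    calc _ ≤ ∑ h ∈ Icc (1 : ℤ) N, (T0 + ∑ t ∈ Ico T0 (4 * N + 1), (if t ≤ (Wset N A B h).card then 1 else 0)) :=
          sum_le_sum fun h _ => layer _ (Wset_card N hN A B h)
      _ = _ := by
        rw [sum_add_distrib, sum_const, Int.card_Icc, sum_comm, smul_eq_mul]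
        congr 1
        · rw [mul_comm]; congr 1; omega
        · refine sum_congr rfl fun t _ => ?_
          rw [card_filter]
  have h2 : ∀ t ∈ Ico T0 (4 * N + 1), (((Icc (1 : ℤ) N).filter (fun h => t ≤ (Wset N A B h).card)).card : ℝ) ≤
      C1 * (N : ℝ) ^ (ε / 2) * M * (1 / t) := by
    intro t ht
    rw [mem_Ico] at ht
    have ht1 : (256 : ℝ) ≤ t := by rw [hT0] at ht; exact_mod_cast ht.1
    have ht2 : (t : ℝ) ≤ 4 * N := by
      have : t ≤ 4 * N := by omega
      exact_mod_cast this
    have := hC1 N A B M t hN ht1 (hM t (by linarith) ht2) ((Icc (1 : ℤ) N).filter (fun h => t ≤ (Wset N A B h).card)) (by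
      intro h hh
      simp only [mem_filter, mem_Icc] at hh
      refine ⟨hh.1.1, hh.1.2, Wset N A B h, ?_, ?_, by exact_mod_cast hh.2⟩
      · intro w hw
        have := (mem_Wset.1 hw).1
        constructor
        · exact_mod_cast this.1
        · exact_mod_cast this.2
      · intro w hw
        exact (mem_Wset.1 hw).2)
    rw [mul_one_div, le_div_iff₀ (by linarith)]
    linarith
  have h3 : ∑ t ∈ Ico T0 (4 * N + 1), (1 / (t : ℝ)) ≤ C2 * 4 ^ (ε / 2) * (N : ℝ) ^ (ε / 2) := by
    calc ∑ t ∈ Ico T0 (4 * N + 1), (1 / (t : ℝ)) ≤ ∑ t ∈ Ico 1 (4 * N + 1), (1 / (t : ℝ)) := by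
          refine sum_le_sum_of_subset_of_nonneg ?_ (fun _ _ _ => by positivity)
          exact Ico_subset_Ico (by omega) le_rfl
      _ = Hn (4 * N) := by
          rw [sum_Ico_eq_sum_range, Hn]
          refine sum_congr (by congr 1) fun t _ => ?_
          push_cast; rw [add_comm]
      _ ≤ C2 * ((4 * N : ℕ) : ℝ) ^ (ε / 2) := hC2 _ (by omega)
      _ = _ := by push_cast; rw [Real.mul_rpow (by norm_num) (by positivity)]; ring
  have hX : (N : ℝ) ^ (ε / 2) * (N : ℝ) ^ (ε / 2) = (N : ℝ) ^ ε := by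
    rw [← Real.rpow_add (by linarith)]; congr 1; ring
  have hX1 : 1 ≤ (N : ℝ) ^ ε := Real.one_le_rpow hN' hε.le
  calc (∑ h ∈ Icc (1 : ℤ) N, ((Wset N A B h).card : ℝ)) ≤ 256 * N + ∑ t ∈ Ico T0 (4 * N + 1),
        (((Icc (1 : ℤ) N).filter (fun h => t ≤ (Wset N A B h).card)).card : ℝ) := by
        have hT : (T0 : ℝ) = 256 := by rw [hT0]; norm_num
        rw [← hT]; exact_mod_cast h1
    _ ≤ 256 * N + ∑ t ∈ Ico T0 (4 * N + 1), C1 * (N : ℝ) ^ (ε / 2) * M * (1 / t) := by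
        gcongr with t ht; exact h2 t ht
    _ = 256 * N + C1 * (N : ℝ) ^ (ε / 2) * M * ∑ t ∈ Ico T0 (4 * N + 1), (1 / (t : ℝ)) := by rw [mul_sum]
    _ ≤ 256 * N + C1 * (N : ℝ) ^ (ε / 2) * M * (C2 * 4 ^ (ε / 2) * (N : ℝ) ^ (ε / 2)) := by gcongr
    _ = 256 * N + C1 * C2 * 4 ^ (ε / 2) * M * ((N : ℝ) ^ (ε / 2) * (N : ℝ) ^ (ε / 2)) := by ring
    _ ≤ (256 + C1 * C2 * 4 ^ (ε / 2)) * (N : ℝ) ^ ε * (N + M) := by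
      rw [hX]
      have hP : 0 ≤ C1 * C2 * 4 ^ (ε / 2) := by positivity
      set P := C1 * C2 * 4 ^ (ε / 2)
      set Y := (N : ℝ) ^ ε
      have e : (256 + P) * Y * (N + M) - (256 * N + P * M * Y) = 256 * N * (Y - 1) + 256 * Y * M + P * Y * N := by ring
      have : 0 ≤ 256 * N * (Y - 1) := mul_nonneg (by positivity) (by linarith)
      have : 0 ≤ 256 * Y * M + P * Y * N := by positivity
      linarith
end VMVT

namespace VMVT
open Finset

noncomputable def GI (N : ℕ) (ψ : ℝ) : ℕ := ⌊(N : ℝ) * Int.fract ψ⌋₊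

lemma GI_lt (N : ℕ) (hN : 1 ≤ N) (ψ : ℝ) : GI N ψ < N := by
  have hN' : (1 : ℝ) ≤ N := by exact_mod_cast hN
  unfold GI
  rw [Nat.floor_lt (by have := Int.fract_nonneg ψ; positivity)]
  have := Int.fract_lt_one ψ
  nlinarith

noncomputable def Gw (N : ℕ) (i : ℕ) : ℝ := 2 * N * (1 / ((i : ℝ) + 1) + 1 / ((N : ℝ) - i))

lemma Gw_nonneg (N i : ℕ) (h : i < N) : 0 ≤ Gw N i := by
  have : (0 : ℝ) < N - i := by have : (i : ℝ) < N := by exact_mod_cast h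
                               linarith
  unfold Gw; positivity

lemma ee_sub_one_norm (ψ : ℝ) : ‖ee ψ - 1‖ = 2 * |Real.sin (Real.pi * ψ)| := by
  have : ee ψ = Complex.exp (Complex.I * ((2 * Real.pi * ψ : ℝ) : ℂ)) := by
    unfold ee; congr 1; push_cast; ring
  rw [this, Complex.norm_exp_I_mul_ofReal_sub_one, Real.norm_eq_abs, abs_mul, abs_of_pos (by norm_num : (0:ℝ) < 2)]
  congr 3; ring

lemma ee_fract (ψ : ℝ) : ee ψ = ee (Int.fract ψ) := by
  unfold ee
  rw [Complex.exp_eq_exp_iff_exists_int]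
  refine ⟨⌊ψ⌋, ?_⟩
  have : ψ = ⌊ψ⌋ + Int.fract ψ := (Int.floor_add_fract ψ).symm
  have h2 : (ψ : ℂ) = (⌊ψ⌋ : ℂ) + (Int.fract ψ : ℝ) := by exact_mod_cast congrArg (fun x : ℝ => (x : ℂ)) this
  rw [h2]; ring

lemma ee_lower (ψ : ℝ) : ‖ee ψ - 1‖ ≥ 4 * min (Int.fract ψ) (1 - Int.fract ψ) := by
  rw [ee_fract, ee_sub_one_norm]
  set v := Int.fract ψ
  have h0 : 0 ≤ v := Int.fract_nonneg ψ
  have h1 : v < 1 := Int.fract_lt_one ψ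
  have hpi := Real.pi_pos
  rcases le_total v (1 / 2) with h | h
  · have := Real.mul_le_sin (x := Real.pi * v) (by positivity) (by nlinarith)
    have e : 2 / Real.pi * (Real.pi * v) = 2 * v := by field_simp
    rw [e] at this
    have := le_abs_self (Real.sin (Real.pi * v))
    have := min_le_left v (1 - v)
    linarith
  · have := Real.mul_le_sin (x := Real.pi * (1 - v)) (mul_nonneg hpi.le (by linarith)) (by nlinarith)
    have e : 2 / Real.pi * (Real.pi * (1 - v)) = 2 * (1 - v) := by field_simp
    rw [e, show Real.pi * (1 - v) = Real.pi - Real.pi * v by ring, Real.sin_pi_sub] at this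
    have := le_abs_self (Real.sin (Real.pi * v))
    have := min_le_right v (1 - v)
    linarith

lemma ee_natmul (n : ℕ) (ψ : ℝ) : ee (n * ψ) = ee ψ ^ n := by
  unfold ee; rw [← Complex.exp_nat_mul]; congr 1; push_cast; ring

lemma geo (N : ℕ) (hN : 1 ≤ N) (ψ : ℝ) (a b : ℕ) (hab : b ≤ a + N) :
    ‖∑ x ∈ Ico a b, ee (x * ψ)‖ ≤ Gw N (GI N ψ) := by
  have hN' : (1 : ℝ) ≤ N := by exact_mod_cast hN
  set i := GI N ψ with hi
  have hiN : i < N := GI_lt N hN ψ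
  have hiN' : (i : ℝ) + 1 ≤ N := by exact_mod_cast hiN
  have triv : ‖∑ x ∈ Ico a b, ee (x * ψ)‖ ≤ N := by
    refine (norm_sum_le _ _).trans ?_
    simp only [ee_norm, sum_const, Nat.card_Ico, nsmul_eq_mul, mul_one]
    have : b - a ≤ N := by omega
    exact_mod_cast this
  have p1 : 0 < 1 / ((i : ℝ) + 1) := by positivity
  have p2 : 0 < 1 / ((N : ℝ) - i) := one_div_pos.2 (by linarith)
  unfold Gw
  by_cases h0 : i = 0
  · refine triv.trans ?_
    rw [h0] at p2 ⊢
    simp only [Nat.cast_zero, zero_add, div_one]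
    nlinarith
  by_cases h1 : i + 1 = N
  · refine triv.trans ?_
    have : (N : ℝ) - i = 1 := by rw [← h1]; push_cast; ring
    rw [this]
    nlinarith
  have hi1 : (1 : ℝ) ≤ i := by exact_mod_cast Nat.one_le_iff_ne_zero.2 h0
  have hi2 : (i : ℝ) + 2 ≤ N := by
    have : i + 2 ≤ N := by omega
    exact_mod_cast this
  set v := Int.fract ψ with hv
  have v1 : (i : ℝ) ≤ N * v := Nat.floor_le (by have := Int.fract_nonneg ψ; positivity)
  have v2 : N * v < i + 1 := Nat.lt_floor_add_one _
  have hlow := ee_lower ψ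
  rw [← hv] at hlow
  have hsum : ‖∑ x ∈ Ico a b, ee (x * ψ)‖ * ‖ee ψ - 1‖ ≤ 2 := by
    rw [sum_Ico_eq_sum_range]
    have : ∀ x ∈ range (b - a), ee (((a + x : ℕ) : ℝ) * ψ) = ee (a * ψ) * ee ψ ^ x := by
      intro x _
      rw [← ee_natmul, ← ee_add]; congr 1; push_cast; ring
    rw [sum_congr rfl this, ← mul_sum, norm_mul, ee_norm, one_mul, ← norm_mul, geom_sum_mul]
    refine (norm_sub_le _ _).trans ?_
    rw [norm_pow, ee_norm]; norm_num
  set sg := ‖∑ x ∈ Ico a b, ee (x * ψ)‖ with hsg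
  have hsg0 : 0 ≤ sg := norm_nonneg _
  have hm : sg * (4 * min v (1 - v)) ≤ 2 := le_trans (by gcongr) hsum
  rcases le_total v (1 - v) with h | h
  · rw [min_eq_left h] at hm
    have hv0 : 0 < v := by
      by_contra hcon; push Not at hcon; nlinarith
    have : sg * (i + 1) ≤ N := by nlinarith
    have : sg ≤ N * (1 / ((i : ℝ) + 1)) := by rw [mul_one_div, le_div_iff₀ (by positivity)]; exact this
    nlinarith
  · rw [min_eq_right h] at hm
    have hb : (N : ℝ) - i ≤ 2 * (N * (1 - v)) := by nlinarith
    have : sg * (N - i) ≤ N := by nlinarith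
    have : sg ≤ N * (1 / ((N : ℝ) - i)) := by rw [mul_one_div, le_div_iff₀ (by linarith)]; exact this
    nlinarith

lemma Gw_sum (N : ℕ) : ∑ i ∈ range N, Gw N i = 4 * N * Hn N := by
  unfold Gw
  rw [← mul_sum, sum_add_distrib]
  have : ∑ i ∈ range N, 1 / ((N : ℝ) - i) = Hn N := by
    rw [Hn, ← sum_range_reflect]
    refine sum_congr rfl fun i hi => ?_
    have := mem_range.1 hi
    rw [Nat.sub_sub, Nat.cast_sub (by omega)]
    push_cast; congr 1; ring
  rw [this, ← Hn]; ring

open Classical in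
lemma h_sum (N : ℕ) (hN : 1 ≤ N) (θ : ℝ) :
    ∑ h ∈ Icc (1 : ℤ) N, Gw N (GI N (h * θ)) ≤
      4 * N * Hn N * (1 + (((Icc (1 : ℤ) N).filter (fun h : ℤ => NI (h * θ) (1 / N))).card : ℝ)) := by
  have hN' : (1 : ℝ) ≤ N := by exact_mod_cast hN
  set Z := ((Icc (1 : ℤ) N).filter (fun h : ℤ => NI (h * θ) (1 / N))) with hZ
  have hfib : ∀ i, ((Icc (1 : ℤ) N).filter (fun h : ℤ => GI N (h * θ) = i)).card ≤ 1 + Z.card := by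
    intro i
    set T := (Icc (1 : ℤ) N).filter (fun h : ℤ => GI N (h * θ) = i) with hT
    rcases T.eq_empty_or_nonempty with h | hne
    · rw [h]; simp
    set h0 := T.min' hne with hh0
    have hm0 : h0 ∈ T := T.min'_mem hne
    have hc : (T.erase h0).card ≤ Z.card := by
      refine card_le_card_of_injOn (fun h => h - h0) ?_ (fun a _ b _ hab => by simpa using hab)
      intro h hh
      have hh' := mem_erase.1 hh
      have hle := T.min'_le h hh'.2
      have q1 := mem_filter.1 hh'.2
      have q2 := mem_filter.1 hm0
      have q3 := mem_Icc.1 q1.1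
      have q4 := mem_Icc.1 q2.1
      have hne' := hh'.1
      simp only [mem_coe, hZ, mem_filter, mem_Icc]
      refine ⟨⟨by omega, by omega⟩, ⌊(h : ℝ) * θ⌋ - ⌊(h0 : ℝ) * θ⌋, ?_⟩
      have e : ((h - h0 : ℤ) : ℝ) * θ - ((⌊(h : ℝ) * θ⌋ - ⌊(h0 : ℝ) * θ⌋ : ℤ) : ℝ) =
          Int.fract (h * θ) - Int.fract (h0 * θ) := by
        push_cast; rw [← Int.self_sub_floor, ← Int.self_sub_floor]; ring
      rw [e]
      have f1 := Nat.floor_le (a := (N : ℝ) * Int.fract (h * θ)) (by have := Int.fract_nonneg ((h : ℝ) * θ); positivity)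
      have f2 := Nat.lt_floor_add_one ((N : ℝ) * Int.fract (h * θ))
      have f3 := Nat.floor_le (a := (N : ℝ) * Int.fract (h0 * θ)) (by have := Int.fract_nonneg ((h0 : ℝ) * θ); positivity)
      have f4 := Nat.lt_floor_add_one ((N : ℝ) * Int.fract (h0 * θ))
      have g1 := q1.2
      have g2 := q2.2
      unfold GI at g1 g2
      rw [g1] at f1 f2
      rw [g2] at f3 f4
      rw [abs_le, le_div_iff₀ (by linarith), ← neg_div, div_le_iff₀ (by linarith)]
      constructor <;> nlinarith
    have := card_erase_add_one hm0
    omega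
  calc ∑ h ∈ Icc (1 : ℤ) N, Gw N (GI N (h * θ))
      = ∑ i ∈ range N, ∑ h ∈ (Icc (1 : ℤ) N).filter (fun h : ℤ => GI N (h * θ) = i), Gw N (GI N (h * θ)) := by
        rw [sum_fiberwise_of_maps_to]
        intro h _; exact mem_range.2 (GI_lt N hN _)
    _ = ∑ i ∈ range N, (((Icc (1 : ℤ) N).filter (fun h : ℤ => GI N (h * θ) = i)).card : ℝ) * Gw N i := by
        refine sum_congr rfl fun i _ => ?_
        rw [← nsmul_eq_mul, ← sum_const]
        refine sum_congr rfl fun h hh => ?_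
        rw [(mem_filter.1 hh).2]
    _ ≤ ∑ i ∈ range N, (1 + (Z.card : ℝ)) * Gw N i := by
        refine sum_le_sum fun i hi => ?_
        refine mul_le_mul_of_nonneg_right ?_ (Gw_nonneg N i (mem_range.1 hi))
        exact_mod_cast hfib i
    _ = _ := by rw [← mul_sum, Gw_sum]; ring
end VMVT

namespace VMVT
open Finset

lemma sq_expand (c : ℕ → ℂ) (hc : ∀ x, ‖c x‖ = 1) (N : ℕ) :
    ‖∑ x ∈ range N, c x‖ ^ 2 ≤ N + 2 * ∑ h ∈ range N,
      ‖∑ x ∈ range (N - 1 - h), c (x + (h + 1)) * (starRingEnd ℂ) (c x)‖ := by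
  have h1 : ∀ N : ℕ, ‖∑ x ∈ range N, c x‖ ^ 2 = N + 2 * (∑ y ∈ range N, ∑ x ∈ range y, c y * (starRingEnd ℂ) (c x)).re := by
    intro N
    induction N with
    | zero => simp
    | succ N ih =>
      rw [sum_range_succ, sum_range_succ, Complex.sq_norm, add_comm, Complex.normSq_add, ← Complex.sq_norm,
        ← Complex.sq_norm, ih, hc, Complex.add_re, map_sum, mul_sum]
      push_cast; ring
  have h2 : ∑ y ∈ range N, ∑ x ∈ range y, c y * (starRingEnd ℂ) (c x) =
      ∑ h ∈ range N, ∑ x ∈ range (N - 1 - h), c (x + (h + 1)) * (starRingEnd ℂ) (c x) := by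
    rw [sum_sigma', sum_sigma']
    refine sum_bij' (fun p _ => ⟨p.1 - 1 - p.2, p.2⟩) (fun p _ => ⟨p.2 + (p.1 + 1), p.2⟩) ?_ ?_ ?_ ?_ ?_
    · rintro ⟨y, x⟩ h
      simp only [mem_sigma, mem_range] at h ⊢
      omega
    · rintro ⟨y, x⟩ h
      simp only [mem_sigma, mem_range] at h ⊢
      omega
    · rintro ⟨y, x⟩ h
      simp only [mem_sigma, mem_range] at h ⊢
      have : x + (y - 1 - x + 1) = y := by omega
      rw [this]
    · rintro ⟨y, x⟩ h
      simp only [mem_sigma, mem_range] at h ⊢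
      have : x + (y + 1) - 1 - x = y := by omega
      rw [this]
    · rintro ⟨y, x⟩ h
      simp only [mem_sigma, mem_range] at h ⊢
      have : x + (y - 1 - x + 1) = y := by omega
      rw [this]
  rw [h1 N, h2]
  have := (Complex.re_le_norm (∑ h ∈ range N, ∑ x ∈ range (N - 1 - h), c (x + (h + 1)) * (starRingEnd ℂ) (c x))).trans
    (norm_sum_le _ _)
  linarith

lemma sq_sum (Q : ℕ → ℝ) (n : ℕ) :
    ‖∑ x ∈ range n, ee (Q x)‖ ^ 2 ≤ ∑ s ∈ range (2 * n),
      ‖∑ x ∈ Ico (s + 1 - n) (min n (s + 1)), ee (Q x - Q (s - x))‖ := by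
  have h1 : ‖∑ x ∈ range n, ee (Q x)‖ ^ 2 = ‖∑ x ∈ range n, ∑ y ∈ range n, ee (Q x - Q y)‖ := by
    have : ∑ x ∈ range n, ∑ y ∈ range n, ee (Q x - Q y) =
        (∑ x ∈ range n, ee (Q x)) * (starRingEnd ℂ) (∑ x ∈ range n, ee (Q x)) := by
      rw [map_sum, sum_mul_sum]
      refine sum_congr rfl fun x _ => sum_congr rfl fun y _ => ?_
      rw [← ee_neg, ← ee_add, sub_eq_add_neg]
    rw [this, norm_mul, Complex.norm_conj, sq]
  have h2 : ∑ x ∈ range n, ∑ y ∈ range n, ee (Q x - Q y) =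
      ∑ s ∈ range (2 * n), ∑ x ∈ Ico (s + 1 - n) (min n (s + 1)), ee (Q x - Q (s - x)) := by
    rw [sum_sigma', sum_sigma']
    refine sum_bij' (fun p _ => ⟨p.1 + p.2, p.1⟩) (fun p _ => ⟨p.2, p.1 - p.2⟩) ?_ ?_ ?_ ?_ ?_
    · rintro ⟨x, y⟩ h
      simp only [mem_sigma, mem_range, mem_Ico, lt_min_iff] at h ⊢
      omega
    · rintro ⟨x, y⟩ h
      simp only [mem_sigma, mem_range, mem_Ico, lt_min_iff] at h ⊢
      omega
    · rintro ⟨x, y⟩ h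
      simp only [mem_sigma, mem_range] at h ⊢
      have : x + y - x = y := by omega
      rw [this]
    · rintro ⟨s, x⟩ h
      simp only [mem_sigma, mem_range, mem_Ico, lt_min_iff] at h ⊢
      have : x + (s - x) = s := by omega
      rw [this]
    · rintro ⟨x, y⟩ h
      simp only [mem_sigma, mem_range] at h ⊢
      have : x + y - x = y := by omega
      rw [this]
  rw [h1, h2]
  exact norm_sum_le _ _

lemma fin_arith (N H Z : ℝ) (hN : 1 ≤ N) (hH : 1 ≤ H) (hZ : 0 ≤ Z) :
    2 * N ^ 2 + 128 * N ^ 2 * H * N + 32 * N ^ 2 * H * Z ≤ 200 * N ^ 2 * H * (N + Z) := by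
  have k1 : N ^ 2 ≤ N ^ 2 * H * N := by
    have : 1 ≤ H * N := one_le_mul_of_one_le_of_one_le hH hN
    have h2 := mul_le_mul_of_nonneg_left this (sq_nonneg N)
    linarith
  have k2 : 0 ≤ N ^ 2 * H * Z := by positivity
  have k3 : 0 ≤ N ^ 2 * H * N := by positivity
  linarith

set_option maxHeartbeats 1000000 in
lemma weyl4 (a0 a1 a2 a3 : ℝ) (N : ℕ) (hN : 1 ≤ N) :
    ‖∑ x ∈ range N, ee (a0 + a1 * ((x : ℝ) + 1) + a2 * ((x : ℝ) + 1) ^ 2 + a3 * ((x : ℝ) + 1) ^ 3)‖ ^ 4 ≤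
      200 * (N : ℝ) ^ 2 * Hn N * (N + ∑ h ∈ Icc (1 : ℤ) N, ((Wset N (6 * a3) (4 * a2) h).card : ℝ)) := by
  classical
  have hN' : (1 : ℝ) ≤ N := by exact_mod_cast hN
  set P : ℕ → ℝ := fun x => a0 + a1 * ((x : ℝ) + 1) + a2 * ((x : ℝ) + 1) ^ 2 + a3 * ((x : ℝ) + 1) ^ 3 with hP
  set A := 6 * a3 with hA
  set B := 4 * a2 with hB
  set g : ℕ → ℝ := fun h => ‖∑ x ∈ range (N - 1 - h), ee (P (x + (h + 1))) * (starRingEnd ℂ) (ee (P x))‖ with hg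
  have h1 : ‖∑ x ∈ range N, ee (P x)‖ ^ 2 ≤ N + 2 * ∑ h ∈ range N, g h :=
    sq_expand (fun x => ee (P x)) (fun x => ee_norm _) N
  have hg2 : ∀ h ∈ range N, g h ^ 2 ≤ ∑ w ∈ Icc (0 : ℤ) (3 * N), Gw N (GI N (((h + 1 : ℕ) : ℤ) * (A * w + B))) := by
    intro h hh
    have hh := mem_range.1 hh
    set n := N - 1 - h with hn
    set Q : ℕ → ℝ := fun x => P (x + (h + 1)) - P x with hQ
    have e1 : g h = ‖∑ x ∈ range n, ee (Q x)‖ := by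
      simp only [hg]
      congr 1
      refine sum_congr rfl fun x _ => ?_
      rw [← ee_neg, ← ee_add, ← sub_eq_add_neg]
    rw [e1]
    refine (sq_sum Q n).trans ?_
    have e2 : ∀ s ∈ range (2 * n), ‖∑ x ∈ Ico (s + 1 - n) (min n (s + 1)), ee (Q x - Q (s - x))‖ ≤
        Gw N (GI N (((h + 1 : ℕ) : ℤ) * (A * ((s + 2 + (h + 1) : ℕ) : ℤ) + B))) := by
      intro s hs
      set ψ : ℝ := (((h + 1 : ℕ) : ℤ) : ℝ) * (A * (((s + 2 + (h + 1) : ℕ) : ℤ) : ℝ) + B) with hψ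
      have e3 : ∑ x ∈ Ico (s + 1 - n) (min n (s + 1)), ee (Q x - Q (s - x)) =
          (∑ x ∈ Ico (s + 1 - n) (min n (s + 1)), ee (x * ψ)) * ee (-(s * ψ / 2)) := by
        rw [sum_mul]
        refine sum_congr rfl fun x hx => ?_
        rw [← ee_add]
        congr 1
        have hx := mem_Ico.1 hx
        rw [lt_min_iff] at hx
        simp only [hQ, hP, hψ, hA, hB]
        push_cast [Nat.cast_sub (show x ≤ s by omega)]
        ring
      rw [e3, norm_mul, ee_norm, mul_one]
      exact geo N hN ψ _ _ (by have := min_le_left n (s + 1); omega)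
    refine (sum_le_sum e2).trans ?_
    rw [← sum_image (s := range (2 * n)) (g := fun s => ((s + 2 + (h + 1) : ℕ) : ℤ))
      (f := fun w : ℤ => Gw N (GI N (((h + 1 : ℕ) : ℤ) * (A * w + B))))]
    · refine sum_le_sum_of_subset_of_nonneg ?_ (fun w _ _ => Gw_nonneg N _ (GI_lt N hN _))
      intro w hw
      obtain ⟨s, hs, rfl⟩ := mem_image.1 hw
      have hs := mem_range.1 hs
      rw [mem_Icc]; omega
    · intro s _ s' _ he
      simp only at he
      omega
  have hg3 : ∑ h ∈ range N, g h ^ 2 ≤ 4 * N * Hn N * (4 * N + ∑ h ∈ Icc (1 : ℤ) N, ((Wset N A B h).card : ℝ)) := by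
    calc ∑ h ∈ range N, g h ^ 2
        ≤ ∑ h ∈ range N, ∑ w ∈ Icc (0 : ℤ) (3 * N), Gw N (GI N (((h + 1 : ℕ) : ℤ) * (A * w + B))) := sum_le_sum hg2
      _ = ∑ w ∈ Icc (0 : ℤ) (3 * N), ∑ h ∈ range N, Gw N (GI N (((h + 1 : ℕ) : ℤ) * (A * w + B))) := sum_comm
      _ ≤ ∑ w ∈ Icc (0 : ℤ) (3 * N), ∑ h ∈ Icc (1 : ℤ) N, Gw N (GI N (h * (A * w + B))) := by
        refine sum_le_sum fun w _ => ?_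
        rw [← sum_image (s := range N) (g := fun h => ((h + 1 : ℕ) : ℤ))
          (f := fun h : ℤ => Gw N (GI N (h * (A * w + B))))]
        · refine sum_le_sum_of_subset_of_nonneg ?_ (fun w _ _ => Gw_nonneg N _ (GI_lt N hN _))
          intro w hw
          obtain ⟨s, hs, rfl⟩ := mem_image.1 hw
          have hs := mem_range.1 hs
          rw [mem_Icc]; omega
        · intro s _ s' _ he
          simp only at he
          omega
      _ ≤ ∑ w ∈ Icc (0 : ℤ) (3 * N), 4 * N * Hn N *
          (1 + (((Icc (1 : ℤ) N).filter (fun h : ℤ => NI (h * (A * w + B)) (1 / N))).card : ℝ)) :=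
        sum_le_sum fun w _ => h_sum N hN _
      _ = 4 * N * Hn N * ((3 * N + 1) + ∑ w ∈ Icc (0 : ℤ) (3 * N),
          (((Icc (1 : ℤ) N).filter (fun h : ℤ => NI (h * (A * w + B)) (1 / N))).card : ℝ)) := by
        rw [← mul_sum, sum_add_distrib]
        congr 2
        rw [sum_const, Int.card_Icc, nsmul_eq_mul, mul_one]
        have : ((3 * N : ℤ) + 1 - 0).toNat = 3 * N + 1 := by omega
        rw [this]; push_cast; ring
      _ = 4 * N * Hn N * ((3 * N + 1) + ∑ h ∈ Icc (1 : ℤ) N, ((Wset N A B h).card : ℝ)) := by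
        congr 2
        have e : ∀ h : ℤ, Wset N A B h = (Icc (0 : ℤ) (3 * N)).filter (fun w : ℤ => NI (h * (A * w + B)) (1 / N)) := by
          intro h; ext w; rw [mem_Wset, mem_filter, mem_Icc]
        simp only [e, card_filter]
        push_cast
        rw [sum_comm]
      _ ≤ _ := by
        have := Hn_nonneg N
        gcongr
        linarith
  have hcs : (∑ h ∈ range N, g h) ^ 2 ≤ N * ∑ h ∈ range N, g h ^ 2 := by
    have := sq_sum_le_card_mul_sum_sq (s := range N) (f := g)
    rwa [card_range] at this
  have hH1 : 1 ≤ Hn N := by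
    unfold Hn
    calc (1 : ℝ) = 1 / (((0 : ℕ) : ℝ) + 1) := by norm_num
      _ ≤ _ := single_le_sum (f := fun t : ℕ => 1 / ((t : ℝ) + 1)) (fun t _ => by positivity) (mem_range.2 hN)
  set Z := ∑ h ∈ Icc (1 : ℤ) N, ((Wset N A B h).card : ℝ) with hZ
  have hZ0 : 0 ≤ Z := sum_nonneg fun _ _ => by positivity
  calc ‖∑ x ∈ range N, ee (P x)‖ ^ 4 = (‖∑ x ∈ range N, ee (P x)‖ ^ 2) ^ 2 := by ring
    _ ≤ (N + 2 * ∑ h ∈ range N, g h) ^ 2 := by gcongr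
    _ ≤ 2 * (N : ℝ) ^ 2 + 8 * (∑ h ∈ range N, g h) ^ 2 := by
      nlinarith [sq_nonneg ((N : ℝ) - 2 * ∑ h ∈ range N, g h)]
    _ ≤ 2 * (N : ℝ) ^ 2 + 8 * (N * (4 * N * Hn N * (4 * N + Z))) := by
      have := hcs.trans (mul_le_mul_of_nonneg_left hg3 (by positivity : (0:ℝ) ≤ N))
      linarith
    _ = 2 * (N : ℝ) ^ 2 + 128 * N ^ 2 * Hn N * N + 32 * N ^ 2 * Hn N * Z := by ring
    _ ≤ 200 * (N : ℝ) ^ 2 * Hn N * (N + Z) := fin_arith _ _ _ hN' hH1 hZ0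
end VMVT

namespace VMVT
open Finset

theorem weyl_three (ε : ℝ) (hε : 0 < ε) : ∃ C : ℝ, 1 ≤ C ∧
    ∀ (a : ℕ → ℝ) (b : ℤ) (q j N : ℕ), 0 < q → Int.gcd b q = 1 → 2 ≤ j → j ≤ 3 → 1 ≤ N →
      |a j - (b : ℝ) / q| ≤ ((q : ℝ) ^ 2)⁻¹ →
      ‖∑ x ∈ Icc 1 N, ee (∑ i ∈ range (3 + 1), a i * (x : ℝ) ^ i)‖ ^ 4 ≤
        C * (N : ℝ) ^ ((4 : ℕ) + ε) * (1 / (q : ℝ) + 1 / N + q / (N : ℝ) ^ j) := by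
  obtain ⟨C1, hC1, H1⟩ := harm (ε / 2) (by linarith)
  obtain ⟨C2, hC2, H2⟩ := Z_bound (ε / 2) (by linarith)
  refine ⟨200 * C1 * (1002 * C2), by nlinarith, ?_⟩
  intro a b q j N hq hg hj2 hj3 hN hα
  have hN' : (1 : ℝ) ≤ N := by exact_mod_cast hN
  have hN0 : (0 : ℝ) < N := by linarith
  have hq' : (0 : ℝ) < q := by exact_mod_cast hq
  set Br : ℝ := 1 / (q : ℝ) + 1 / N + q / (N : ℝ) ^ j with hBr
  have hBr0 : 0 ≤ Br := by positivity
  have hNB : (N : ℝ) ≤ N ^ 2 * Br := by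
    have e : (N : ℝ) ^ 2 * Br = N + (N ^ 2 * (1 / q) + N ^ 2 * (q / N ^ j)) := by
      rw [hBr]; field_simp; ring
    rw [e]
    have : 0 ≤ (N : ℝ) ^ 2 * (1 / q) + N ^ 2 * (q / N ^ j) := by positivity
    linarith
  have hZ : (∑ h ∈ Icc (1 : ℤ) N, ((Wset N (6 * a 3) (4 * a 2) h).card : ℝ)) ≤
      C2 * (N : ℝ) ^ (ε / 2) * (N + 1000 * (N ^ 2 * Br)) := by
    refine H2 N _ _ _ hN (by positivity) fun t ht1 ht2 E hE => ?_
    obtain rfl | rfl : j = 2 ∨ j = 3 := by omega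
    · have := step2b N hN _ _ q t hq' ht1 ht2
        (by have := hsep_of hq hg hα 4 (by norm_num) (by norm_num); exact_mod_cast this) E hE
      refine this.trans (le_of_eq ?_)
      rw [hBr]; field_simp; ring
    · have := step2a N hN _ _ q t hq' ht1 ht2
        (by have := hsep_of hq hg hα 6 (by norm_num) (by norm_num); exact_mod_cast this) E hE
      refine this.trans (le_of_eq ?_)
      rw [hBr]; field_simp; ring
  have hw := weyl4 (a 0) (a 1) (a 2) (a 3) N hN
  have hs : ∑ x ∈ Icc 1 N, ee (∑ i ∈ range (3 + 1), a i * (x : ℝ) ^ i) =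
      ∑ x ∈ range N, ee (a 0 + a 1 * ((x : ℝ) + 1) + a 2 * ((x : ℝ) + 1) ^ 2 + a 3 * ((x : ℝ) + 1) ^ 3) := by
    rw [← Finset.Ico_add_one_right_eq_Icc, Finset.sum_Ico_eq_sum_range]
    refine sum_congr (by simp) fun x _ => ?_
    simp only [sum_range_succ, sum_range_zero]
    push_cast
    congr 1
    ring
  rw [hs]
  refine hw.trans ?_
  have hp0 : 1 ≤ (N : ℝ) ^ (ε / 2) := Real.one_le_rpow hN' (by linarith)
  set n := (N : ℝ) ^ (ε / 2) with hn
  have hpw : (N : ℝ) ^ (((4 : ℕ) : ℝ) + ε) = N ^ 4 * (n * n) := by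
    rw [Real.rpow_add hN0, Real.rpow_natCast, hn, ← Real.rpow_add hN0]; congr 2; ring
  rw [hpw]
  have hZ2 : (N : ℝ) + ∑ h ∈ Icc (1 : ℤ) N, ((Wset N (6 * a 3) (4 * a 2) h).card : ℝ) ≤
      1002 * C2 * n * (N ^ 2 * Br) := by
    have h1 : (1 : ℝ) ≤ C2 * n := one_le_mul_of_one_le_of_one_le hC2 hp0
    have h2 : (N : ℝ) ≤ C2 * n * (N ^ 2 * Br) :=
      hNB.trans (le_mul_of_one_le_left (by positivity) h1)
    have h3 : C2 * n * N ≤ C2 * n * (N ^ 2 * Br) := mul_le_mul_of_nonneg_left hNB (by positivity)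
    linarith
  have hH := H1 N hN
  calc 200 * (N : ℝ) ^ 2 * Hn N * (N + ∑ h ∈ Icc (1 : ℤ) N, ((Wset N (6 * a 3) (4 * a 2) h).card : ℝ))
      ≤ 200 * (N : ℝ) ^ 2 * (C1 * n) * (1002 * C2 * n * (N ^ 2 * Br)) := by
        refine mul_le_mul (mul_le_mul_of_nonneg_left hH (by positivity)) hZ2 ?_ (by positivity)
        exact add_nonneg hN0.le (sum_nonneg fun _ _ => by positivity)
    _ = _ := by ring
end VMVT

namespace VMVT
open Finset

lemma fsum_eq (k : ℕ) (α : Fin k → ℝ) (X : ℝ) (a : ℕ → ℝ) (h0 : a 0 = 0)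
    (h1 : ∀ j : Fin k, a ((j : ℕ) + 1) = α j) :
    fsum k α X = ∑ x ∈ Icc 1 ⌊X⌋₊, ee (∑ i ∈ range (k + 1), a i * (x : ℝ) ^ i) := by
  unfold fsum ee
  refine sum_congr rfl fun x _ => ?_
  congr 3
  rw [Finset.sum_range_succ', h0, zero_mul, add_zero, Finset.sum_range]
  exact sum_congr rfl fun j _ => by rw [h1]

lemma root_step (F N X Br C ε σ : ℝ) (P : ℕ) (hP : 0 < P) (hF : 0 ≤ F) (hFN : F ≤ N) (hN : 1 ≤ N) (hNX : N ≤ X)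
    (hC : 1 ≤ C) (hε : 0 < ε) (hBr : 0 < Br) (hσ0 : 0 ≤ σ) (hσ : σ * P ≤ 1)
    (h : F ^ P ≤ C * N ^ ((P : ℝ) + P * ε) * Br) :
    F ≤ C * X ^ (1 + ε) * Br ^ σ := by
  have hX : 1 ≤ X := hN.trans hNX
  have hX0 : 0 < X := by linarith
  have hP' : (0 : ℝ) < P := by exact_mod_cast hP
  rcases le_total 1 Br with hb | hb
  · have e1 : 1 ≤ Br ^ σ := Real.one_le_rpow hb hσ0
    have e2 : X ≤ X ^ (1 + ε) := by
      calc X = X ^ (1 : ℝ) := (Real.rpow_one X).symm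
        _ ≤ _ := Real.rpow_le_rpow_of_exponent_le hX (by linarith)
    calc F ≤ 1 * X * 1 := by linarith
      _ ≤ C * X ^ (1 + ε) * Br ^ σ := by gcongr
  · have hr : (C * X ^ (1 + ε) * Br ^ σ) ^ P = C ^ P * X ^ ((P : ℝ) + P * ε) * Br ^ (σ * P) := by
      rw [mul_pow, mul_pow, ← Real.rpow_natCast (X ^ (1 + ε)), ← Real.rpow_natCast (Br ^ σ),
        ← Real.rpow_mul hX0.le, ← Real.rpow_mul hBr.le]
      congr 3; ring
    have hle : F ^ P ≤ (C * X ^ (1 + ε) * Br ^ σ) ^ P := by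
      rw [hr]
      refine h.trans ?_
      have e1 : Br ≤ Br ^ (σ * P) := by
        calc Br = Br ^ (1 : ℝ) := (Real.rpow_one _).symm
          _ ≤ _ := Real.rpow_le_rpow_of_exponent_ge hBr hb hσ
      have e2 : C ≤ C ^ P := le_self_pow₀ hC hP.ne'
      have e3 : N ^ ((P : ℝ) + P * ε) ≤ X ^ ((P : ℝ) + P * ε) :=
        Real.rpow_le_rpow (by linarith) hNX (by positivity)
      gcongr
    exact le_of_pow_le_pow_left₀ hP.ne' (by positivity) hle

lemma br_le (k j q : ℕ) (N X : ℝ) (hj : j ≤ k) (hN : 1 ≤ N) (hNX : X ≤ 2 * N) (hk : 1 ≤ k) (hX : 1 ≤ X) (hq : 0 < q) :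
    1 / (q : ℝ) + 1 / N + q / N ^ j ≤ 2 ^ k * ((q : ℝ)⁻¹ + X⁻¹ + (q : ℝ) * X ^ (-(j : ℝ))) := by
  have hX0 : 0 < X := by linarith
  have hq' : (0 : ℝ) < q := by exact_mod_cast hq
  rw [Real.rpow_neg hX0.le, Real.rpow_natCast]
  have h2 : (1 : ℝ) ≤ 2 ^ k := one_le_pow₀ (by norm_num)
  have h3 : (2 : ℝ) ≤ 2 ^ k := le_self_pow₀ (by norm_num) (by omega)
  have h4 : (2 : ℝ) ^ j ≤ 2 ^ k := pow_le_pow_right₀ (by norm_num) hj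
  have a1 : 1 / (q : ℝ) ≤ 2 ^ k * (q : ℝ)⁻¹ := by
    rw [one_div]; exact le_mul_of_one_le_left (by positivity) h2
  have a2 : 1 / N ≤ 2 ^ k * X⁻¹ := by
    rw [← div_eq_mul_inv, div_le_div_iff₀ (by linarith) hX0]
    nlinarith
  have a3 : q / N ^ j ≤ 2 ^ k * (q * (X ^ j)⁻¹) := by
    have e : X ^ j ≤ 2 ^ k * N ^ j := by
      calc X ^ j ≤ (2 * N) ^ j := by gcongr
        _ = 2 ^ j * N ^ j := by ring
        _ ≤ _ := by gcongr
    rw [← div_eq_mul_inv, ← mul_div_assoc, div_le_div_iff₀ (by positivity) (by positivity)]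
    nlinarith
  linarith

lemma weyl_all (k : ℕ) (hk : 3 ≤ k) (ε : ℝ) (hε : 0 < ε) : ∃ P : ℕ, 0 < P ∧
    1 / (2 * ((k : ℝ) - 1) * ((k : ℝ) - 2)) * P ≤ 1 ∧ ∃ C : ℝ, 1 ≤ C ∧
    ∀ (a : ℕ → ℝ) (b : ℤ) (q j N : ℕ), 0 < q → Int.gcd b q = 1 → 2 ≤ j → j ≤ k → 1 ≤ N →
      |a j - (b : ℝ) / q| ≤ ((q : ℝ) ^ 2)⁻¹ →
      ‖∑ x ∈ Icc 1 N, ee (∑ i ∈ range (k + 1), a i * (x : ℝ) ^ i)‖ ^ P ≤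
        C * (N : ℝ) ^ ((P : ℝ) + P * ε) * (1 / (q : ℝ) + 1 / N + q / (N : ℝ) ^ j) := by
  obtain rfl | hk4 : k = 3 ∨ 4 ≤ k := by omega
  · refine ⟨4, by norm_num, by norm_num, ?_⟩
    obtain ⟨C, hC, H⟩ := weyl_three ((4 : ℕ) * ε) (by positivity)
    exact ⟨C, hC, H⟩
  · have h2 := two_sN (k - 1)
    have hk1 : k - 1 + 1 = k := by omega
    have hP : 0 < 2 * sN (k - 1) := by
      rw [h2]; exact Nat.mul_pos (by omega) (by omega)
    refine ⟨2 * sN (k - 1), hP, ?_, ?_⟩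
    · rw [h2, hk1]
      have hk' : (4 : ℝ) ≤ k := by exact_mod_cast hk4
      have h1 : (0 : ℝ) < 2 * ((k : ℝ) - 1) * ((k : ℝ) - 2) := by
        apply mul_pos <;> linarith
      rw [div_mul_eq_mul_div, one_mul, div_le_one h1]
      push_cast [Nat.cast_sub (show 1 ≤ k by omega)]
      nlinarith
    · obtain ⟨C, hC, H⟩ := weyl_gen k (by omega) ((2 * sN (k - 1) : ℕ) * ε) (by positivity)
      refine ⟨C, hC, fun a b q j N h1 h2 h3 h4 h5 h6 => ?_⟩
      rw [pow_mul]
      exact H a b q j N h1 h2 h3 h4 h5 h6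
end VMVT

theorem weyl_type_estimate_efficient_congruencing (k : ℕ) (hk : 3 ≤ k) (ε : ℝ) (hε : ε > 0) :
    ∃ C : ℝ, ∀ (α : Fin k → ℝ) (a : ℤ) (q : ℕ) (j : Fin k),
      0 < q → Int.gcd a q = 1 → 1 ≤ (j : ℕ) →
      |α j - (a : ℝ) / q| ≤ ((q : ℝ) ^ 2)⁻¹ →
      ∀ X : ℝ, X ≥ 1 →
        ‖fsum k α X‖ ≤
          C * X ^ (1 + ε) *
            ((q : ℝ)⁻¹ + X⁻¹ + (q : ℝ) * X ^ (-(((j : ℕ) : ℝ) + 1))) ^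
              (1 / (2 * ((k : ℝ) - 1) * ((k : ℝ) - 2))) := by
  obtain ⟨P, hP, hσ, C, hC, H⟩ := VMVT.weyl_all k hk ε hε
  refine ⟨C * 2 ^ k, ?_⟩
  intro α b q j hq hg hj hα X hX
  have hk' : (3 : ℝ) ≤ k := by exact_mod_cast hk
  have hX0 : (0 : ℝ) ≤ X := by linarith
  have hq' : (0 : ℝ) < q := by exact_mod_cast hq
  set a : ℕ → ℝ := fun i => if h : 1 ≤ i ∧ i - 1 < k then α ⟨i - 1, h.2⟩ else 0 with ha
  have ha1 : ∀ j : Fin k, a ((j : ℕ) + 1) = α j := by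
    intro j
    have : 1 ≤ (j : ℕ) + 1 ∧ (j : ℕ) + 1 - 1 < k := ⟨by omega, by have := j.2; omega⟩
    simp only [ha, dif_pos this]
    congr 1
  have hN : 1 ≤ ⌊X⌋₊ := Nat.le_floor (by simpa using hX)
  have hN' : (1 : ℝ) ≤ (⌊X⌋₊ : ℝ) := by exact_mod_cast hN
  have hNX : (⌊X⌋₊ : ℝ) ≤ X := Nat.floor_le hX0
  have hXN : X ≤ 2 * (⌊X⌋₊ : ℝ) := by
    have := Nat.lt_floor_add_one X
    linarith
  have h := H a b q (j + 1) ⌊X⌋₊ hq hg (by omega) (by have := j.2; omega) hN (by rw [ha1]; exact hα)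
  rw [← VMVT.fsum_eq k α X a (by simp [ha]) ha1] at h
  have hbr := VMVT.br_le k (j + 1) q (⌊X⌋₊ : ℝ) X (by have := j.2; omega) hN' hXN (by omega) hX hq
  rw [Nat.cast_add, Nat.cast_one] at hbr
  set Br := ((q : ℝ)⁻¹ + X⁻¹ + (q : ℝ) * X ^ (-(((j : ℕ) : ℝ) + 1))) with hBr
  have hBr0 : 0 < Br := by positivity
  refine VMVT.root_step _ (⌊X⌋₊ : ℝ) X Br (C * 2 ^ k) ε _ P hP (norm_nonneg _) ?_ hN' hNX ?_ hε hBr0 ?_ hσ ?_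
  · rw [VMVT.fsum_eq k α X a (by simp [ha]) ha1]
    refine (norm_sum_le _ _).trans ?_
    simp
  · exact one_le_mul_of_one_le_of_one_le hC (one_le_pow₀ (by norm_num))
  · apply one_div_nonneg.2
    apply mul_nonneg <;> linarith
  · refine h.trans ?_
    calc _ ≤ C * (⌊X⌋₊ : ℝ) ^ ((P : ℝ) + P * ε) * (2 ^ k * Br) := by gcongr
      _ = _ := by ring
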